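/- Let R > 0 and a < b with ab > 0. Suppose (u,p) is a C^∞ pair on Ω_{a,b,3R} \ {x' = 0}, with u (−1)-homogeneous and p (−2)-homogeneous, solving the stationary Navier–Stokes equations −Δu + (u·∇)u + ∇p = 0, div u = 0 there, and suppose |u(x)|/|ln|x'|| → 0 as |x'| → 0 uniformly on Ω_{a,b,3R} \ {x' = 0}. Then: (i) for every s with 1 < s < 2 and every compact subinterval [a',b'] ⊂ (a,b), sup_{x₃∈[a',b']} ( ‖p(·,x₃)‖_{L^s(D_R)} + ‖∇_{x'} p(·,x₃)‖_{L^s(D_R)} ) < ∞; and (ii) for any a < a' < b' < b, ‖∇u‖_{L²(Ω_{a',b',R} \ Ω_{a',b',ε})} / √|ln ε| → 0 as ε → 0⁺. -/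

import Mathlib

noncomputable section

open Real Filter MeasureTheory Metric Topology
open scoped ENNReal InnerProductSpace

abbrev V3 := EuclideanSpace ℝ (Fin 3)
abbrev V2 := EuclideanSpace ℝ (Fin 2)

/-- standard basis vector in `ℝ³` -/
def e3 (j : Fin 3) : V3 := EuclideanSpace.single j 1

/-- partial derivative `∂_j f` -/
def pd (j : Fin 3) (f : V3 → ℝ) (x : V3) : ℝ := fderiv ℝ f x (e3 j)

/-- Laplacian on `ℝ³` -/
def lap3 (f : V3 → ℝ) (x : V3) : ℝ := ∑ j, pd j (fun y => pd j f y) x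

/-- stationary Navier–Stokes equations `-Δu + (u·∇)u + ∇p = 0`, `div u = 0` at `x` -/
def NSEq (u : V3 → V3) (p : V3 → ℝ) (x : V3) : Prop :=
  (∀ i, - lap3 (fun z => u z i) x + (∑ j, u x j * pd j (fun z => u z i) x) + pd i p x = 0)
  ∧ (∑ j, pd j (fun z => u z j) x) = 0

/-- stationary Euler equations `(u·∇)u + ∇p = 0`, `div u = 0` at `x` -/
def EulerEq (u : V3 → V3) (p : V3 → ℝ) (x : V3) : Prop :=
  (∀ i, (∑ j, u x j * pd j (fun z => u z i) x) + pd i p x = 0)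
  ∧ (∑ j, pd j (fun z => u z j) x) = 0

/-- south pole -/
def S3 : V3 := EuclideanSpace.single 2 (-1)
/-- north pole -/
def N3 : V3 := EuclideanSpace.single 2 1

/-- the unit sphere `S²` -/
def sphere2 : Set V3 := Metric.sphere (0 : V3) 1

/-- the open cone over a subset of the unit sphere -/
def cone3 (Ω : Set V3) : Set V3 := {x : V3 | x ≠ 0 ∧ (‖x‖⁻¹ • x) ∈ Ω}

/-- `|x'| = √(x₁² + x₂²)` -/
def rho (x : V3) : ℝ := Real.sqrt ((x 0) ^ 2 + (x 1) ^ 2)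

/-- the `x₃`-axis `{x' = 0}` -/
def axis3 : Set V3 := {x : V3 | x 0 = 0 ∧ x 1 = 0}

/-- `Ω_{a,b,R} = {a < x₃ < b, |x'| < R}` -/
def OmegaR (a b R : ℝ) : Set V3 := {x : V3 | a < x 2 ∧ x 2 < b ∧ rho x < R}

/-- build a point of `ℝ³` from `x' ∈ ℝ²` and `x₃ ∈ ℝ` -/
def emb (y : V2) (t : ℝ) : V3 := (EuclideanSpace.equiv (Fin 3) ℝ).symm ![y 0, y 1, t]

/-- spherical component `u_r = u · e_r` -/
def uRc (u : V3 → V3) (x : V3) : ℝ := (u x 0 * x 0 + u x 1 * x 1 + u x 2 * x 2) / ‖x‖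

/-- spherical component `u_θ = u · e_θ` -/
def uTc (u : V3 → V3) (x : V3) : ℝ :=
  (u x 0 * x 0 * x 2 + u x 1 * x 1 * x 2) / (‖x‖ * rho x) - u x 2 * rho x / ‖x‖

/-- spherical component `u_φ = u · e_φ` -/
def uPc (u : V3 → V3) (x : V3) : ℝ := (-(u x 0) * x 1 + u x 1 * x 0) / rho x

/-- axisymmetry on a set: the spherical components are independent of the meridian angle -/
def AxisymOn (u : V3 → V3) (Ω : Set V3) : Prop :=
  ∀ x ∈ Ω, ∀ y ∈ Ω, ‖x‖ = ‖y‖ → x 2 = y 2 →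
    uRc u x = uRc u y ∧ uTc u x = uTc u y ∧ uPc u x = uPc u y

/-- spherical frame vector `e_r` -/
def eRv (x : V3) : V3 := ‖x‖⁻¹ • x

/-- spherical frame vector `e_θ` -/
def eThv (x : V3) : V3 := (EuclideanSpace.equiv (Fin 3) ℝ).symm
  ![x 2 * x 0 / (‖x‖ * rho x), x 2 * x 1 / (‖x‖ * rho x), -(rho x) / ‖x‖]

/-- spherical frame vector `e_φ` -/
def ePhv (x : V3) : V3 := (EuclideanSpace.equiv (Fin 3) ℝ).symm ![-(x 1) / rho x, x 0 / rho x, 0]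

/-- the spherical cap `S² ∩ B_δ(S) \ {S}` -/
def NSCap (δ : ℝ) : Set V3 := (sphere2 ∩ Metric.ball S3 δ) \ {S3}

/-- the spherical cap `S² ∩ B_δ(S)` -/
def NSCapFull (δ : ℝ) : Set V3 := sphere2 ∩ Metric.ball S3 δ

section
/-- twice the d-bar derivative -/
def db (h : ℂ → ℂ) (z : ℂ) : ℂ := fderiv ℝ h z 1 + Complex.I * fderiv ℝ h z Complex.I

lemma db_rot (D : ℂ →L[ℝ] ℂ) (θ : ℝ) :
    D (Complex.exp (θ * Complex.I)) + Complex.I * D (Complex.I * Complex.exp (θ * Complex.I))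
      = Complex.exp (-(θ * Complex.I)) * (D 1 + Complex.I * D Complex.I) := by
  have e1 : Complex.exp (θ * Complex.I) = (Real.cos θ) • (1:ℂ) + (Real.sin θ) • Complex.I := by
    rw [Complex.exp_mul_I]; simp
  have e2 : Complex.I * Complex.exp (θ * Complex.I)
      = (-Real.sin θ) • (1:ℂ) + (Real.cos θ) • Complex.I := by
    rw [Complex.exp_mul_I]; simp
    linear_combination (Complex.sin θ) * Complex.I_mul_I
  have e3 : Complex.exp (-(θ * Complex.I)) = Real.cos θ - Real.sin θ * Complex.I := by
    rw [show -(θ * Complex.I) = (-(θ:ℂ)) * Complex.I by ring, Complex.exp_mul_I]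
    simp [sub_eq_add_neg]
  rw [e2, e1, e3, map_add, map_add, map_smul, map_smul, map_smul, map_smul]
  simp only [Complex.real_smul]
  push_cast
  linear_combination ((Complex.sin θ) * D Complex.I) * Complex.I_mul_I

lemma circ_hasDerivAt_radius (z0 : ℂ) (s θ : ℝ) :
    HasDerivAt (fun s : ℝ => circleMap z0 s θ) (Complex.exp (θ * Complex.I)) s := by
  unfold circleMap
  have h : HasDerivAt (fun s : ℝ => (s:ℂ)) 1 s := Complex.ofRealCLM.hasDerivAt
  simpa using (h.mul_const (Complex.exp (θ * Complex.I))).const_add z0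

lemma circ_deriv {O : Set ℂ} (hO : IsOpen O) {h : ℂ → ℂ} (hh : ContDiffOn ℝ 1 h O)
    {z0 : ℂ} {s : ℝ} (hs : 0 ≤ s) (hsub : sphere z0 s ⊆ O) :
    HasDerivAt (fun s : ℝ => ∫ θ in (0:ℝ)..(2 * π), h (circleMap z0 s θ))
      (∫ θ in (0:ℝ)..(2 * π), Complex.exp (-(θ * Complex.I)) * db h (circleMap z0 s θ)) s := by
  have hmem : ∀ θ, circleMap z0 s θ ∈ O := fun θ => hsub (circleMap_mem_sphere z0 hs θ)
  obtain ⟨δ, hδ, hδO⟩ := (isCompact_sphere z0 s).exists_cthickening_subset_open hO hsub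
  have hcomp : IsCompact (cthickening δ (sphere z0 s)) := (isCompact_sphere z0 s).cthickening
  have hfd : ContinuousOn (fderiv ℝ h) O := hh.continuousOn_fderiv_of_isOpen hO le_rfl
  have hdiff : ∀ z ∈ O, DifferentiableAt ℝ h z := fun z hz =>
    (hh.differentiableOn one_ne_zero).differentiableAt (hO.mem_nhds hz)
  have hmem2 : ∀ x ∈ ball s δ, ∀ θ, circleMap z0 x θ ∈ cthickening δ (sphere z0 s) := by
    intro x hx θ
    apply mem_cthickening_of_dist_le _ (circleMap z0 s θ) _ _ (circleMap_mem_sphere z0 hs θ)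
    rw [mem_ball, Real.dist_eq] at hx
    have : circleMap z0 x θ - circleMap z0 s θ = ((x - s : ℝ):ℂ) * Complex.exp (θ * Complex.I) := by
      simp [circleMap]; ring
    rw [dist_eq_norm, this, norm_mul, Complex.norm_exp_ofReal_mul_I, Complex.norm_real,
      Real.norm_eq_abs, mul_one]
    exact hx.le
  obtain ⟨C, hC⟩ := hcomp.exists_bound_of_continuousOn (hfd.mono hδO)
  have hcirc : ∀ x : ℝ, Continuous (circleMap z0 x) := fun x => continuous_circleMap z0 x
  have hcon : ∀ x ∈ ball s δ, Continuous fun θ => h (circleMap z0 x θ) := fun x hx =>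
    hh.continuousOn.comp_continuous (hcirc x) (fun θ => hδO (hmem2 x hx θ))
  have hfdc : Continuous fun θ => fderiv ℝ h (circleMap z0 s θ) :=
    hfd.comp_continuous (hcirc s) hmem
  have hexp : Continuous fun θ : ℝ => Complex.exp (θ * Complex.I) := by fun_prop
  have key := (intervalIntegral.hasDerivAt_integral_of_dominated_loc_of_deriv_le
    (F := fun (x:ℝ) θ => h (circleMap z0 x θ))
    (F' := fun (x:ℝ) (θ:ℝ) => fderiv ℝ h (circleMap z0 x θ) (Complex.exp (θ * Complex.I)))
    (bound := fun _ => C) (a := 0) (b := 2 * π) (μ := volume) (ball_mem_nhds s hδ)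
    (Filter.eventually_of_mem (ball_mem_nhds s hδ)
      (fun x hx => (hcon x hx).aestronglyMeasurable))
    ((hcon s (mem_ball_self hδ)).intervalIntegrable _ _)
    ((hfdc.clm_apply hexp).aestronglyMeasurable)
    (ae_of_all _ fun θ _ x hx => by
      refine (ContinuousLinearMap.le_opNorm _ _).trans ?_
      rw [Complex.norm_exp_ofReal_mul_I, mul_one]
      exact hC _ (hmem2 x hx θ))
    (continuous_const.intervalIntegrable _ _)
    (ae_of_all _ fun θ _ x hx =>
      (hdiff _ (hδO (hmem2 x hx θ))).hasFDerivAt.comp_hasDerivAt x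
        (circ_hasDerivAt_radius z0 x θ))).2
  suffices hEq : (∫ θ in (0:ℝ)..(2 * π), Complex.exp (-(θ * Complex.I)) * db h (circleMap z0 s θ))
      = ∫ θ in (0:ℝ)..(2 * π), fderiv ℝ h (circleMap z0 s θ) (Complex.exp (θ * Complex.I)) by
    rw [hEq]; exact key
  have h0 : ∫ θ in (0:ℝ)..(2 * π), fderiv ℝ h (circleMap z0 s θ)
      (Complex.I * Complex.exp (θ * Complex.I)) = 0 := by
    rcases hs.eq_or_lt with hs0 | hs0
    · subst hs0
      simp only [circleMap_zero_radius, Function.const_apply]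
      rw [ContinuousLinearMap.intervalIntegral_comp_comm]
      · rw [intervalIntegral.integral_const_mul]
        have : ∫ θ in (0:ℝ)..(2 * π), Complex.exp (θ * Complex.I) = 0 := by
          have := integral_exp_mul_complex (a := 0) (b := 2 * π) Complex.I_ne_zero
          have h3 : ∀ θ : ℝ, Complex.exp (θ * Complex.I) = Complex.exp (Complex.I * θ) :=
            fun θ => by rw [mul_comm]
          simp only [h3]
          rw [this, mul_comm Complex.I]; simp [Complex.exp_two_pi_mul_I]
        rw [this]; simp
      · exact (continuous_const.mul hexp).intervalIntegrable _ _
    · have hd : ∀ θ : ℝ, HasDerivAt (fun θ => h (circleMap z0 s θ))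
          (fderiv ℝ h (circleMap z0 s θ) (s • (Complex.I * Complex.exp (θ * Complex.I)))) θ := by
        intro θ
        have := (hdiff _ (hmem θ)).hasFDerivAt.comp_hasDerivAt θ (hasDerivAt_circleMap z0 s θ)
        have e : s • (Complex.I * Complex.exp (θ * Complex.I)) = circleMap 0 s θ * Complex.I := by
          simp [circleMap]; ring
        rw [e]; exact this
      have := intervalIntegral.integral_eq_sub_of_hasDerivAt (a := 0) (b := 2 * π)
        (fun θ _ => hd θ) ((hfdc.clm_apply (by fun_prop)).intervalIntegrable _ _)
      have hms : ∀ θ : ℝ, fderiv ℝ h (circleMap z0 s θ) (s • (Complex.I * Complex.exp (θ * Complex.I)))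
          = s • fderiv ℝ h (circleMap z0 s θ) (Complex.I * Complex.exp (θ * Complex.I)) :=
        fun θ => ContinuousLinearMap.map_smul_of_tower _ _ _
      simp only [hms] at this
      rw [intervalIntegral.integral_smul] at this
      have h2 : circleMap z0 s (2 * π) = circleMap z0 s 0 := by
        simpa using periodic_circleMap z0 s 0
      rw [h2, sub_self] at this
      exact (smul_eq_zero.mp this).resolve_left hs0.ne'
  have : ∀ θ : ℝ, Complex.exp (-(θ * Complex.I)) * db h (circleMap z0 s θ) =
      fderiv ℝ h (circleMap z0 s θ) (Complex.exp (θ * Complex.I))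
      + Complex.I * fderiv ℝ h (circleMap z0 s θ) (Complex.I * Complex.exp (θ * Complex.I)) :=
    fun θ => (db_rot _ θ).symm
  simp only [this]
  have hc2 : Continuous fun θ : ℝ => Complex.I * fderiv ℝ h (circleMap z0 s θ)
      (Complex.I * Complex.exp (θ * Complex.I)) :=
    continuous_const.mul (hfdc.clm_apply (continuous_const.mul hexp))
  rw [intervalIntegral.integral_add ((hfdc.clm_apply hexp).intervalIntegrable _ _)
    (hc2.intervalIntegrable _ _), intervalIntegral.integral_const_mul, h0]
  simp

end

section
lemma db_mul {f g : ℂ → ℂ} {z : ℂ} (hf : DifferentiableAt ℝ f z) (hg : DifferentiableAt ℝ g z) :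
    db (fun z => f z * g z) z = f z * db g z + g z * db f z := by
  unfold db
  rw [fderiv_fun_mul hf hg]
  simp only [add_apply, ContinuousLinearMap.smul_apply, smul_eq_mul]
  ring

lemma db_sub_const (z0 z : ℂ) : db (fun z => z - z0) z = 0 := by
  unfold db
  rw [fderiv_sub_const, fderiv_fun_id]
  simp

lemma db_id (z : ℂ) : db (fun z => z) z = 0 := by
  unfold db
  rw [fderiv_fun_id]
  simp

lemma norm_circ_integral_le {F : ℝ → ℂ} {K : ℝ} (hF : ∀ θ, ‖F θ‖ ≤ K) :
    ‖∫ θ in (0:ℝ)..(2 * π), F θ‖ ≤ 2 * π * K := by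
  have := intervalIntegral.norm_integral_le_of_norm_le_const (a := 0) (b := 2 * π) (f := F) (C := K)
    (fun x _ => hF x)
  rw [sub_zero, abs_of_pos two_pi_pos] at this
  linarith

lemma norm_exp_neg_I (θ : ℝ) : ‖Complex.exp (-(θ * Complex.I))‖ = 1 := by
  have : -((θ:ℂ) * Complex.I) = ((-θ : ℝ):ℂ) * Complex.I := by push_cast; ring
  rw [this, Complex.norm_exp_ofReal_mul_I]

lemma interior_est {O : Set ℂ} (hO : IsOpen O) {φ g : ℂ → ℂ} (hφ : ContDiffOn ℝ 1 φ O)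
    (hg : ContDiffOn ℝ 1 g O) {z0 : ℂ} {ρ : ℝ} (hρ : 0 < ρ) (hsub : closedBall z0 ρ ⊆ O)
    (τ : ℂ →L[ℝ] ℂ) {Φ K E : ℝ} (h1 : ∀ z ∈ closedBall z0 ρ, ‖φ z‖ ≤ Φ)
    (h2 : ∀ z ∈ closedBall z0 ρ, ‖db g z‖ ≤ K)
    (h3 : ∀ z ∈ closedBall z0 ρ, ‖db φ z - τ (g z)‖ ≤ E) :
    ‖τ (g z0)‖ ≤ 2 * Φ / ρ + 2 * E + 2 * ‖τ‖ * K * ρ := by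
  have hdφ : ∀ z ∈ O, DifferentiableAt ℝ φ z := fun z hz =>
    (hφ.differentiableOn one_ne_zero).differentiableAt (hO.mem_nhds hz)
  have hcirc : ∀ s ∈ Set.Icc 0 ρ, ∀ θ, circleMap z0 s θ ∈ closedBall z0 ρ := fun s hs θ =>
    closedBall_subset_closedBall hs.2 (circleMap_mem_closedBall z0 hs.1 θ)
  have hsph : ∀ s ∈ Set.Icc 0 ρ, sphere z0 s ⊆ O := fun s hs =>
    sphere_subset_closedBall.trans ((closedBall_subset_closedBall hs.2).trans hsub)
  have hz0 : z0 ∈ closedBall z0 ρ := mem_closedBall_self hρ.le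
  have hK : 0 ≤ K := (norm_nonneg _).trans (h2 z0 hz0)
  have hE : 0 ≤ E := (norm_nonneg _).trans (h3 z0 hz0)
  have hπ := pi_pos
  set Ig : ℝ → ℂ := fun s => ∫ θ in (0:ℝ)..(2 * π), g (circleMap z0 s θ) with hIg
  set ψ : ℂ → ℂ := fun z => (z - z0) * φ z with hψ
  have hψc : ContDiffOn ℝ 1 ψ O := (contDiff_id.sub contDiff_const).contDiffOn.mul hφ
  set J : ℝ → ℂ := fun s => ∫ θ in (0:ℝ)..(2 * π), ψ (circleMap z0 s θ) with hJ
  have dIg : ∀ s ∈ Set.Icc 0 ρ, HasDerivAt Ig _ s := fun s hs => circ_deriv hO hg hs.1 (hsph s hs)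
  have bIg : ∀ s ∈ Set.Icc 0 ρ, ‖Ig s - Ig 0‖ ≤ 2 * π * K * (s - 0) := by
    intro s hs
    have := (convex_Icc 0 ρ).norm_image_sub_le_of_norm_hasDerivWithin_le (f := Ig)
      (C := 2 * π * K) (fun x hx => (dIg x hx).hasDerivWithinAt)
      (fun x hx => norm_circ_integral_le fun θ => by
        rw [norm_mul, norm_exp_neg_I, one_mul]; exact h2 _ (hcirc x hx θ))
      (Set.left_mem_Icc.2 hρ.le) hs
    rwa [Real.norm_eq_abs, abs_of_nonneg (by linarith [hs.1])] at this
  have Ig0 : Ig 0 = 2 * π * g z0 := by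
    simp only [hIg, circleMap_zero_radius, Function.const_apply]
    rw [intervalIntegral.integral_const]
    simp
  have dJ : ∀ s ∈ Set.Icc 0 ρ, HasDerivAt J
      ((s:ℂ) * ∫ θ in (0:ℝ)..(2 * π), db φ (circleMap z0 s θ)) s := by
    intro s hs
    have := circ_deriv hO hψc hs.1 (hsph s hs)
    rw [← intervalIntegral.integral_const_mul]
    have hEq : ∀ θ : ℝ, (s:ℂ) * db φ (circleMap z0 s θ)
        = Complex.exp (-(θ * Complex.I)) * db ψ (circleMap z0 s θ) := by
      intro θ
      rw [hψ, db_mul (by fun_prop) (hdφ _ (hsub (hcirc s hs θ))), db_sub_const]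
      simp only [circleMap, add_sub_cancel_left, mul_zero, add_zero]
      have : Complex.exp (-(θ * Complex.I)) * Complex.exp (θ * Complex.I) = 1 := by
        rw [← Complex.exp_add]; simp
      linear_combination (-(s:ℂ) * db φ (z0 + s * Complex.exp (θ * Complex.I))) * this
    rw [intervalIntegral.integral_congr (fun θ _ => hEq θ)]
    exact this
  set T : ℝ → ℂ := fun s => J s - ((s ^ 2 * π : ℝ):ℂ) * τ (g z0) with hT
  have hcdb : ∀ s ∈ Set.Icc 0 ρ, Continuous fun θ => db φ (circleMap z0 s θ) := by
    intro s hs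
    have hfd : ContinuousOn (fderiv ℝ φ) O := hφ.continuousOn_fderiv_of_isOpen hO le_rfl
    have hc := hfd.comp_continuous (continuous_circleMap z0 s) (fun θ => hsub (hcirc s hs θ))
    unfold db
    exact (hc.clm_apply continuous_const).add (continuous_const.mul (hc.clm_apply continuous_const))
  have hcg : ∀ s ∈ Set.Icc 0 ρ, Continuous fun θ => g (circleMap z0 s θ) := fun s hs =>
    hg.continuousOn.comp_continuous (continuous_circleMap z0 s) (fun θ => hsub (hcirc s hs θ))
  have dT : ∀ s ∈ Set.Icc 0 ρ, HasDerivAt T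
      ((s:ℂ) * ((∫ θ in (0:ℝ)..(2 * π), (db φ (circleMap z0 s θ) - τ (g (circleMap z0 s θ))))
        + τ (Ig s - Ig 0))) s := by
    intro s hs
    have e1 : HasDerivAt (fun s : ℝ => ((s ^ 2 * π : ℝ):ℂ) * τ (g z0))
        (((2 * s * π : ℝ):ℂ) * τ (g z0)) s := by
      have : HasDerivAt (fun s : ℝ => s ^ 2 * π) (2 * s * π) s := by
        simpa using (hasDerivAt_pow 2 s).mul_const π
      exact (this.ofReal_comp).mul_const _
    have e2 := (dJ s hs).sub e1
    have e3 : (s:ℂ) * ((∫ θ in (0:ℝ)..(2 * π), (db φ (circleMap z0 s θ) - τ (g (circleMap z0 s θ))))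
        + τ (Ig s - Ig 0)) = (s:ℂ) * (∫ θ in (0:ℝ)..(2 * π), db φ (circleMap z0 s θ))
          - ((2 * s * π : ℝ):ℂ) * τ (g z0) := by
      have hτc : Continuous fun θ => τ (g (circleMap z0 s θ)) := τ.continuous.comp (hcg s hs)
      rw [intervalIntegral.integral_sub ((hcdb s hs).intervalIntegrable _ _)
        (hτc.intervalIntegrable _ _)]
      have e4 : ∫ θ in (0:ℝ)..(2 * π), τ (g (circleMap z0 s θ)) = τ (Ig s) :=
        τ.intervalIntegral_comp_comm ((hcg s hs).intervalIntegrable _ _)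
      have e5 : τ (2 * π * g z0) = 2 * π * τ (g z0) := by
        have := τ.map_smul_of_tower (2 * π) (g z0)
        simpa using this
      rw [e4, map_sub, Ig0, e5]
      push_cast; ring
    rw [e3]; exact e2
  have bT := (convex_Icc 0 ρ).norm_image_sub_le_of_norm_hasDerivWithin_le (f := T)
      (C := ρ * (2 * π * E + ‖τ‖ * (2 * π * K * ρ))) (fun x hx => (dT x hx).hasDerivWithinAt)
      (fun x hx => by
        rw [norm_mul, Complex.norm_real, Real.norm_eq_abs, abs_of_nonneg hx.1]
        apply mul_le_mul hx.2 _ (norm_nonneg _) hρ.le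
        refine (norm_add_le _ _).trans (add_le_add ?_ ?_)
        · exact norm_circ_integral_le fun θ => h3 _ (hcirc x hx θ)
        · refine (τ.le_opNorm _).trans (mul_le_mul_of_nonneg_left ?_ (norm_nonneg _))
          refine (bIg x hx).trans ?_
          rw [sub_zero]
          exact mul_le_mul_of_nonneg_left hx.2 (by positivity))
      (Set.left_mem_Icc.2 hρ.le) (Set.right_mem_Icc.2 hρ.le)
  rw [sub_zero, Real.norm_eq_abs, abs_of_pos hρ] at bT
  have T0 : T 0 = 0 := by simp [hT, hJ, hψ]
  rw [T0, sub_zero] at bT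
  have bJ : ‖J ρ‖ ≤ 2 * π * (ρ * Φ) := norm_circ_integral_le fun θ => by
    rw [hψ, norm_mul]
    have hm := hcirc ρ (Set.right_mem_Icc.2 hρ.le) θ
    exact mul_le_mul (by simpa [dist_eq_norm] using hm) (h1 _ hm) (norm_nonneg _) hρ.le
  have fin : ρ ^ 2 * π * ‖τ (g z0)‖ ≤ ‖J ρ‖ + ‖T ρ‖ := by
    have : ((ρ ^ 2 * π : ℝ):ℂ) * τ (g z0) = J ρ - T ρ := by simp [hT]
    calc ρ ^ 2 * π * ‖τ (g z0)‖ = ‖((ρ ^ 2 * π : ℝ):ℂ) * τ (g z0)‖ := by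
          rw [norm_mul, Complex.norm_real, Real.norm_eq_abs, abs_of_pos (by positivity)]
      _ ≤ _ := by rw [this]; exact norm_sub_le _ _
  have fin2 : ρ ^ 2 * π * ‖τ (g z0)‖ ≤ ρ ^ 2 * π * (2 * Φ / ρ + 2 * E + 2 * ‖τ‖ * K * ρ) := by
    refine (fin.trans (add_le_add bJ bT)).trans (le_of_eq ?_)
    field_simp
    ring
  exact le_of_mul_le_mul_left fin2 (by positivity)

/-- absorption lemma -/
lemma absorb {F : ℂ → ℝ} {r1 A B α β : ℝ} (hr1 : 0 < r1) (hα : 0 < α) (hβ : 0 < β) (hA : 0 ≤ A)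
    (hB : 0 ≤ B)
    (hFc : ContinuousOn F {z : ℂ | 0 < ‖z‖ ∧ ‖z‖ < r1}) (hF0 : ∀ z, 0 ≤ F z)
    (h : ∀ z0 : ℂ, ∀ ρ S : ℝ, 0 < ρ → 2 * ρ ≤ ‖z0‖ → ‖z0‖ + ρ < r1 → 
      (∀ z ∈ closedBall z0 ρ, F z ≤ S) → F z0 ≤ A * ρ ^ (-α) + B * ρ ^ β * S) :
    ∃ C, 0 ≤ C ∧ ∀ z : ℂ, 0 < ‖z‖ → ‖z‖ < r1 / 2 → F z ≤ C * ‖z‖ ^ (-α) := by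
  -- choice of κ
  obtain ⟨κ, hκ0, hκ1, hκ⟩ : ∃ κ : ℝ, 0 < κ ∧ κ ≤ 1 / 2 ∧ B * (κ * r1) ^ β * 2 ^ α ≤ 1 / 2 := by
    have ht : Tendsto (fun κ : ℝ => B * (κ * r1) ^ β * 2 ^ α) (𝓝[>] 0) (𝓝 0) := by
      have : Tendsto (fun κ : ℝ => B * (κ * r1) ^ β * 2 ^ α) (𝓝 0) (𝓝 (B * (0 * r1) ^ β * 2 ^ α)) := by
        apply ContinuousAt.tendsto
        have : ContinuousAt (fun κ : ℝ => (κ * r1) ^ β) 0 :=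
          ContinuousAt.rpow_const (by fun_prop) (Or.inr hβ.le)
        fun_prop
      rw [zero_mul, Real.zero_rpow hβ.ne', mul_zero, zero_mul] at this
      exact this.mono_left nhdsWithin_le_nhds
    have e1 := ht.eventually (gt_mem_nhds (show (0:ℝ) < 1/2 by norm_num))
    have e2 : ∀ᶠ κ : ℝ in 𝓝[>] 0, κ ≤ 1 / 2 :=
      (nhdsWithin_le_nhds (Iic_mem_nhds (by norm_num)))
    obtain ⟨κ, h1, h2, h3⟩ := (e1.and (e2.and self_mem_nhdsWithin)).exists
    exact ⟨κ, h3, h2, h1.le⟩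
  refine ⟨2 * A * κ ^ (-α) * 2 ^ α, by positivity, fun z0 hz0 hz1 => ?_⟩
  set R := ‖z0‖ / 2 with hR
  have hRpos : 0 < R := by positivity
  have hin : ∀ z ∈ closedBall z0 R, R ≤ ‖z‖ ∧ ‖z‖ ≤ 3 * R := by
    intro z hz
    rw [mem_closedBall, dist_eq_norm] at hz
    have a1 := norm_sub_norm_le z0 z
    have a2 := norm_sub_norm_le z z0
    rw [norm_sub_rev] at a1
    constructor <;> linarith
  have hsub : closedBall z0 R ⊆ {z : ℂ | 0 < ‖z‖ ∧ ‖z‖ < r1} := fun z hz =>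
    ⟨hRpos.trans_le (hin z hz).1, by linarith [(hin z hz).2]⟩
  -- weighted sup
  set G : ℂ → ℝ := fun z => (R - ‖z - z0‖) ^ α * F z with hG
  have hGc : ContinuousOn G (closedBall z0 R) := by
    apply ContinuousOn.mul _ (hFc.mono hsub)
    exact ContinuousOn.rpow_const (by fun_prop) (fun _ _ => Or.inr hα.le)
  obtain ⟨zm, hzm, hmax⟩ := (isCompact_closedBall z0 R).exists_isMaxOn
    ⟨z0, mem_closedBall_self hRpos.le⟩ hGc
  set X := G zm with hX
  have hmax' : ∀ z ∈ closedBall z0 R, G z ≤ X := fun z hz => hmax hz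
  have hX0 : 0 ≤ X := by
    have : 0 ≤ R - ‖zm - z0‖ := by
      rw [mem_closedBall, dist_eq_norm] at hzm; linarith
    exact mul_nonneg (rpow_nonneg this _) (hF0 _)
  have claim : X ≤ A * κ ^ (-α) + 1 / 2 * X := by
    set d := R - ‖zm - z0‖ with hd
    have hzm' := hzm
    rw [mem_closedBall, dist_eq_norm] at hzm'
    rcases (show 0 ≤ d by linarith).eq_or_lt with hd0 | hd0
    · have : X = 0 := by
        rw [hX, hG]; simp only []
        rw [← hd, ← hd0, Real.zero_rpow hα.ne', zero_mul]
      rw [this]; positivity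
    · have hzn := hin zm hzm
      have hdR : d ≤ R := by linarith [norm_nonneg (zm - z0)]
      have hκd : κ * d ≤ d / 2 := by nlinarith
      have := h zm (κ * d) (X * (d / 2) ^ (-α)) (by positivity) (by linarith) (by linarith) (by
        intro z hz
        rw [mem_closedBall, dist_eq_norm] at hz
        have t : ‖z - z0‖ ≤ ‖z - zm‖ + ‖zm - z0‖ := by
          simpa using norm_add_le (z - zm) (zm - z0)
        have hdz : d / 2 ≤ R - ‖z - z0‖ := by linarith
        have := hmax' z (by rw [mem_closedBall, dist_eq_norm]; linarith)
        have h5 : (d / 2) ^ α * F z ≤ X := le_trans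
          (mul_le_mul_of_nonneg_right (Real.rpow_le_rpow (by positivity) hdz hα.le) (hF0 z)) this
        rw [Real.rpow_neg (by positivity), ← div_eq_mul_inv, le_div_iff₀ (by positivity)]
        linarith)
      have e1 : X = d ^ α * F zm := rfl
      have e2 : d ^ α * (A * (κ * d) ^ (-α) + B * (κ * d) ^ β * (X * (d / 2) ^ (-α)))
          = A * κ ^ (-α) + (B * (κ * d) ^ β * 2 ^ α) * X := by
        rw [Real.mul_rpow hκ0.le hd0.le, Real.div_rpow hd0.le (by norm_num), Real.rpow_neg hd0.le,
          Real.rpow_neg (by norm_num : (0:ℝ) ≤ 2)]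
        have : d ^ α ≠ 0 := (Real.rpow_pos_of_pos hd0 α).ne'
        field_simp
      have e3 : B * (κ * d) ^ β * 2 ^ α ≤ 1 / 2 := by
        refine le_trans ?_ hκ
        have : (κ * d) ^ β ≤ (κ * r1) ^ β :=
          Real.rpow_le_rpow (by positivity) (by nlinarith) hβ.le
        gcongr
      calc X = d ^ α * F zm := e1
        _ ≤ d ^ α * (A * (κ * d) ^ (-α) + B * (κ * d) ^ β * (X * (d / 2) ^ (-α))) := by gcongr
        _ = _ := e2
        _ ≤ _ := by gcongr
  have hXb : X ≤ 2 * A * κ ^ (-α) := by linarith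
  have h0 := hmax' z0 (mem_closedBall_self hRpos.le)
  simp only [hG, sub_self, norm_zero, sub_zero] at h0
  have h6 : R ^ α * F z0 ≤ 2 * A * κ ^ (-α) := h0.trans hXb
  have h7 : R ^ α * 2 ^ α = ‖z0‖ ^ α := by
    rw [← Real.mul_rpow hRpos.le (by norm_num)]; congr 1; rw [hR]; ring
  rw [Real.rpow_neg hz0.le, ← div_eq_mul_inv, le_div_iff₀ (by positivity), ← h7]
  have : (0:ℝ) < 2 ^ α := by positivity
  nlinarith

end

section
/-- truncated power -/
def tp (M α y : ℝ) : ℝ := if y < M then y ^ (-α) else 0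

lemma tp_nonneg {M α y : ℝ} (hy : 0 ≤ y) : 0 ≤ tp M α y := by
  unfold tp; split_ifs <;> positivity

lemma integrable_tp {E : Type*} [NormedAddCommGroup E] [NormedSpace ℝ E] [MeasurableSpace E]
    [Nontrivial E] (μ : Measure E) [FiniteDimensional ℝ E] [BorelSpace E] [μ.IsAddHaarMeasure]
    (hE : Module.finrank ℝ E = 2) (M : ℝ) {α : ℝ} (hα : α < 2) :
    Integrable (fun x : E => tp M α ‖x‖) μ := by
  rw [integrable_fun_norm_addHaar μ (f := tp M α), hE]
  rcases le_or_gt M 0 with hM | hM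
  · apply (integrableOn_zero (ε' := ℝ)).congr_fun _ measurableSet_Ioi
    intro y hy
    have : ¬ y < M := by simp only [Set.mem_Ioi] at hy; linarith
    simp [tp, this]
  · have h1 : IntegrableOn (fun y : ℝ => y ^ (1 - α)) (Set.Ioo 0 M) :=
      (intervalIntegral.integrableOn_Ioo_rpow_iff hM).2 (by linarith)
    have h2 : Set.Ioi (0:ℝ) = Set.Ioo 0 M ∪ Set.Ici M := by
      ext y; simp; constructor
      · intro hy; rcases lt_or_ge y M with h | h <;> simp [*]
      · rintro (h | h) <;> linarith
    rw [h2]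
    apply IntegrableOn.union
    · apply h1.congr_fun _ measurableSet_Ioo
      intro y hy
      simp only [tp, hy.2, if_true, smul_eq_mul]
      rw [show (2 - 1 : ℕ) = 1 from rfl, pow_one, sub_eq_add_neg, Real.rpow_add hy.1, Real.rpow_one]
    · apply (integrableOn_zero (ε' := ℝ)).congr_fun _ measurableSet_Ici
      intro y hy
      simp [tp, not_lt.2 (Set.mem_Ici.1 hy)]

lemma db_cont {F : ℂ → ℂ} (hF : ContDiff ℝ 1 F) : Continuous (db F) := by
  have hc := hF.continuous_fderiv one_ne_zero
  unfold db
  exact (hc.clm_apply continuous_const).add (continuous_const.mul (hc.clm_apply continuous_const))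

lemma db_compact {F : ℂ → ℂ} (hF : HasCompactSupport F) : HasCompactSupport (db F) := by
  have h := hF.fderiv ℝ
  refine h.mono' ?_
  refine Function.support_subset_iff'.2 (fun z hz => ?_) |>.trans subset_closure
  rw [Function.notMem_support] at hz
  simp [db, hz]

lemma pompeiu {F : ℂ → ℂ} (hF : ContDiff ℝ 1 F) (hc : HasCompactSupport F) (z0 : ℂ) :
    ∫ z, db F z / (z - z0) = -(2 * π * F z0) := by
  have e1 : ∫ z, db F z / (z - z0) = ∫ w, db F (z0 + w) / w := by
    rw [← integral_add_left_eq_self _ z0]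
    simp
  rw [e1, ← Complex.integral_comp_polarCoord_symm]
  have hdbc := db_cont hF
  have hps : ∀ q : ℝ × ℝ, Complex.polarCoord.symm q = circleMap 0 q.1 q.2 := by
    intro q
    rw [Complex.polarCoord_symm_apply, circleMap, Complex.exp_mul_I]; simp
  set G : ℝ × ℝ → ℂ := fun q => Complex.exp (-(q.2 * Complex.I)) * db F (circleMap z0 q.1 q.2)
    with hG
  have hGc : Continuous G := by
    have : Continuous fun q : ℝ × ℝ => circleMap z0 q.1 q.2 := by
      unfold circleMap; fun_prop
    have h2 := hdbc.comp this
    have h3 : Continuous fun q : ℝ × ℝ => Complex.exp (-(q.2 * Complex.I)) := by fun_prop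
    exact h3.mul h2
  have htar : polarCoord.target = Set.Ioi (0:ℝ) ×ˢ Set.Ioo (-π) π := rfl
  have e2 : ∫ q in polarCoord.target, q.1 • (db F (z0 + Complex.polarCoord.symm q)
      / Complex.polarCoord.symm q) = ∫ q in polarCoord.target, G q := by
    apply setIntegral_congr_fun polarCoord.open_target.measurableSet
    intro q hq
    rw [htar] at hq
    have hq0 : (q.1 : ℂ) ≠ 0 := by exact_mod_cast (ne_of_gt hq.1)
    simp only [hps, hG]
    have : z0 + circleMap 0 q.1 q.2 = circleMap z0 q.1 q.2 := by simp [circleMap]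
    rw [this, Complex.exp_neg, Complex.real_smul]
    simp only [circleMap, zero_add]
    field_simp
  obtain ⟨M, hM⟩ := hc.isCompact.isBounded.subset_closedBall z0
  have hM0 : ∀ z, M < ‖z - z0‖ → db F z = 0 := by
    intro z hz
    by_contra h
    have : z ∈ tsupport F := by
      have h1 : fderiv ℝ F z ≠ 0 := fun h0 => h (by simp [db, h0])
      exact support_fderiv_subset ℝ h1
    have := hM this
    rw [mem_closedBall, dist_eq_norm] at this
    linarith
  have hM1 : ∀ z, M < ‖z - z0‖ → F z = 0 := by
    intro z hz
    by_contra h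
    have := hM (subset_tsupport F h)
    rw [mem_closedBall, dist_eq_norm] at this
    linarith
  have hcm : ∀ s θ, 0 < s → ‖circleMap z0 s θ - z0‖ = s := by
    intro s θ hs
    simp [circleMap, abs_of_pos hs]
  have hint : IntegrableOn G (Set.Ioi (0:ℝ) ×ˢ Set.Ioo (-π) π) := by
    have h1 : IntegrableOn G (Set.Icc (0:ℝ) (M) ×ˢ Set.Icc (-π) π) :=
      hGc.continuousOn.integrableOn_compact (isCompact_Icc.prod isCompact_Icc)
    refine h1.of_forall_sdiff_eq_zero (measurableSet_Ioi.prod measurableSet_Ioo) ?_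
    rintro ⟨s, θ⟩ ⟨⟨hs, hθ⟩, hn⟩
    simp only [Set.mem_Ioi] at hs
    have : M < s := by
      by_contra hle
      exact hn ⟨⟨hs.le, not_lt.1 hle⟩, ⟨hθ.1.le, hθ.2.le⟩⟩
    simp only [hG]
    rw [hM0 _ (by rw [hcm s θ hs]; exact this), mul_zero]
  rw [e2, htar, Measure.volume_eq_prod, setIntegral_prod _ hint]
  set I : ℝ → ℂ := fun s => ∫ θ in (0:ℝ)..(2 * π), F (circleMap z0 s θ) with hI
  set I' : ℝ → ℂ := fun s => ∫ θ in (0:ℝ)..(2 * π),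
    Complex.exp (-(θ * Complex.I)) * db F (circleMap z0 s θ) with hI'
  have e3 : ∀ s, ∫ θ in Set.Ioo (-π) π, G (s, θ) = I' s := by
    intro s
    rw [← integral_Ioc_eq_integral_Ioo, ← intervalIntegral.integral_of_le (by linarith [pi_pos])]
    have hper : Function.Periodic (fun θ : ℝ => G (s, θ)) (2 * π) := by
      intro θ
      simp only [hG]
      have h1 : circleMap z0 s (θ + 2 * π) = circleMap z0 s θ := periodic_circleMap z0 s θ
      have h2 : Complex.exp (-((θ + 2 * π : ℝ) * Complex.I)) = Complex.exp (-(θ * Complex.I)) := by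
        rw [Complex.exp_eq_exp_iff_exists_int]
        exact ⟨-1, by push_cast; ring⟩
      rw [h1, h2]
    have := hper.intervalIntegral_add_eq (-π) 0
    rw [zero_add, show -π + 2 * π = π by ring] at this
    exact this
  simp only [e3]
  have hder : ∀ s ∈ Set.Ici (0:ℝ), HasDerivAt I (I' s) s := fun s hs =>
    circ_deriv isOpen_univ hF.contDiffOn hs (Set.subset_univ _)
  have hintI : IntegrableOn I' (Set.Ioi 0) := by
    rw [IntegrableOn, Measure.volume_eq_prod, ← Measure.prod_restrict] at hint
    have := hint.integral_prod_left
    simp only [e3] at this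
    exact this
  have hlim : Tendsto I atTop (𝓝 0) := by
    apply tendsto_const_nhds.congr'
    filter_upwards [eventually_gt_atTop (max M 0)] with s hs
    have : ∀ θ, F (circleMap z0 s θ) = 0 := fun θ =>
      hM1 _ (by rw [hcm s θ ((le_max_right _ _).trans_lt hs)]; exact (le_max_left _ _).trans_lt hs)
    simp [hI, this]
  rw [integral_Ioi_of_hasDerivAt_of_tendsto' hder hintI hlim]
  simp [hI]

end

section
lemma xy_bound {x y w η : ℝ} (hx : 0 < x) (hy : 0 < y) (hη : 0 < η) (hη2 : η < 1/2)
    (hw : x ≤ w ∨ y ≤ w) : x ^ (1 + η) * y ≤ w ^ (2 * η) * (x ^ (2 - η) + y ^ (2 - η)) := by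
  have gen : ∀ p q : ℝ, 0 ≤ p → 0 ≤ q → p + q = 2 - η → x ^ p * y ^ q ≤ x ^ (2 - η) + y ^ (2 - η) := by
    intro p q hp hq hpq
    rcases le_total x y with h | h
    · calc x ^ p * y ^ q ≤ y ^ p * y ^ q := by gcongr
        _ = y ^ (2 - η) := by rw [← Real.rpow_add hy, hpq]
        _ ≤ _ := by linarith [Real.rpow_nonneg hx.le (2 - η)]
    · calc x ^ p * y ^ q ≤ x ^ p * x ^ q := by gcongr
        _ = x ^ (2 - η) := by rw [← Real.rpow_add hx, hpq]
        _ ≤ _ := by linarith [Real.rpow_nonneg hy.le (2 - η)]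
  rcases hw with h | h
  · calc x ^ (1 + η) * y = x ^ (2 * η) * (x ^ (1 - η) * y ^ (1:ℝ)) := by
          rw [Real.rpow_one, ← mul_assoc, ← Real.rpow_add hx]; ring_nf
      _ ≤ w ^ (2 * η) * (x ^ (2 - η) + y ^ (2 - η)) := by
          apply mul_le_mul (Real.rpow_le_rpow hx.le h (by linarith))
            (gen _ _ (by linarith) (by linarith) (by ring)) (by positivity)
            (Real.rpow_nonneg (hx.le.trans h) _)
  · calc x ^ (1 + η) * y = y ^ (2 * η) * (x ^ (1 + η) * y ^ (1 - 2 * η)) := by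
          rw [mul_left_comm, ← Real.rpow_add hy]; ring_nf; rw [Real.rpow_one]
      _ ≤ w ^ (2 * η) * (x ^ (2 - η) + y ^ (2 - η)) := by
          apply mul_le_mul (Real.rpow_le_rpow hy.le h (by linarith))
            (gen _ _ (by linarith) (by linarith) (by ring)) (by positivity)
            (Real.rpow_nonneg (hy.le.trans h) _)

lemma sing_bound {z z0 : ℂ} {M η : ℝ} (hz : z ≠ 0) (hzz : z ≠ z0) (hz0 : z0 ≠ 0) (hη : 0 < η)
    (hη2 : η < 1/2) (hM : ‖z‖ < M) (hM0 : ‖z0‖ < M) :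
    ‖z‖ ^ (-(1 + η)) * ‖z - z0‖⁻¹ ≤ (2 / ‖z0‖) ^ (2 * η) *
      (tp M (2 - η) ‖z‖ + tp (2 * M) (2 - η) ‖z - z0‖) := by
  have h1 : 0 < ‖z‖ := norm_pos_iff.2 hz
  have h2 : 0 < ‖z - z0‖ := norm_pos_iff.2 (sub_ne_zero.2 hzz)
  have h3 : 0 < ‖z0‖ := norm_pos_iff.2 hz0
  have t : ‖z0‖ ≤ ‖z‖ + ‖z - z0‖ := by
    have := norm_sub_le z (z - z0); simpa using this
  have key := xy_bound (x := ‖z‖⁻¹) (y := ‖z - z0‖⁻¹) (w := 2 / ‖z0‖) (by positivity)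
    (by positivity) hη hη2 (by
      rcases le_total (‖z0‖ / 2) ‖z‖ with h | h
      · left; rw [inv_le_comm₀ h1 (by positivity)]; rw [inv_div]; exact h
      · right; rw [inv_le_comm₀ h2 (by positivity), inv_div]; linarith)
  have t2 : ‖z - z0‖ < 2 * M := by linarith [norm_sub_le z z0]
  simp only [tp, hM, t2, if_true]
  rw [Real.inv_rpow h1.le, Real.inv_rpow h1.le, Real.inv_rpow h2.le, ← Real.rpow_neg h1.le,
    ← Real.rpow_neg h1.le, ← Real.rpow_neg h2.le] at key
  exact key

lemma integrable_sing (z0 : ℂ) {M η c : ℝ} (hη : 0 < η) : 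
    Integrable (fun z : ℂ => c * (tp M (2 - η) ‖z‖ + tp (2 * M) (2 - η) ‖z - z0‖)) := by
  have h1 := integrable_tp (volume : Measure ℂ) Complex.finrank_real_complex M
    (show 2 - η < 2 by linarith)
  have h2 := integrable_tp (volume : Measure ℂ) Complex.finrank_real_complex (2 * M)
    (show 2 - η < 2 by linarith)
  exact (h1.add (h2.comp_sub_right z0)).const_mul c

lemma db_congr {f g : ℂ → ℂ} {z : ℂ} (h : f =ᶠ[𝓝 z] g) : db f z = db g z := by
  unfold db; rw [h.fderiv_eq]

lemma db_zero_of {F : ℂ → ℂ} {M : ℝ} (hs : ∀ z, M ≤ ‖z‖ → F z = 0) {z : ℂ} (hz : M < ‖z‖) :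
    db F z = 0 := by
  have : F =ᶠ[𝓝 z] fun _ => 0 := by
    filter_upwards [(isOpen_lt continuous_const continuous_norm).mem_nhds hz] with w hw
    exact hs w (le_of_lt hw)
  rw [db_congr this]; simp [db]

lemma bump_bound (f : ContDiffBump (0:ℂ)) : ∃ K, 0 ≤ K ∧ ∀ z, ‖db (fun z => (f z : ℂ)) z‖ ≤ K := by
  have h1 : ContDiff ℝ 1 (fun z => (f z : ℂ)) := Complex.ofRealCLM.contDiff.comp f.contDiff
  have h2 : HasCompactSupport (fun z => (f z : ℂ)) :=
    f.hasCompactSupport.comp_left (g := fun x : ℝ => (x:ℂ)) (by simp)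
  obtain ⟨K, hK⟩ := (db_cont h1).bounded_above_of_compact_support (db_compact h2)
  exact ⟨K, (norm_nonneg _).trans (hK 0), hK⟩

lemma pompeiu_sing {F : ℂ → ℂ} {M C η : ℝ} (hM : 0 < M) (hF : ContDiffOn ℝ 1 F {0}ᶜ)
    (hs : ∀ z, M / 2 ≤ ‖z‖ → F z = 0) (hη : 0 < η) (hη2 : η < 1/2)
    (b1 : ∀ z, z ≠ 0 → ‖F z‖ ≤ C * ‖z‖ ^ (-η)) (b2 : ∀ z, z ≠ 0 → ‖db F z‖ ≤ C * ‖z‖ ^ (-η))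
    {z0 : ℂ} (hz0 : z0 ≠ 0) (hzM : ‖z0‖ < M) :
    ∫ z, db F z / (z - z0) = -(2 * π * F z0) := by
  have hC : 0 ≤ C := by
    have := (norm_nonneg _).trans (b1 1 one_ne_zero); simpa using this
  set ψ : ContDiffBump (0:ℂ) := ⟨1, 2, by norm_num, by norm_num⟩ with hψ
  obtain ⟨K, hK0, hK⟩ := bump_bound ψ
  set Ψ : ℂ → ℂ := fun z => (ψ z : ℂ) with hΨ
  have hΨc : ContDiff ℝ 1 Ψ := Complex.ofRealCLM.contDiff.comp ψ.contDiff
  have hΨ2 : ∀ z, 2 ≤ ‖z‖ → Ψ z = 0 := by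
    intro z hz
    have : ψ z = 0 := ψ.zero_of_le_dist (by simpa [hψ] using hz)
    simp [hΨ, this]
  have hΨ1 : ∀ z, ‖z‖ ≤ 1 → Ψ z = 1 := by
    intro z hz
    have : ψ z = 1 := ψ.one_of_mem_closedBall (by simpa [hψ] using hz)
    simp [hΨ, this]
  set A : ℕ → ℂ → ℂ := fun n z => 1 - Ψ (((n:ℝ)+1) • z) with hA
  have hAc : ∀ n, ContDiff ℝ 1 (A n) := fun n =>
    contDiff_const.sub (hΨc.comp (contDiff_const_smul _))
  have hA0 : ∀ n z, ‖A n z‖ ≤ 1 := by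
    intro n z
    simp only [hA, hΨ]
    rw [← Complex.ofReal_one, ← Complex.ofReal_sub, Complex.norm_real, Real.norm_eq_abs, abs_le]
    constructor <;> linarith [ψ.nonneg (x := ((n:ℝ)+1) • z), ψ.le_one (x := ((n:ℝ)+1) • z)]
  have hdA : ∀ n z, db (A n) z = -(((n:ℝ)+1 : ℝ) : ℂ) * db Ψ (((n:ℝ)+1) • z) := by
    intro n z
    simp only [hA, db]
    rw [fderiv_const_sub, fderiv_comp_smul]
    simp
    ring
  have hdA1 : ∀ n z, z ≠ 0 → ‖db (A n) z‖ ≤ 2 * K * ‖z‖⁻¹ := by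
    intro n z hz
    have hz' : 0 < ‖z‖ := norm_pos_iff.2 hz
    have hn : (0:ℝ) < (n:ℝ) + 1 := by positivity
    rw [hdA, norm_mul, norm_neg, Complex.norm_real, Real.norm_eq_abs, abs_of_pos hn]
    rcases le_or_gt (((n:ℝ)+1) * ‖z‖) 2 with h | h
    · have : (n:ℝ) + 1 ≤ 2 * ‖z‖⁻¹ := by
        rw [← div_eq_mul_inv, le_div_iff₀ hz']; exact h
      calc _ ≤ 2 * ‖z‖⁻¹ * K := mul_le_mul this (hK _) (norm_nonneg _) (by positivity)
        _ = _ := by ring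
    · rw [db_zero_of hΨ2 (by rw [norm_smul, Real.norm_eq_abs, abs_of_pos hn]; exact h)]
      simp; positivity
  have hAev : ∀ z, z ≠ 0 → ∀ᶠ n in atTop, A n z = 1 ∧ db (A n) z = 0 := by
    intro z hz
    have hz' : 0 < ‖z‖ := norm_pos_iff.2 hz
    have : Tendsto (fun n : ℕ => ((n:ℝ)+1) * ‖z‖) atTop atTop :=
      (tendsto_atTop_add_const_right _ _ tendsto_natCast_atTop_atTop).atTop_mul_const hz'
    filter_upwards [this.eventually_gt_atTop 2] with n hn
    have hn0 : (0:ℝ) < (n:ℝ) + 1 := by positivity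
    have hn' : 2 < ‖((n:ℝ)+1) • z‖ := by
      rw [norm_smul, Real.norm_eq_abs, abs_of_pos hn0]; exact hn
    refine ⟨by simp only [hA]; rw [hΨ2 _ hn'.le, sub_zero], ?_⟩
    rw [hdA, db_zero_of hΨ2 hn', mul_zero]
  set G : ℕ → ℂ → ℂ := fun n z => A n z * F z with hG
  have hFd : ∀ z, z ≠ 0 → ContDiffAt ℝ 1 F z := fun z hz =>
    hF.contDiffAt (isOpen_compl_singleton.mem_nhds hz)
  have hGc : ∀ n, ContDiff ℝ 1 (G n) := by
    intro n
    rw [contDiff_iff_contDiffAt]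
    intro z
    by_cases hz : z = 0
    · have hn0 : (0:ℝ) < (n:ℝ) + 1 := by positivity
      have : G n =ᶠ[𝓝 z] fun _ => 0 := by
        rw [hz]
        filter_upwards [closedBall_mem_nhds (0:ℂ) (show 0 < ((n:ℝ)+1)⁻¹ by positivity)] with w hw
        rw [mem_closedBall, dist_zero_right] at hw
        simp only [hG, hA]
        rw [hΨ1, sub_self, zero_mul]
        rw [norm_smul, Real.norm_eq_abs, abs_of_pos hn0]
        calc _ ≤ ((n:ℝ)+1) * ((n:ℝ)+1)⁻¹ := by gcongr
          _ = 1 := mul_inv_cancel₀ hn0.ne'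
      exact contDiffAt_const.congr_of_eventuallyEq this
    · exact (hAc n).contDiffAt.mul (hFd z hz)
  have hGs : ∀ n z, M / 2 ≤ ‖z‖ → G n z = 0 := fun n z hz => by
    simp only [hG]; rw [hs z hz, mul_zero]
  have hGcs : ∀ n, HasCompactSupport (G n) := fun n =>
    HasCompactSupport.intro (isCompact_closedBall (0:ℂ) (M/2)) (fun z hz => hGs n z (by
      rw [mem_closedBall, dist_zero_right] at hz; linarith))
  have hdG : ∀ n z, z ≠ 0 → db (G n) z = A n z * db F z + F z * db (A n) z := fun n z hz =>
    db_mul ((hAc n).differentiable one_ne_zero z) ((hFd z hz).differentiableAt one_ne_zero)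
  have hP : ∀ n, ∫ z, db (G n) z / (z - z0) = -(2 * π * G n z0) := fun n =>
    pompeiu (hGc n) (hGcs n) z0
  have hae : ∀ᵐ z : ℂ, z ≠ 0 ∧ z ≠ z0 := by
    filter_upwards [compl_mem_ae_iff.2 (measure_singleton (μ := (volume : Measure ℂ)) (0:ℂ)),
      compl_mem_ae_iff.2 (measure_singleton (μ := (volume : Measure ℂ)) z0)] with z h1 h2
    exact ⟨h1, h2⟩
  have lim1 : Tendsto (fun n => ∫ z, db (G n) z / (z - z0)) atTop (𝓝 (∫ z, db F z / (z - z0))) := by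
    refine tendsto_integral_of_dominated_convergence
      (fun z => (C * (M + 2 * K) * (2 / ‖z0‖) ^ (2 * η)) * (tp M (2 - η) ‖z‖ + tp (2 * M) (2 - η) ‖z - z0‖))
      (fun n => ?_) (integrable_sing z0 hη) (fun n => ?_) ?_
    · exact ((db_cont (hGc n)).measurable.div (by fun_prop)).aestronglyMeasurable
    · filter_upwards [hae] with z hz
      have hz' : 0 < ‖z‖ := norm_pos_iff.2 hz.1
      rcases lt_or_ge ‖z‖ M with hzlt | hzge
      · have := sing_bound hz.1 hz.2 hz0 hη hη2 hzlt hzM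
        have h1 : ‖db (G n) z‖ ≤ C * (M + 2 * K) * ‖z‖ ^ (-(1 + η)) := by
          have e : ‖z‖ ^ (-η) = ‖z‖ * ‖z‖ ^ (-(1 + η)) := by
            nth_rw 2 [← Real.rpow_one ‖z‖]
            rw [← Real.rpow_add hz']; ring_nf
          have e2 : ‖z‖ ^ (-η) * ‖z‖⁻¹ = ‖z‖ ^ (-(1 + η)) := by
            rw [e]; field_simp
          rw [hdG n z hz.1]
          refine (norm_add_le _ _).trans ?_
          rw [norm_mul, norm_mul]
          calc _ ≤ 1 * (C * ‖z‖ ^ (-η)) + (C * ‖z‖ ^ (-η)) * (2 * K * ‖z‖⁻¹) := by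
                gcongr
                · exact hA0 n z
                · exact b2 z hz.1
                · exact b1 z hz.1
                · exact hdA1 n z hz.1
            _ = C * (‖z‖ * ‖z‖ ^ (-(1 + η))) + C * 2 * K * (‖z‖ ^ (-η) * ‖z‖⁻¹) := by
                rw [← e]; ring
            _ ≤ C * (M * ‖z‖ ^ (-(1 + η))) + C * 2 * K * (‖z‖ ^ (-η) * ‖z‖⁻¹) := by gcongr
            _ = _ := by rw [e2]; ring
        rw [norm_div, div_eq_mul_inv]
        calc _ ≤ C * (M + 2 * K) * ‖z‖ ^ (-(1 + η)) * ‖z - z0‖⁻¹ := by gcongr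
          _ = C * (M + 2 * K) * (‖z‖ ^ (-(1 + η)) * ‖z - z0‖⁻¹) := by ring
          _ ≤ C * (M + 2 * K) * ((2 / ‖z0‖) ^ (2 * η) * (tp M (2 - η) ‖z‖ + tp (2 * M) (2 - η) ‖z - z0‖)) := by
            gcongr
          _ = _ := by ring
      · rw [db_zero_of (hGs n) (by linarith)]
        have := tp_nonneg (M := M) (α := 2 - η) (norm_nonneg z)
        have := tp_nonneg (M := 2 * M) (α := 2 - η) (norm_nonneg (z - z0))
        simp; positivity
    · filter_upwards [hae] with z hz
      apply tendsto_const_nhds.congr'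
      filter_upwards [hAev z hz.1] with n hn
      rw [hdG n z hz.1, hn.1, hn.2]; simp
  have lim2 : Tendsto (fun n => ∫ z, db (G n) z / (z - z0)) atTop (𝓝 (-(2 * π * F z0))) := by
    apply tendsto_const_nhds.congr'
    filter_upwards [hAev z0 hz0] with n hn
    rw [hP]; simp only [hG]; rw [hn.1, one_mul]
  exact tendsto_nhds_unique lim1 lim2

end

section
lemma pole_lemma {h : ℂ → ℂ} {r1 C η : ℝ} (hr1 : 0 < r1) (hC : 0 ≤ C)
    (hh : ContDiffOn ℝ 1 h {z : ℂ | 0 < ‖z‖ ∧ ‖z‖ < r1}) (hη : 0 < η) (hη2 : η < 1/2)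
    (b1 : ∀ z : ℂ, 0 < ‖z‖ → ‖z‖ < r1 → ‖h z‖ ≤ C * ‖z‖ ^ (-(1 + η)))
    (b2 : ∀ z : ℂ, 0 < ‖z‖ → ‖z‖ < r1 → ‖db h z‖ ≤ C * ‖z‖ ^ (-(1 + η))) :
    ∃ L : ℂ, ∃ C', 0 ≤ C' ∧ ∀ z : ℂ, 0 < ‖z‖ → ‖z‖ < r1 / 4 →
      ‖h z - L / z‖ ≤ C' * ‖z‖ ^ (-(2 * η)) := by
  have hOo : IsOpen {z : ℂ | 0 < ‖z‖ ∧ ‖z‖ < r1} :=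
    (isOpen_lt continuous_const continuous_norm).inter (isOpen_lt continuous_norm continuous_const)
  set χ : ContDiffBump (0:ℂ) := ⟨r1 / 4, r1 / 2, by linarith, by linarith⟩ with hχ
  obtain ⟨K, hK0, hK⟩ := bump_bound χ
  set X : ℂ → ℂ := fun z => (χ z : ℂ) with hX
  have hXc : ContDiff ℝ 1 X := Complex.ofRealCLM.contDiff.comp χ.contDiff
  have hX2 : ∀ z, r1 / 2 ≤ ‖z‖ → X z = 0 := by
    intro z hz
    have : χ z = 0 := χ.zero_of_le_dist (by simpa [hχ] using hz)
    simp [hX, this]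
  have hX1 : ∀ z, ‖z‖ ≤ r1 / 4 → X z = 1 := by
    intro z hz
    have : χ z = 1 := χ.one_of_mem_closedBall (by simpa [hχ] using hz)
    simp [hX, this]
  have hX0 : ∀ z, ‖X z‖ ≤ 1 := by
    intro z
    simp only [hX]
    rw [Complex.norm_real, Real.norm_eq_abs, abs_of_nonneg χ.nonneg]
    exact χ.le_one
  set F : ℂ → ℂ := fun z => X z * (z * h z) with hF
  have hs : ∀ z, r1 / 2 ≤ ‖z‖ → F z = 0 := fun z hz => by
    simp only [hF]; rw [hX2 z hz, zero_mul]
  have hhd : ∀ z : ℂ, z ≠ 0 → ‖z‖ < r1 → ContDiffAt ℝ 1 h z := fun z hz hz1 =>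
    hh.contDiffAt (hOo.mem_nhds ⟨norm_pos_iff.2 hz, hz1⟩)
  have hFc : ContDiffOn ℝ 1 F {0}ᶜ := by
    intro z hz
    apply ContDiffAt.contDiffWithinAt
    rcases lt_or_ge ‖z‖ r1 with hlt | hge
    · exact hXc.contDiffAt.mul (contDiffAt_id.mul (hhd z hz hlt))
    · have : F =ᶠ[𝓝 z] fun _ => 0 := by
        filter_upwards [(isOpen_lt continuous_const continuous_norm).mem_nhds
          (show r1 / 2 < ‖z‖ by linarith)] with w hw
        exact hs w (le_of_lt hw)
      exact contDiffAt_const.congr_of_eventuallyEq this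
  have eη : ∀ z : ℂ, z ≠ 0 → ‖z‖ * ‖z‖ ^ (-(1 + η)) = ‖z‖ ^ (-η) := by
    intro z hz
    have hz' : 0 < ‖z‖ := norm_pos_iff.2 hz
    nth_rw 1 [← Real.rpow_one ‖z‖]
    rw [← Real.rpow_add hz']; ring_nf
  have zh : ∀ z : ℂ, z ≠ 0 → ‖z‖ < r1 → ‖z * h z‖ ≤ C * ‖z‖ ^ (-η) := by
    intro z hz hz1
    rw [norm_mul, ← eη z hz]
    calc _ ≤ ‖z‖ * (C * ‖z‖ ^ (-(1 + η))) := by gcongr; exact b1 z (norm_pos_iff.2 hz) hz1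
      _ = _ := by ring
  have hFb1 : ∀ z, z ≠ 0 → ‖F z‖ ≤ (C * (1 + K)) * ‖z‖ ^ (-η) := by
    intro z hz
    rcases lt_or_ge ‖z‖ r1 with hlt | hge
    · simp only [hF]; rw [norm_mul]
      calc _ ≤ 1 * (C * ‖z‖ ^ (-η)) := by gcongr; exact hX0 z; exact zh z hz hlt
        _ ≤ _ := by nlinarith [mul_nonneg hC (Real.rpow_nonneg (norm_nonneg z) (-η)), mul_nonneg hK0 (mul_nonneg hC (Real.rpow_nonneg (norm_nonneg z) (-η)))]
    · rw [hs z (by linarith)]; simp; positivity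
  have hFb2 : ∀ z, z ≠ 0 → ‖db F z‖ ≤ (C * (1 + K)) * ‖z‖ ^ (-η) := by
    intro z hz
    rcases lt_or_ge ‖z‖ r1 with hlt | hge
    · have hd := (hhd z hz hlt).differentiableAt one_ne_zero
      have e1 : db F z = X z * (z * db h z) + (z * h z) * db X z := by
        simp only [hF]
        have hd2 : DifferentiableAt ℝ (fun z => z * h z) z := differentiableAt_fun_id.mul hd
        rw [db_mul (hXc.differentiable one_ne_zero z) hd2,
          db_mul differentiableAt_fun_id hd, db_id]
        ring
      rw [e1]
      refine (norm_add_le _ _).trans ?_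
      rw [norm_mul, norm_mul _ (db X z), norm_mul z (db h z)]
      calc _ ≤ 1 * (‖z‖ * (C * ‖z‖ ^ (-(1 + η)))) + (C * ‖z‖ ^ (-η)) * K := by
            gcongr
            · exact hX0 z
            · exact b2 z (norm_pos_iff.2 hz) hlt
            · exact zh z hz hlt
            · exact hK z
        _ = _ := by rw [← eη z hz]; ring
    · rw [db_zero_of hs (by linarith)]; simp; positivity
  set C1 := C * (1 + K) with hC1
  have hC10 : 0 ≤ C1 := by positivity
  have hae : ∀ z0 : ℂ, ∀ᵐ z : ℂ, z ≠ z0 := fun z0 =>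
    compl_mem_ae_iff.2 (measure_singleton (μ := (volume : Measure ℂ)) z0)
  have hmeas : AEStronglyMeasurable (db F) (volume : Measure ℂ) := by
    have hco : ContinuousOn (db F) {0}ᶜ := by
      have hc := hFc.continuousOn_fderiv_of_isOpen isOpen_compl_singleton le_rfl
      unfold db
      exact (hc.clm_apply continuousOn_const).add
        (continuousOn_const.mul (hc.clm_apply continuousOn_const))
    have := hco.aestronglyMeasurable (μ := volume) isOpen_compl_singleton.measurableSet
    rwa [restrict_compl_singleton] at this
  have hmeas2 : ∀ z0 : ℂ, AEStronglyMeasurable (fun z => db F z / (z - z0)) (volume : Measure ℂ) := by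
    intro z0
    simp only [div_eq_mul_inv]
    apply hmeas.mul
    have : Measurable fun z : ℂ => (z - z0)⁻¹ := by fun_prop
    exact this.aestronglyMeasurable
  have hb : ∀ z : ℂ, z ≠ 0 → ‖db F z‖ * ‖z‖⁻¹ ≤ C1 * ‖z‖ ^ (-(1 + η)) := by
    intro z hz
    have hz' : 0 < ‖z‖ := norm_pos_iff.2 hz
    rw [← div_eq_mul_inv, div_le_iff₀ hz', mul_assoc, mul_comm _ ‖z‖, eη z hz]
    exact hFb2 z hz
  have hbs : ∀ z0 : ℂ, z0 ≠ 0 → ‖z0‖ < r1 → ∀ z : ℂ, z ≠ 0 → z ≠ z0 → ‖db F z‖ * ‖z‖⁻¹ * ‖z - z0‖⁻¹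
      ≤ (C1 * (2 / ‖z0‖) ^ (2 * η)) * (tp r1 (2 - η) ‖z‖ + tp (2 * r1) (2 - η) ‖z - z0‖) := by
    intro z0 hz0 hz01 z hz hzz
    rcases lt_or_ge ‖z‖ r1 with hlt | hge
    · have := sing_bound hz hzz hz0 hη hη2 hlt hz01
      calc _ ≤ C1 * ‖z‖ ^ (-(1 + η)) * ‖z - z0‖⁻¹ :=
              mul_le_mul_of_nonneg_right (hb z hz) (by positivity)
        _ = C1 * (‖z‖ ^ (-(1 + η)) * ‖z - z0‖⁻¹) := by ring
        _ ≤ C1 * _ := mul_le_mul_of_nonneg_left this hC10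
        _ = _ := by ring
    · rw [db_zero_of hs (by linarith)]
      have := tp_nonneg (M := r1) (α := 2 - η) (norm_nonneg z)
      have := tp_nonneg (M := 2 * r1) (α := 2 - η) (norm_nonneg (z - z0))
      simp; positivity
  have hint0 : Integrable (fun z => db F z / (z - 0)) (volume : Measure ℂ) := by
    have ht := integrable_tp (volume : Measure ℂ) Complex.finrank_real_complex r1
      (show 1 + η < 2 by linarith)
    refine (ht.const_mul C1).mono' (hmeas2 0) ?_
    filter_upwards [hae 0] with z hz
    rw [sub_zero, norm_div, div_eq_mul_inv]
    rcases lt_or_ge ‖z‖ r1 with hlt | hge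
    · simp only [tp, hlt, if_true]; exact hb z hz
    · rw [db_zero_of hs (by linarith)]
      have := tp_nonneg (M := r1) (α := 1 + η) (norm_nonneg z)
      simp; positivity
  have hint1 : ∀ z0 : ℂ, z0 ≠ 0 → ‖z0‖ < r1 →
      Integrable (fun z => db F z / (z - z0)) (volume : Measure ℂ) := by
    intro z0 hz0 hz01
    refine (integrable_sing z0 (M := r1) (η := η) (c := r1 * (C1 * (2 / ‖z0‖) ^ (2 * η))) hη).mono'
      (hmeas2 z0) ?_
    filter_upwards [hae 0, hae z0] with z hz hzz
    have h0 := hbs z0 hz0 hz01 z hz hzz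
    have hz' : 0 < ‖z‖ := norm_pos_iff.2 hz
    rw [norm_div, div_eq_mul_inv, mul_assoc]
    rcases lt_or_ge ‖z‖ r1 with hlt | hge
    · calc ‖db F z‖ * ‖z - z0‖⁻¹ = ‖z‖ * (‖db F z‖ * ‖z‖⁻¹ * ‖z - z0‖⁻¹) := by field_simp
        _ ≤ r1 * (‖db F z‖ * ‖z‖⁻¹ * ‖z - z0‖⁻¹) := by gcongr
        _ ≤ _ := by gcongr
    · rw [db_zero_of hs (by linarith)]
      have := tp_nonneg (M := r1) (α := 2 - η) (norm_nonneg z)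
      have := tp_nonneg (M := 2 * r1) (α := 2 - η) (norm_nonneg (z - z0))
      simp; positivity
  set T1 := ∫ z : ℂ, tp r1 (2 - η) ‖z‖ with hT1
  set T2 := ∫ z : ℂ, tp (2 * r1) (2 - η) ‖z‖ with hT2
  have hT1p : 0 ≤ T1 := integral_nonneg fun z => tp_nonneg (norm_nonneg z)
  have hT2p : 0 ≤ T2 := integral_nonneg fun z => tp_nonneg (norm_nonneg z)
  have hπ := pi_pos
  have hπc : (2 * π : ℂ) ≠ 0 := by
    have : (2 * π : ℝ) ≠ 0 := by positivity
    exact_mod_cast this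
  set J := ∫ z, db F z / (z - 0) with hJ
  refine ⟨-(J / (2 * π)), C1 * 2 ^ (2 * η) * (T1 + T2) / (2 * π), by positivity, ?_⟩
  intro z0 hz0 hz01
  have hz0' : z0 ≠ 0 := norm_pos_iff.1 hz0
  have hP := pompeiu_sing hr1 hFc hs hη hη2 hFb1 hFb2 hz0' (by linarith)
  have hFz0 : F z0 = z0 * h z0 := by
    simp only [hF]; rw [hX1 z0 hz01.le, one_mul]
  have hdiff : (∫ z, db F z / (z - z0)) - J = ∫ z, (db F z / (z - z0) - db F z / (z - 0)) :=
    (integral_sub (hint1 z0 hz0' (by linarith)) hint0).symm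
  have hnorm : ‖(∫ z, db F z / (z - z0)) - J‖ ≤ ‖z0‖ * ((C1 * (2 / ‖z0‖) ^ (2 * η)) * (T1 + T2)) := by
    rw [hdiff]
    have e0 : ‖z0‖ * ((C1 * (2 / ‖z0‖) ^ (2 * η)) * (T1 + T2)) = ∫ z : ℂ, (‖z0‖ * (C1 * (2 / ‖z0‖) ^ (2 * η)))
        * (tp r1 (2 - η) ‖z‖ + tp (2 * r1) (2 - η) ‖z - z0‖) := by
      have h1 := integrable_tp (volume : Measure ℂ) Complex.finrank_real_complex r1
        (show 2 - η < 2 by linarith)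
      have h2 := integrable_tp (volume : Measure ℂ) Complex.finrank_real_complex (2 * r1)
        (show 2 - η < 2 by linarith)
      rw [integral_const_mul, integral_add h1 (h2.comp_sub_right z0),
        integral_sub_right_eq_self (fun z : ℂ => tp (2 * r1) (2 - η) ‖z‖) z0]
      ring
    rw [e0]
    refine norm_integral_le_of_norm_le (integrable_sing z0 hη) ?_
    filter_upwards [hae 0, hae z0] with z hz hzz
    have h0 := hbs z0 hz0' (by linarith) z hz hzz
    have hzz' : z - z0 ≠ 0 := sub_ne_zero.2 hzz
    have e1 : db F z / (z - z0) - db F z / (z - 0) = z0 * (db F z * z⁻¹ * (z - z0)⁻¹) := by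
      rw [sub_zero]; field_simp; ring
    rw [e1, norm_mul, norm_mul, norm_mul, norm_inv, norm_inv, mul_assoc ‖z0‖]
    calc _ ≤ ‖z0‖ * _ := mul_le_mul_of_nonneg_left h0 hz0.le
      _ = _ := by ring
  have e2 : h z0 - -(J / (2 * π)) / z0 = -(((∫ z, db F z / (z - z0)) - J) / (2 * π * z0)) := by
    rw [hP, hFz0]; field_simp; ring
  rw [e2, norm_neg, norm_div, norm_mul, norm_mul]
  have e3 : ‖(2:ℂ)‖ * ‖(π:ℂ)‖ = 2 * π := by
    rw [Complex.norm_real, Real.norm_eq_abs, abs_of_pos hπ]; simp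
  rw [e3, div_le_iff₀ (by positivity)]
  refine hnorm.trans (le_of_eq ?_)
  rw [Real.div_rpow (by norm_num) hz0.le, Real.rpow_neg hz0.le]
  field_simp

lemma rad_int {f f' : ℝ → ℂ} {s s1 C α : ℝ} (hs : 0 < s) (hss : s ≤ s1) (hα : α ≠ 0)
    (hd : ∀ x ∈ Set.Icc s s1, HasDerivAt f (f' x) x)
    (hb : ∀ x ∈ Set.Icc s s1, ‖f' x‖ ≤ C * x ^ (-(1 + α))) :
    ‖f s1 - f s‖ ≤ C / α * (s ^ (-α) - s1 ^ (-α)) := by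
  have h := image_norm_le_of_norm_deriv_right_le_deriv_boundary' (f := fun x => f x - f s)
    (f' := f') (a := s) (b := s1) (B := fun x => C / α * (s ^ (-α) - x ^ (-α)))
    (B' := fun x => C * x ^ (-(1 + α)))
    (fun x hx => ((hd x hx).continuousAt.sub continuousAt_const).continuousWithinAt)
    (fun x hx => ((hd x ⟨hx.1, hx.2.le⟩).sub_const _).hasDerivWithinAt) (by simp)
    (fun x hx => ContinuousAt.continuousWithinAt (by
      have : 0 < x := hs.trans_le hx.1
      have : ContinuousAt (fun x : ℝ => x ^ (-α)) x := ContinuousAt.rpow_const continuousAt_id (Or.inl this.ne')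
      fun_prop))
    (fun x hx => by
      have hx0 : 0 < x := hs.trans_le hx.1
      have h1 := (((Real.hasDerivAt_rpow_const (p := -α) (Or.inl hx0.ne')).const_sub (s ^ (-α))).const_mul (C / α))
      have e : C / α * -(-α * x ^ (-α - 1)) = C * x ^ (-(1 + α)) := by
        rw [show -α - 1 = -(1 + α) by ring]; field_simp
      rw [e] at h1
      exact h1.hasDerivWithinAt)
    (fun x hx => hb x ⟨hx.1, hx.2.le⟩)
  exact h (Set.right_mem_Icc.2 hss)

end

section
lemma log_lemma {φ : ℂ → ℂ} {r1 C γ : ℝ} {α β : ℂ} (hr1 : 0 < r1) (hγ1 : γ < 1)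
    (hφ : ContDiffOn ℝ 1 φ {z : ℂ | 0 < ‖z‖ ∧ ‖z‖ < r1})
    (hd : ∀ z : ℂ, 0 < ‖z‖ → ‖z‖ < r1 →
      ‖db φ z - (α / (starRingEnd ℂ) z + β / z)‖ ≤ C * ‖z‖ ^ (-γ))
    (ho : ∀ ε > (0:ℝ), ∃ ρ > (0:ℝ), ∀ z : ℂ, 0 < ‖z‖ → ‖z‖ < ρ → ‖φ z‖ ≤ ε * |Real.log ‖z‖|) :
    α = 0 := by
  have hOo : IsOpen {z : ℂ | 0 < ‖z‖ ∧ ‖z‖ < r1} :=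
    (isOpen_lt continuous_const continuous_norm).inter (isOpen_lt continuous_norm continuous_const)
  have hπ := pi_pos
  have hcn : ∀ s θ : ℝ, 0 < s → ‖circleMap 0 s θ‖ = s := by
    intro s θ hs; simp [circleMap, abs_of_pos hs]
  have hsph : ∀ s, 0 < s → s < r1 → sphere (0:ℂ) s ⊆ {z : ℂ | 0 < ‖z‖ ∧ ‖z‖ < r1} := by
    intro s hs hs1 z hz
    rw [mem_sphere, dist_zero_right] at hz
    exact ⟨by rw [hz]; exact hs, by rw [hz]; exact hs1⟩
  set m : ℝ → ℂ := fun s => ∫ θ in (0:ℝ)..(2 * π), φ (circleMap 0 s θ) with hm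
  set m' : ℝ → ℂ := fun s => ∫ θ in (0:ℝ)..(2 * π),
    Complex.exp (-(θ * Complex.I)) * db φ (circleMap 0 s θ) with hm'
  have dm : ∀ s, 0 < s → s < r1 → HasDerivAt m (m' s) s := fun s hs hs1 =>
    circ_deriv hOo hφ hs.le (hsph s hs hs1)
  have hcdb : ∀ s, 0 < s → s < r1 →
      Continuous fun θ : ℝ => Complex.exp (-(θ * Complex.I)) * db φ (circleMap 0 s θ) := by
    intro s hs hs1
    have hfd := hφ.continuousOn_fderiv_of_isOpen hOo le_rfl
    have hc := hfd.comp_continuous (continuous_circleMap 0 s)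
      (fun θ => hsph s hs hs1 (circleMap_mem_sphere 0 hs.le θ))
    have h2 : Continuous fun θ : ℝ => db φ (circleMap 0 s θ) := by
      unfold db
      exact (hc.clm_apply continuous_const).add (continuous_const.mul (hc.clm_apply continuous_const))
    have h3 : Continuous fun θ : ℝ => Complex.exp (-(θ * Complex.I)) := by fun_prop
    exact h3.mul h2
  have hI2 : ∫ θ in (0:ℝ)..(2 * π), Complex.exp (-(θ * Complex.I)) * Complex.exp (-(θ * Complex.I)) = 0 := by
    have h1 : ∀ θ : ℝ, Complex.exp (-(θ * Complex.I)) * Complex.exp (-(θ * Complex.I))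
        = Complex.exp ((-(2 * Complex.I)) * θ) := by
      intro θ; rw [← Complex.exp_add]; congr 1; ring
    simp only [h1]
    rw [integral_exp_mul_complex (by simp)]
    have : Complex.exp (-(2 * Complex.I) * ((2 * π : ℝ):ℂ)) = 1 := by
      rw [Complex.exp_eq_one_iff]; exact ⟨-2, by push_cast; ring⟩
    rw [this]; simp
  have bm : ∀ s, 0 < s → s < r1 → ‖m' s - 2 * π * α / s‖ ≤ 2 * π * (C * s ^ (-γ)) := by
    intro s hs hs1
    have hs0 : (s:ℂ) ≠ 0 := by exact_mod_cast hs.ne'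
    have e1 : ∀ θ : ℝ, Complex.exp (-(θ * Complex.I)) * (α / (starRingEnd ℂ) (circleMap 0 s θ)
        + β / circleMap 0 s θ) = α / s + β / s * (Complex.exp (-(θ * Complex.I)) * Complex.exp (-(θ * Complex.I))) := by
      intro θ
      have h1 : circleMap 0 s θ = s * Complex.exp (θ * Complex.I) := by simp [circleMap]
      have h2 : (starRingEnd ℂ) (circleMap 0 s θ) = s * Complex.exp (-(θ * Complex.I)) := by
        rw [h1, map_mul, Complex.conj_ofReal, ← Complex.exp_conj]; simp
      have hx : Complex.exp (θ * Complex.I) ≠ 0 := Complex.exp_ne_zero _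
      rw [h2, h1, Complex.exp_neg]
      field_simp
    have hc2 : Continuous fun θ : ℝ => Complex.exp (-(θ * Complex.I)) * (α / (starRingEnd ℂ) (circleMap 0 s θ)
        + β / circleMap 0 s θ) := by
      simp only [e1]; fun_prop
    have e2 : ∫ θ in (0:ℝ)..(2 * π), Complex.exp (-(θ * Complex.I)) * (α / (starRingEnd ℂ) (circleMap 0 s θ)
        + β / circleMap 0 s θ) = 2 * π * α / s := by
      simp only [e1]
      have hc3 : Continuous fun θ : ℝ => β / s * (Complex.exp (-(θ * Complex.I)) * Complex.exp (-(θ * Complex.I))) := by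
        fun_prop
      have hc4 : Continuous fun _ : ℝ => α / (s:ℂ) := by fun_prop
      rw [intervalIntegral.integral_add (hc4.intervalIntegrable _ _) (hc3.intervalIntegrable _ _),
        intervalIntegral.integral_const_mul, hI2, intervalIntegral.integral_const]
      simp; ring
    rw [← e2, hm']
    simp only []
    rw [← intervalIntegral.integral_sub ((hcdb s hs hs1).intervalIntegrable _ _) (hc2.intervalIntegrable _ _)]
    apply norm_circ_integral_le
    intro θ
    rw [← mul_sub, norm_mul, norm_exp_neg_I, one_mul]
    have := hd (circleMap 0 s θ) (by rw [hcn s θ hs]; exact hs) (by rw [hcn s θ hs]; exact hs1)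
    rwa [hcn s θ hs] at this
  set N : ℝ → ℂ := fun s => m s - 2 * π * α * (Real.log s : ℂ) with hN
  have dN : ∀ s, 0 < s → s < r1 → HasDerivAt N (m' s - 2 * π * α / s) s := by
    intro s hs hs1
    have h1 : HasDerivAt (fun s : ℝ => (Real.log s : ℂ)) ((s⁻¹ : ℝ) : ℂ) s :=
      (Real.hasDerivAt_log hs.ne').ofReal_comp
    have h2 := (dm s hs hs1).sub (h1.const_mul (2 * π * α))
    have e : 2 * π * α / s = 2 * π * α * ((s⁻¹ : ℝ) : ℂ) := by push_cast; rw [div_eq_mul_inv]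
    rw [e]; exact h2
  set s1 := min (r1 / 2) (1 / 2) with hs1
  have hs1p : 0 < s1 := by positivity
  have hs1r : s1 < r1 := (min_le_left _ _).trans_lt (by linarith)
  have hs1h : s1 < 1 := (min_le_right _ _).trans_lt (by norm_num)
  have hC : 0 ≤ C := by
    have := (norm_nonneg _).trans (bm s1 hs1p hs1r)
    have h2 : 0 < s1 ^ (-γ) := Real.rpow_pos_of_pos hs1p _
    by_contra hneg
    have : C * s1 ^ (-γ) < 0 := mul_neg_of_neg_of_pos (not_le.1 hneg) h2
    nlinarith
  obtain ⟨B, hB⟩ : ∃ B, ∀ s, 0 < s → s ≤ s1 → ‖N s‖ ≤ B := by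
    refine ⟨‖N s1‖ + 2 * π * C / (1 - γ) * s1 ^ (1 - γ), fun s hs hss => ?_⟩
    have h := rad_int (f := N) (f' := fun s => m' s - 2 * π * α / s) (C := 2 * π * C) (α := γ - 1)
      hs hss (by linarith) (fun x hx => dN x (hs.trans_le hx.1) (hx.2.trans_lt hs1r))
      (fun x hx => by
        have := bm x (hs.trans_le hx.1) (hx.2.trans_lt hs1r)
        rw [show -(1 + (γ - 1)) = -γ by ring]; linarith)
    have e : 2 * π * C / (γ - 1) * (s ^ (-(γ - 1)) - s1 ^ (-(γ - 1)))
        = 2 * π * C / (1 - γ) * (s1 ^ (1 - γ) - s ^ (1 - γ)) := by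
      rw [show -(γ - 1) = 1 - γ by ring]
      have h1 : γ - 1 ≠ 0 := by linarith
      have h2 : 1 - γ ≠ 0 := by linarith
      field_simp; ring
    rw [e] at h
    have h3 : ‖N s‖ ≤ ‖N s1‖ + ‖N s1 - N s‖ := by
      have := norm_sub_le (N s1) (N s1 - N s); simpa using this
    have h4 : 0 ≤ 2 * π * C / (1 - γ) := div_nonneg (by positivity) (by linarith)
    have h5 : 0 ≤ s ^ (1 - γ) := by positivity
    nlinarith
  by_contra hα
  have hαp : 0 < ‖α‖ := norm_pos_iff.2 hα
  obtain ⟨ρ, hρ, hoρ⟩ := ho (‖α‖ / 2) (by positivity)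
  have hlog : Tendsto (fun s : ℝ => π * ‖α‖ * |Real.log s|) (𝓝[>] 0) atTop :=
    (tendsto_abs_atBot_atTop.comp Real.tendsto_log_nhdsGT_zero).const_mul_atTop (by positivity)
  have ev : ∀ᶠ s : ℝ in 𝓝[>] 0, s < min s1 ρ :=
    nhdsWithin_le_nhds (Iio_mem_nhds (by positivity))
  obtain ⟨s, h1, h2, h3⟩ := ((hlog.eventually_gt_atTop B).and (ev.and self_mem_nhdsWithin)).exists
  have h3 : 0 < s := h3
  have hms : ‖m s‖ ≤ 2 * π * (‖α‖ / 2 * |Real.log s|) := norm_circ_integral_le fun θ => by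
    have := hoρ (circleMap 0 s θ) (by rw [hcn s θ h3]; exact h3)
      (by rw [hcn s θ h3]; exact h2.trans_le (min_le_right _ _))
    rwa [hcn s θ h3] at this
  have hNs := hB s h3 (h2.le.trans (min_le_left _ _))
  have e : 2 * π * ‖α‖ * |Real.log s| ≤ ‖m s‖ + ‖N s‖ := by
    have e1 : 2 * π * α * (Real.log s : ℂ) = m s - N s := by simp [hN]
    calc 2 * π * ‖α‖ * |Real.log s| = ‖2 * π * α * (Real.log s : ℂ)‖ := by
          rw [norm_mul, norm_mul, norm_mul, Complex.norm_real, Complex.norm_real, Real.norm_eq_abs,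
            Real.norm_eq_abs, abs_of_pos hπ]; simp
      _ ≤ _ := by rw [e1]; exact norm_sub_le _ _
  nlinarith

end

section
/-- plane partial derivatives -/
def d1 (φ : ℂ → ℝ) (z : ℂ) : ℝ := fderiv ℝ φ z 1
def d2 (φ : ℂ → ℝ) (z : ℂ) : ℝ := fderiv ℝ φ z Complex.I

/-- having plane partial derivatives s, t -/
def PD (φ : ℂ → ℝ) (z : ℂ) (s t : ℝ) : Prop :=
  HasFDerivAt φ (s • Complex.reCLM + t • Complex.imCLM) z

lemma PD.d1 {φ : ℂ → ℝ} {z : ℂ} {s t : ℝ} (h : PD φ z s t) : d1 φ z = s := by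
  unfold _root_.d1; rw [HasFDerivAt.fderiv h]; simp

lemma PD.d2 {φ : ℂ → ℝ} {z : ℂ} {s t : ℝ} (h : PD φ z s t) : d2 φ z = t := by
  unfold _root_.d2; rw [HasFDerivAt.fderiv h]; simp

lemma PD_of_hasFDerivAt {φ : ℂ → ℝ} {z : ℂ} {D : ℂ →L[ℝ] ℝ} (h : HasFDerivAt φ D z) :
    PD φ z (D 1) (D Complex.I) := by
  unfold PD
  have : D 1 • Complex.reCLM + D Complex.I • Complex.imCLM = D := by
    apply ContinuousLinearMap.ext
    intro w
    have hw : w = w.re • (1:ℂ) + w.im • Complex.I := by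
      simp
    have : D w = w.re * D 1 + w.im * D Complex.I := by
      conv_lhs => rw [hw]
      rw [map_add, map_smul, map_smul, smul_eq_mul, smul_eq_mul]
    rw [this]; simp; ring
  rw [this]; exact h

lemma PD_of_diff {φ : ℂ → ℝ} {z : ℂ} (h : DifferentiableAt ℝ φ z) :
    PD φ z (d1 φ z) (d2 φ z) := PD_of_hasFDerivAt h.hasFDerivAt

lemma PD.congr {φ : ℂ → ℝ} {z : ℂ} {s t s' t' : ℝ} (h : PD φ z s t) (hs : s = s') (ht : t = t') :
    PD φ z s' t' := by subst hs ht; exact h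

lemma PD_const (k : ℝ) (z : ℂ) : PD (fun _ => k) z 0 0 := by
  unfold PD; simpa using hasFDerivAt_const k z

lemma PD_re (z : ℂ) : PD (fun z => z.re) z 1 0 := by
  have h : HasFDerivAt (fun z : ℂ => z.re) Complex.reCLM z := Complex.reCLM.hasFDerivAt
  have := PD_of_hasFDerivAt h
  simpa using this

lemma PD_im (z : ℂ) : PD (fun z => z.im) z 0 1 := by
  have h : HasFDerivAt (fun z : ℂ => z.im) Complex.imCLM z := Complex.imCLM.hasFDerivAt
  have := PD_of_hasFDerivAt h
  simpa using this

lemma PD.add {φ ψ : ℂ → ℝ} {z : ℂ} {s t s' t' : ℝ} (h : PD φ z s t) (h' : PD ψ z s' t') :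
    PD (fun z => φ z + ψ z) z (s + s') (t + t') := by
  have := PD_of_hasFDerivAt (HasFDerivAt.add h h')
  simp at this
  exact this

lemma PD.sub {φ ψ : ℂ → ℝ} {z : ℂ} {s t s' t' : ℝ} (h : PD φ z s t) (h' : PD ψ z s' t') :
    PD (fun z => φ z - ψ z) z (s - s') (t - t') := by
  have := PD_of_hasFDerivAt (HasFDerivAt.sub h h')
  simp at this
  exact this

lemma PD.mul {φ ψ : ℂ → ℝ} {z : ℂ} {s t s' t' : ℝ} (h : PD φ z s t) (h' : PD ψ z s' t') :
    PD (fun z => φ z * ψ z) z (φ z * s' + ψ z * s) (φ z * t' + ψ z * t) := by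
  have := PD_of_hasFDerivAt (HasFDerivAt.mul h h')
  simp at this
  exact this

lemma PD.neg {φ : ℂ → ℝ} {z : ℂ} {s t : ℝ} (h : PD φ z s t) :
    PD (fun z => - φ z) z (-s) (-t) := by
  have := PD_of_hasFDerivAt (HasFDerivAt.neg h)
  simp at this
  exact this

lemma PD.inv {φ : ℂ → ℝ} {z : ℂ} {s t : ℝ} (h : PD φ z s t) (h0 : φ z ≠ 0) :
    PD (fun z => (φ z)⁻¹) z (-s * ((φ z)⁻¹) ^ 2) (-t * ((φ z)⁻¹) ^ 2) := by
  have := PD_of_hasFDerivAt ((hasDerivAt_inv h0).comp_hasFDerivAt z h)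
  simp at this
  refine PD.congr this ?_ ?_ <;> ring

lemma PD.const_mul {φ : ℂ → ℝ} {z : ℂ} {s t : ℝ} (k : ℝ) (h : PD φ z s t) :
    PD (fun z => k * φ z) z (k * s) (k * t) :=
  ((PD_const k z).mul h).congr (by ring) (by ring)

def qq (z : ℂ) : ℝ := (1 + z.re * z.re + z.im * z.im)⁻¹

lemma qq_den (z : ℂ) : 0 < 1 + z.re * z.re + z.im * z.im := by nlinarith [mul_self_nonneg z.re, mul_self_nonneg z.im]

lemma qq_pos (z : ℂ) : 0 < qq z := inv_pos.2 (qq_den z)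

lemma qq_eq (z : ℂ) : qq z * (1 + z.re * z.re + z.im * z.im) = 1 := inv_mul_cancel₀ (qq_den z).ne'

lemma PD_qq (z : ℂ) : PD qq z (-2 * z.re * qq z ^ 2) (-2 * z.im * qq z ^ 2) := by
  have h := (((PD_const 1 z).add ((PD_re z).mul (PD_re z))).add ((PD_im z).mul (PD_im z))).inv
    (qq_den z).ne'
  refine PD.congr h ?_ ?_ <;> (simp only [qq]; ring)

def sX : Fin 3 → ℂ → ℝ := ![fun z => 2 * z.re * qq z, fun z => 2 * z.im * qq z, fun z => 2 * qq z - 1]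
def sY : Fin 3 → ℂ → ℝ := ![fun z => 2 * qq z - 4 * z.re * z.re * (qq z * qq z),
  fun z => -4 * z.re * z.im * (qq z * qq z), fun z => -4 * z.re * (qq z * qq z)]
def sW : Fin 3 → ℂ → ℝ := ![fun z => -4 * z.re * z.im * (qq z * qq z),
  fun z => 2 * qq z - 4 * z.im * z.im * (qq z * qq z), fun z => -4 * z.im * (qq z * qq z)]
def smu (z : ℂ) : ℝ := 4 * qq z ^ 2

lemma smu_pos (z : ℂ) : 0 < smu z := by have := qq_pos z; unfold smu; positivity

lemma PD_sX (l : Fin 3) (z : ℂ) : PD (sX l) z (sY l z) (sW l z) := by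
  have hq := PD_qq z
  have ha := PD_re z
  have hb := PD_im z
  fin_cases l
  · refine ((ha.const_mul 2).mul hq).congr ?_ ?_ <;> simp [sY, sW] <;> ring
  · refine ((hb.const_mul 2).mul hq).congr ?_ ?_ <;> simp [sY, sW] <;> ring
  · refine ((hq.const_mul 2).sub (PD_const 1 z)).congr ?_ ?_ <;> simp [sY, sW] <;> ring

lemma PD_sYW (l : Fin 3) (z : ℂ) : ∃ A B E, PD (sY l) z A B ∧ PD (sW l) z B E ∧
    A + E = -2 * smu z * sX l z := by
  have hq := PD_qq z
  have hqq := hq.mul hq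
  have ha := PD_re z
  have hb := PD_im z
  have e := qq_eq z
  fin_cases l
  · have h1 := (hq.const_mul 2).sub (((ha.const_mul 4).mul ha).mul hqq)
    have h2 := ((ha.const_mul (-4)).mul hb).mul hqq
    refine ⟨_, _, _, h1, h2.congr ?_ rfl, ?_⟩ <;> simp [smu, sX]
    · ring
    · linear_combination (16 * z.re * qq z ^ 2) * e
  · have h1 := ((ha.const_mul (-4)).mul hb).mul hqq
    have h2 := (hq.const_mul 2).sub (((hb.const_mul 4).mul hb).mul hqq)
    refine ⟨_, _, _, h1, h2.congr ?_ rfl, ?_⟩ <;> simp [smu, sX]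
    · ring
    · linear_combination (16 * z.im * qq z ^ 2) * e
  · have h1 := (ha.const_mul (-4)).mul hqq
    have h2 := (hb.const_mul (-4)).mul hqq
    refine ⟨_, _, _, h1, h2.congr ?_ rfl, ?_⟩ <;> simp [smu, sX]
    · ring
    · linear_combination (16 * qq z ^ 2) * e

lemma s_unit (z : ℂ) : sX 0 z ^ 2 + sX 1 z ^ 2 + sX 2 z ^ 2 = 1 := by
  have e := qq_eq z
  simp only [sX]; simp
  linear_combination (4 * qq z) * e

lemma s_compl (l m : Fin 3) (z : ℂ) : sY l z * sY m z + sW l z * sW m z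
    = smu z * ((if l = m then 1 else 0) - sX l z * sX m z) := by
  have e := qq_eq z
  fin_cases l <;> fin_cases m <;> simp [sX, sY, sW, smu]
  · linear_combination (16 * z.re ^ 2 * qq z ^ 3) * e
  · linear_combination (16 * z.re * z.im * qq z ^ 3) * e
  · linear_combination (16 * z.re * qq z ^ 3) * e
  · linear_combination (16 * z.re * z.im * qq z ^ 3) * e
  · linear_combination (16 * z.im ^ 2 * qq z ^ 3) * e
  · linear_combination (16 * z.im * qq z ^ 3) * e
  · linear_combination (16 * z.re * qq z ^ 3) * e
  · linear_combination (16 * z.im * qq z ^ 3) * e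
  · linear_combination (16 * qq z ^ 3) * e

/-- y = w × x -/
lemma s_cross1 (z : ℂ) : sY 0 z = sW 1 z * sX 2 z - sW 2 z * sX 1 z ∧
    sY 1 z = sW 2 z * sX 0 z - sW 0 z * sX 2 z ∧ sY 2 z = sW 0 z * sX 1 z - sW 1 z * sX 0 z := by
  have e := qq_eq z
  refine ⟨?_, ?_, ?_⟩ <;> simp [sX, sY, sW]
  · linear_combination (-4 * qq z) * e
  · linear_combination (0) * e
  · linear_combination (0) * e

/-- w = x × y -/
lemma s_cross2 (z : ℂ) : sW 0 z = sX 1 z * sY 2 z - sX 2 z * sY 1 z ∧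
    sW 1 z = sX 2 z * sY 0 z - sX 0 z * sY 2 z ∧ sW 2 z = sX 0 z * sY 1 z - sX 1 z * sY 0 z := by
  have e := qq_eq z
  refine ⟨?_, ?_, ?_⟩ <;> simp [sX, sY, sW]
  · linear_combination (0) * e
  · linear_combination (-4 * qq z) * e
  · linear_combination (0) * e

/-- y × w = μ x -/
lemma s_cross3 (z : ℂ) : sY 1 z * sW 2 z - sY 2 z * sW 1 z = smu z * sX 0 z ∧
    sY 2 z * sW 0 z - sY 0 z * sW 2 z = smu z * sX 1 z ∧
    sY 0 z * sW 1 z - sY 1 z * sW 0 z = smu z * sX 2 z := by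
  have e := qq_eq z
  refine ⟨?_, ?_, ?_⟩ <;> simp [sX, sY, sW, smu]
  · linear_combination (0) * e
  · linear_combination (0) * e
  · linear_combination (-8 * qq z^2) * e

end

section
lemma alg_lap (c : ℝ) (x y w : Fin 3 → ℝ) (G : Fin 3 → Fin 3 → ℝ) (H : Fin 3 → Fin 3 → Fin 3 → ℝ)
    (hs : ∀ i l m, H i l m = H i m l)
    (hE2 : ∀ i m, c * (x 0 * H i 0 m + x 1 * H i 1 m + x 2 * H i 2 m) = -2 * G i m)
    (hdd : ∀ m, H 0 m 0 + H 1 m 1 + H 2 m 2 = 0)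
    (y0 : y 0 = w 1 * x 2 - w 2 * x 1) (y1 : y 1 = w 2 * x 0 - w 0 * x 2)
    (y2 : y 2 = w 0 * x 1 - w 1 * x 0) :
    c * (y 0 * (H 0 0 0 + H 0 1 1 + H 0 2 2) + y 1 * (H 1 0 0 + H 1 1 1 + H 1 2 2)
       + y 2 * (H 2 0 0 + H 2 1 1 + H 2 2 2))
    + c * (w 0 * (x 0 * (H 2 0 1 - H 1 0 2) + x 1 * (H 0 0 2 - H 2 0 0) + x 2 * (H 1 0 0 - H 0 0 1))
         + w 1 * (x 0 * (H 2 1 1 - H 1 1 2) + x 1 * (H 0 1 2 - H 2 1 0) + x 2 * (H 1 1 0 - H 0 1 1))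
         + w 2 * (x 0 * (H 2 2 1 - H 1 2 2) + x 1 * (H 0 2 2 - H 2 2 0) + x 2 * (H 1 2 0 - H 0 2 1)))
    + 2 * (w 0 * (G 2 1 - G 1 2) + w 1 * (G 0 2 - G 2 0) + w 2 * (G 1 0 - G 0 1)) = 0 := by
  have e21 := hE2 2 1
  have e12 := hE2 1 2
  have e02 := hE2 0 2
  have e20 := hE2 2 0
  have e10 := hE2 1 0
  have e01 := hE2 0 1
  have g0 := hdd 0
  have g1 := hdd 1
  have g2 := hdd 2
  rw [y0, y1, y2]
  simp only [hs _ 1 0, hs _ 2 0, hs _ 2 1] at *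
  linear_combination (c * (w 1 * x 2 - w 2 * x 1)) * g0 + (c * (w 2 * x 0 - w 0 * x 2)) * g1
    + (c * (w 0 * x 1 - w 1 * x 0)) * g2 + w 0 * (e21 - e12) + w 1 * (e02 - e20) + w 2 * (e10 - e01)

lemma alg_E1 (c : ℝ) (hc : c ≠ 0) (x y w U gp : Fin 3 → ℝ) (G : Fin 3 → Fin 3 → ℝ)
    (H : Fin 3 → Fin 3 → Fin 3 → ℝ)
    (hs : ∀ i l m, H i l m = H i m l)
    (hE1 : ∀ i, c * (x 0 * G i 0 + x 1 * G i 1 + x 2 * G i 2) = - U i)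
    (hE2 : ∀ i m, c * (x 0 * H i 0 m + x 1 * H i 1 m + x 2 * H i 2 m) = -2 * G i m)
    (hdd : ∀ m, H 0 m 0 + H 1 m 1 + H 2 m 2 = 0)
    (hNS : ∀ i, gp i = (H i 0 0 + H i 1 1 + H i 2 2) - (U 0 * G i 0 + U 1 * G i 1 + U 2 * G i 2))
    (y0 : y 0 = w 1 * x 2 - w 2 * x 1) (y1 : y 1 = w 2 * x 0 - w 0 * x 2)
    (y2 : y 2 = w 0 * x 1 - w 1 * x 0)
    (w0 : w 0 = x 1 * y 2 - x 2 * y 1) (w1 : w 1 = x 2 * y 0 - x 0 * y 2)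
    (w2 : w 2 = x 0 * y 1 - x 1 * y 0) (f d1f d2W v2 om : ℝ)
    (hf : f = U 0 * x 0 + U 1 * x 1 + U 2 * x 2)
    (hd1f : d1f = (U 0 * y 0 + U 1 * y 1 + U 2 * y 2)
      + c * (x 0 * (y 0 * G 0 0 + y 1 * G 0 1 + y 2 * G 0 2) + x 1 * (y 0 * G 1 0 + y 1 * G 1 1 + y 2 * G 1 2)
       + x 2 * (y 0 * G 2 0 + y 1 * G 2 1 + y 2 * G 2 2)))
    (hv2 : v2 = U 0 * w 0 + U 1 * w 1 + U 2 * w 2)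
    (hom : om = x 0 * (G 2 1 - G 1 2) + x 1 * (G 0 2 - G 2 0) + x 2 * (G 1 0 - G 0 1))
    (hd2W : d2W = w 0 * (G 2 1 - G 1 2) + w 1 * (G 0 2 - G 2 0) + w 2 * (G 1 0 - G 0 1) +
     c * (w 0 * (x 0 * (H 2 0 1 - H 1 0 2) + x 1 * (H 0 0 2 - H 2 0 0) + x 2 * (H 1 0 0 - H 0 0 1))
         + w 1 * (x 0 * (H 2 1 1 - H 1 1 2) + x 1 * (H 0 1 2 - H 2 1 0) + x 2 * (H 1 1 0 - H 0 1 1))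
         + w 2 * (x 0 * (H 2 2 1 - H 1 2 2) + x 1 * (H 0 2 2 - H 2 2 0) + x 2 * (H 1 2 0 - H 0 2 1)))) :
    c * (y 0 * gp 0 + y 1 * gp 1 + y 2 * gp 2)
     + c * (U 0 * (y 0 * G 0 0 + y 1 * G 0 1 + y 2 * G 0 2) + U 1 * (y 0 * G 1 0 + y 1 * G 1 1 + y 2 * G 1 2)
       + U 2 * (y 0 * G 2 0 + y 1 * G 2 1 + y 2 * G 2 2)) - (f + c⁻¹) * d1f = - d2W + c * v2 * om := by
  have hl := alg_lap c x y w G H hs hE2 hdd y0 y1 y2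
  have hwo : c * (w 0 * (G 2 1 - G 1 2) + w 1 * (G 0 2 - G 2 0) + w 2 * (G 1 0 - G 0 1)) = - d1f := by
    rw [hd1f, w0, w1, w2]
    linear_combination y 0 * hE1 0 + y 1 * hE1 1 + y 2 * hE1 2
  have hwo' : c⁻¹ * d1f = - (w 0 * (G 2 1 - G 1 2) + w 1 * (G 0 2 - G 2 0) + w 2 * (G 1 0 - G 0 1)) := by
    rw [← neg_eq_iff_eq_neg] at hwo; rw [← hwo]; field_simp
  have hux : (U 0 * (y 0 * G 0 0 + y 1 * G 0 1 + y 2 * G 0 2) + U 1 * (y 0 * G 1 0 + y 1 * G 1 1 + y 2 * G 1 2)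
       + U 2 * (y 0 * G 2 0 + y 1 * G 2 1 + y 2 * G 2 2))
     - (y 0 * (U 0 * G 0 0 + U 1 * G 0 1 + U 2 * G 0 2) + y 1 * (U 0 * G 1 0 + U 1 * G 1 1 + U 2 * G 1 2)
       + y 2 * (U 0 * G 2 0 + U 1 * G 2 1 + U 2 * G 2 2))
     = v2 * om - f * (w 0 * (G 2 1 - G 1 2) + w 1 * (G 0 2 - G 2 0) + w 2 * (G 1 0 - G 0 1)) := by
    rw [hv2, hom, hf, y0, y1, y2]; ring
  rw [hNS 0, hNS 1, hNS 2, hd2W]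
  linear_combination hl + c * hux - f * hwo - hwo'

lemma e3_apply (l m : Fin 3) : (e3 l) m = if m = l then 1 else 0 := by
  simp [e3]

/-- the point c X(z) -/
def pos (c : ℝ) (z : ℂ) : V3 := ∑ l, (c * sX l z) • e3 l

lemma pos_apply (c : ℝ) (z : ℂ) (m : Fin 3) : pos c z m = c * sX m z := by
  unfold pos
  rw [Fin.sum_univ_three]
  fin_cases m <;> simp [e3_apply]

lemma V3_eta (x : V3) : x = ∑ l, x l • e3 l := by
  ext m
  rw [Fin.sum_univ_three]
  fin_cases m <;> simp [e3_apply]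

lemma PD_pos (c : ℝ) (z : ℂ) {g : V3 → ℝ} (hg : DifferentiableAt ℝ g (pos c z)) :
    PD (fun z => g (pos c z)) z
     (c * (sY 0 z * pd 0 g (pos c z) + sY 1 z * pd 1 g (pos c z) + sY 2 z * pd 2 g (pos c z)))
     (c * (sW 0 z * pd 0 g (pos c z) + sW 1 z * pd 1 g (pos c z) + sW 2 z * pd 2 g (pos c z))) := by
  have h1 : HasFDerivAt (fun z => ∑ l, (c * sX l z) • e3 l)
      (∑ l, ((c * sY l z) • Complex.reCLM + (c * sW l z) • Complex.imCLM).smulRight (e3 l)) z := by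
    apply HasFDerivAt.fun_sum
    intro l _
    exact HasFDerivAt.smul_const ((PD_sX l z).const_mul c) (e3 l)
  have h2 : HasFDerivAt g (fderiv ℝ g (pos c z)) (∑ l, (c * sX l z) • e3 l) := hg.hasFDerivAt
  have h3 := PD_of_hasFDerivAt (HasFDerivAt.comp z h2 h1)
  refine PD.congr h3 ?_ ?_
  · simp [Fin.sum_univ_three, pd]; ring
  · simp [Fin.sum_univ_three, pd]; ring

lemma contDiff_qq : ContDiff ℝ (⊤:ℕ∞) qq := by
  unfold qq
  have hr : ContDiff ℝ (⊤:ℕ∞) (fun z : ℂ => z.re) := Complex.reCLM.contDiff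
  have hi : ContDiff ℝ (⊤:ℕ∞) (fun z : ℂ => z.im) := Complex.imCLM.contDiff
  exact ((contDiff_const.add (hr.mul hr)).add (hi.mul hi)).inv (fun z => (qq_den z).ne')

lemma contDiff_sX (l : Fin 3) : ContDiff ℝ (⊤:ℕ∞) (sX l) := by
  have hr : ContDiff ℝ (⊤:ℕ∞) (fun z : ℂ => z.re) := Complex.reCLM.contDiff
  have hi : ContDiff ℝ (⊤:ℕ∞) (fun z : ℂ => z.im) := Complex.imCLM.contDiff
  have hq := contDiff_qq
  fin_cases l <;> simp only [sX] <;> simp <;> fun_prop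

lemma contDiff_sY (l : Fin 3) : ContDiff ℝ (⊤:ℕ∞) (sY l) := by
  have hr : ContDiff ℝ (⊤:ℕ∞) (fun z : ℂ => z.re) := Complex.reCLM.contDiff
  have hi : ContDiff ℝ (⊤:ℕ∞) (fun z : ℂ => z.im) := Complex.imCLM.contDiff
  have hq := contDiff_qq
  fin_cases l <;> simp only [sY] <;> simp <;> fun_prop

lemma contDiff_sW (l : Fin 3) : ContDiff ℝ (⊤:ℕ∞) (sW l) := by
  have hr : ContDiff ℝ (⊤:ℕ∞) (fun z : ℂ => z.re) := Complex.reCLM.contDiff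
  have hi : ContDiff ℝ (⊤:ℕ∞) (fun z : ℂ => z.im) := Complex.imCLM.contDiff
  have hq := contDiff_qq
  fin_cases l <;> simp only [sW] <;> simp <;> fun_prop

lemma contDiff_pos (c : ℝ) : ContDiff ℝ (⊤:ℕ∞) (pos c) := by
  unfold pos
  apply ContDiff.sum
  intro l _
  exact (contDiff_const.mul (contDiff_sX l)).smul contDiff_const

end

section
lemma pd_add {m : Fin 3} {A B : V3 → ℝ} {x : V3} (hA : DifferentiableAt ℝ A x)
    (hB : DifferentiableAt ℝ B x) : pd m (fun x => A x + B x) x = pd m A x + pd m B x := by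
  unfold pd; rw [fderiv_fun_add hA hB]; simp

lemma pd_mul {m : Fin 3} {A B : V3 → ℝ} {x : V3} (hA : DifferentiableAt ℝ A x)
    (hB : DifferentiableAt ℝ B x) : pd m (fun x => A x * B x) x = A x * pd m B x + B x * pd m A x := by
  unfold pd; rw [fderiv_fun_mul hA hB]; simp

lemma hasFDerivAt_coord (l : Fin 3) (x : V3) :
    HasFDerivAt (fun x : V3 => x l) (EuclideanSpace.proj l : V3 →L[ℝ] ℝ) x :=
  (EuclideanSpace.proj l : V3 →L[ℝ] ℝ).hasFDerivAt

lemma pd_coord (m l : Fin 3) (x : V3) : pd m (fun x : V3 => x l) x = if l = m then 1 else 0 := by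
  unfold pd; rw [(hasFDerivAt_coord l x).fderiv]; simp [e3_apply]

lemma pd_congr {m : Fin 3} {A B : V3 → ℝ} {x : V3} (h : A =ᶠ[𝓝 x] B) : pd m A x = pd m B x := by
  unfold pd; rw [h.fderiv_eq]

lemma pd_smooth {O : Set V3} (hO : IsOpen O) {g : V3 → ℝ} (hg : ContDiffOn ℝ (⊤:ℕ∞) g O)
    (l : Fin 3) : ContDiffOn ℝ (⊤:ℕ∞) (pd l g) O := by
  have h := hg.fderiv_of_isOpen hO (m := (⊤:ℕ∞)) (by simp)
  unfold pd
  exact h.clm_apply contDiffOn_const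

lemma sm_diff {O : Set V3} (hO : IsOpen O) {g : V3 → ℝ} (hg : ContDiffOn ℝ (⊤:ℕ∞) g O)
    {x : V3} (hx : x ∈ O) : DifferentiableAt ℝ g x :=
  (hg.contDiffAt (hO.mem_nhds hx)).differentiableAt (by simp)

lemma pd_symm {O : Set V3} (hO : IsOpen O) {g : V3 → ℝ} (hg : ContDiffOn ℝ (⊤:ℕ∞) g O)
    {x : V3} (hx : x ∈ O) (l m : Fin 3) : pd l (pd m g) x = pd m (pd l g) x := by
  have hat := hg.contDiffAt (hO.mem_nhds hx)
  have hsym : IsSymmSndFDerivAt ℝ g x := hat.isSymmSndFDerivAt (by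
    simp only [minSmoothness_of_isRCLikeNormedField]; norm_cast)
  have hd : DifferentiableAt ℝ (fderiv ℝ g) x :=
    (hat.fderiv_right (m := 1) (by norm_cast)).differentiableAt (by simp)
  have key : ∀ l m, pd l (pd m g) x = fderiv ℝ (fderiv ℝ g) x (e3 l) (e3 m) := by
    intro l m
    unfold pd
    rw [fderiv_clm_apply hd (by fun_prop)]
    simp
  rw [key, key]
  exact hsym _ _

structure NSd (O : Set V3) (u : Fin 3 → V3 → ℝ) (p : V3 → ℝ) : Prop where
  ho : IsOpen O
  su : ∀ i, ContDiffOn ℝ (⊤:ℕ∞) (u i) O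
  sp : ContDiffOn ℝ (⊤:ℕ∞) p O
  eu : ∀ x ∈ O, ∀ i, x 0 * pd 0 (u i) x + x 1 * pd 1 (u i) x + x 2 * pd 2 (u i) x = - u i x
  ep : ∀ x ∈ O, x 0 * pd 0 p x + x 1 * pd 1 p x + x 2 * pd 2 p x = -2 * p x
  ns : ∀ x ∈ O, ∀ i, pd i p x = (pd 0 (pd 0 (u i)) x + pd 1 (pd 1 (u i)) x + pd 2 (pd 2 (u i)) x)
     - (u 0 x * pd 0 (u i) x + u 1 x * pd 1 (u i) x + u 2 x * pd 2 (u i) x)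
  dv : ∀ x ∈ O, pd 0 (u 0) x + pd 1 (u 1) x + pd 2 (u 2) x = 0

variable {O : Set V3} {u : Fin 3 → V3 → ℝ} {p : V3 → ℝ}

lemma NSd.eu2 (N : NSd O u p) {x : V3} (hx : x ∈ O) (i m : Fin 3) :
    x 0 * pd 0 (pd m (u i)) x + x 1 * pd 1 (pd m (u i)) x + x 2 * pd 2 (pd m (u i)) x
      = -2 * pd m (u i) x := by
  have hd : ∀ l, DifferentiableAt ℝ (pd l (u i)) x := fun l =>
    sm_diff N.ho (pd_smooth N.ho (N.su i) l) hx
  have hdu := sm_diff N.ho (N.su i) hx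
  have hc : ∀ l, DifferentiableAt ℝ (fun x : V3 => x l) x := fun l =>
    (hasFDerivAt_coord l x).differentiableAt
  have h0 : (fun x : V3 => x 0 * pd 0 (u i) x + x 1 * pd 1 (u i) x + x 2 * pd 2 (u i) x + u i x)
      =ᶠ[𝓝 x] fun _ => 0 := by
    filter_upwards [N.ho.mem_nhds hx] with y hy
    rw [N.eu y hy i]; ring
  have h1 := pd_congr (m := m) h0
  have h2 : pd m (fun _ : V3 => (0:ℝ)) x = 0 := by simp [pd]
  have q0 := (hc 0).fun_mul (hd 0)
  have q1 := (hc 1).fun_mul (hd 1)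
  have q2 := (hc 2).fun_mul (hd 2)
  rw [h2, pd_add ((q0.fun_add q1).fun_add q2) hdu, pd_add (q0.fun_add q1) q2, pd_add q0 q1,
    pd_mul (hc 0) (hd 0), pd_mul (hc 1) (hd 1), pd_mul (hc 2) (hd 2), pd_coord, pd_coord, pd_coord] at h1
  rw [pd_symm N.ho (N.su i) hx 0 m, pd_symm N.ho (N.su i) hx 1 m, pd_symm N.ho (N.su i) hx 2 m]
  fin_cases m <;> simp at h1 ⊢ <;> linarith

lemma NSd.ddiv (N : NSd O u p) {x : V3} (hx : x ∈ O) (m : Fin 3) :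
    pd m (pd 0 (u 0)) x + pd m (pd 1 (u 1)) x + pd m (pd 2 (u 2)) x = 0 := by
  have hd : ∀ l i, DifferentiableAt ℝ (pd l (u i)) x := fun l i =>
    sm_diff N.ho (pd_smooth N.ho (N.su i) l) hx
  have h0 : (fun x : V3 => pd 0 (u 0) x + pd 1 (u 1) x + pd 2 (u 2) x)
      =ᶠ[𝓝 x] fun _ => 0 := by
    filter_upwards [N.ho.mem_nhds hx] with y hy
    rw [N.dv y hy]
  have h1 := pd_congr (m := m) h0
  have h2 : pd m (fun _ : V3 => (0:ℝ)) x = 0 := by simp [pd]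
  rw [h2, pd_add ((hd 0 0).fun_add (hd 1 1)) (hd 2 2), pd_add (hd 0 0) (hd 1 1)] at h1
  exact h1

/-- plane functions -/
def zf (u : Fin 3 → V3 → ℝ) (c : ℝ) (z : ℂ) : ℝ :=
  u 0 (pos c z) * sX 0 z + u 1 (pos c z) * sX 1 z + u 2 (pos c z) * sX 2 z
def zv1 (u : Fin 3 → V3 → ℝ) (c : ℝ) (z : ℂ) : ℝ :=
  u 0 (pos c z) * sY 0 z + u 1 (pos c z) * sY 1 z + u 2 (pos c z) * sY 2 z
def zv2 (u : Fin 3 → V3 → ℝ) (c : ℝ) (z : ℂ) : ℝ :=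
  u 0 (pos c z) * sW 0 z + u 1 (pos c z) * sW 1 z + u 2 (pos c z) * sW 2 z
def zW (u : Fin 3 → V3 → ℝ) (c : ℝ) (z : ℂ) : ℝ :=
  sX 0 z * (pd 1 (u 2) (pos c z) - pd 2 (u 1) (pos c z))
   + sX 1 z * (pd 2 (u 0) (pos c z) - pd 0 (u 2) (pos c z))
   + sX 2 z * (pd 0 (u 1) (pos c z) - pd 1 (u 0) (pos c z))
def zP (u : Fin 3 → V3 → ℝ) (p : V3 → ℝ) (c : ℝ) (z : ℂ) : ℝ :=
  p (pos c z) + 1/2 * (u 0 (pos c z) * u 0 (pos c z) + u 1 (pos c z) * u 1 (pos c z)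
    + u 2 (pos c z) * u 2 (pos c z)) - 1/2 * (zf u c z * zf u c z) - c⁻¹ * zf u c z

lemma NSd.E1 (N : NSd O u p) {c : ℝ} (hc : c ≠ 0) {z : ℂ} (hz : pos c z ∈ O) :
    d1 (zP u p c) z = - d2 (zW u c) z + c * zv2 u c z * zW u c z ∧
    d2 (zP u p c) z = d1 (zW u c) z - c * zv1 u c z * zW u c z := by
  have hu : ∀ i, PD (fun z => u i (pos c z)) z _ _ := fun i => PD_pos c z (sm_diff N.ho (N.su i) hz)
  have hp := PD_pos c z (sm_diff N.ho N.sp hz)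
  have hG : ∀ i l, PD (fun z => pd l (u i) (pos c z)) z _ _ := fun i l => PD_pos c z
    (sm_diff N.ho (pd_smooth N.ho (N.su i) l) hz)
  have hX := fun l => PD_sX l z
  have pf := (((hu 0).mul (hX 0)).add ((hu 1).mul (hX 1))).add ((hu 2).mul (hX 2))
  have pf' : PD (zf u c) z _ _ := pf
  have pW : PD (zW u c) z _ _ := (((hX 0).mul ((hG 2 1).sub (hG 1 2))).add
    ((hX 1).mul ((hG 0 2).sub (hG 2 0)))).add ((hX 2).mul ((hG 1 0).sub (hG 0 1)))
  have pP : PD (zP u p c) z _ _ := ((hp.add ((((((hu 0).mul (hu 0)).add ((hu 1).mul (hu 1))).add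
    ((hu 2).mul (hu 2))).const_mul (1/2)))).sub ((pf'.mul pf').const_mul (1/2))).sub (pf'.const_mul c⁻¹)
  obtain ⟨y0, y1, y2⟩ := s_cross1 z
  obtain ⟨w0, w1, w2⟩ := s_cross2 z
  have hE1 : ∀ i, c * (sX 0 z * pd 0 (u i) (pos c z) + sX 1 z * pd 1 (u i) (pos c z)
     + sX 2 z * pd 2 (u i) (pos c z)) = - u i (pos c z) := by
    intro i
    have := N.eu _ hz i
    rw [pos_apply, pos_apply, pos_apply] at this
    linarith
  have hE2 : ∀ i m, c * (sX 0 z * pd 0 (pd m (u i)) (pos c z) + sX 1 z * pd 1 (pd m (u i)) (pos c z)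
     + sX 2 z * pd 2 (pd m (u i)) (pos c z)) = -2 * pd m (u i) (pos c z) := by
    intro i m
    have := N.eu2 hz i m
    rw [pos_apply, pos_apply, pos_apply] at this
    linarith
  have hs : ∀ i l m, pd l (pd m (u i)) (pos c z) = pd m (pd l (u i)) (pos c z) :=
    fun i l m => pd_symm N.ho (N.su i) hz l m
  have hdd := fun m => N.ddiv hz m
  have hNS := N.ns _ hz
  constructor
  · rw [pP.d1, pW.d2]
    have := alg_E1 c hc (fun l => sX l z) (fun l => sY l z) (fun l => sW l z)
      (fun l => u l (pos c z)) (fun l => pd l p (pos c z)) (fun i l => pd l (u i) (pos c z))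
      (fun i l m => pd l (pd m (u i)) (pos c z)) hs hE1 hE2 hdd hNS y0 y1 y2 w0 w1 w2
      (zf u c z) _ _ (zv2 u c z) (zW u c z) rfl rfl rfl rfl rfl
    simp only [zf] at this ⊢
    linear_combination this
  · rw [pP.d2, pW.d1]
    have := alg_E1 c hc (fun l => sX l z) (fun l => sW l z) (fun l => -sY l z)
      (fun l => u l (pos c z)) (fun l => pd l p (pos c z)) (fun i l => pd l (u i) (pos c z))
      (fun i l m => pd l (pd m (u i)) (pos c z)) hs hE1 hE2 hdd hNS
      (by linarith) (by linarith) (by linarith)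
      (by linarith) (by linarith) (by linarith)
      (zf u c z) _ _ (-zv1 u c z) (zW u c z) rfl rfl (by simp only [zv1]; ring) rfl rfl
    simp only [zf] at this ⊢
    linear_combination this

lemma NSd.E2 (N : NSd O u p) {c : ℝ} {z : ℂ} (hz : pos c z ∈ O) :
    d1 (zv2 u c) z - d2 (zv1 u c) z = c * smu z * zW u c z ∧
    d1 (zv1 u c) z + d2 (zv2 u c) z = - smu z * zf u c z := by
  have hu : ∀ i, PD (fun z => u i (pos c z)) z _ _ := fun i => PD_pos c z (sm_diff N.ho (N.su i) hz)
  obtain ⟨A0, B0, E0, hY0, hW0, hl0⟩ := PD_sYW 0 z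
  obtain ⟨A1, B1, E1, hY1, hW1, hl1⟩ := PD_sYW 1 z
  obtain ⟨A2, B2, E2, hY2, hW2, hl2⟩ := PD_sYW 2 z
  have pv1 : PD (zv1 u c) z _ _ := (((hu 0).mul hY0).add ((hu 1).mul hY1)).add ((hu 2).mul hY2)
  have pv2 : PD (zv2 u c) z _ _ := (((hu 0).mul hW0).add ((hu 1).mul hW1)).add ((hu 2).mul hW2)
  have hE1 : ∀ i, c * (sX 0 z * pd 0 (u i) (pos c z) + sX 1 z * pd 1 (u i) (pos c z)
     + sX 2 z * pd 2 (u i) (pos c z)) = - u i (pos c z) := by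
    intro i
    have := N.eu _ hz i
    rw [pos_apply, pos_apply, pos_apply] at this
    linarith
  have hdv := N.dv _ hz
  obtain ⟨k0, k1, k2⟩ := s_cross3 z
  have c00 := s_compl 0 0 z
  have c01 := s_compl 0 1 z
  have c02 := s_compl 0 2 z
  have c11 := s_compl 1 1 z
  have c12 := s_compl 1 2 z
  have c22 := s_compl 2 2 z
  simp at c00 c01 c02 c11 c12 c22
  rw [pv1.d1, pv1.d2, pv2.d1, pv2.d2]
  constructor
  · simp only [zW]
    linear_combination c * (pd 1 (u 2) (pos c z) - pd 2 (u 1) (pos c z)) * k0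
     + c * (pd 2 (u 0) (pos c z) - pd 0 (u 2) (pos c z)) * k1
     + c * (pd 0 (u 1) (pos c z) - pd 1 (u 0) (pos c z)) * k2
  · simp only [zf]
    linear_combination u 0 (pos c z) * hl0 + u 1 (pos c z) * hl1 + u 2 (pos c z) * hl2
     + c * pd 0 (u 0) (pos c z) * c00 + c * pd 1 (u 1) (pos c z) * c11 + c * pd 2 (u 2) (pos c z) * c22
     + c * (pd 0 (u 1) (pos c z) + pd 1 (u 0) (pos c z)) * c01
     + c * (pd 0 (u 2) (pos c z) + pd 2 (u 0) (pos c z)) * c02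
     + c * (pd 1 (u 2) (pos c z) + pd 2 (u 1) (pos c z)) * c12 + c * smu z * hdv
     - smu z * (sX 0 z * hE1 0 + sX 1 z * hE1 1 + sX 2 z * hE1 2)

lemma NSd.E3 (N : NSd O u p) {c : ℝ} {z : ℂ} (hz : pos c z ∈ O) (i : Fin 3) :
    d1 (d1 (fun z => u i (pos c z))) z + d2 (d2 (fun z => u i (pos c z))) z
      = c ^ 2 * smu z * (pd i p (pos c z) + (u 0 (pos c z) * pd 0 (u i) (pos c z)
       + u 1 (pos c z) * pd 1 (u i) (pos c z) + u 2 (pos c z) * pd 2 (u i) (pos c z))) := by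
  have hev : ∀ᶠ w in 𝓝 z, pos c w ∈ O :=
    (contDiff_pos c).continuous.continuousAt.eventually (N.ho.mem_nhds hz)
  have hG : ∀ l, PD (fun z => pd l (u i) (pos c z)) z _ _ := fun l => PD_pos c z
    (sm_diff N.ho (pd_smooth N.ho (N.su i) l) hz)
  obtain ⟨A0, B0, E0, hY0, hW0, hl0⟩ := PD_sYW 0 z
  obtain ⟨A1, B1, E1, hY1, hW1, hl1⟩ := PD_sYW 1 z
  obtain ⟨A2, B2, E2, hY2, hW2, hl2⟩ := PD_sYW 2 z
  have e1 : d1 (d1 (fun z => u i (pos c z))) z = d1 (fun z => c * (sY 0 z * pd 0 (u i) (pos c z)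
      + sY 1 z * pd 1 (u i) (pos c z) + sY 2 z * pd 2 (u i) (pos c z))) z := by
    have : d1 (fun z => u i (pos c z)) =ᶠ[𝓝 z] (fun z => c * (sY 0 z * pd 0 (u i) (pos c z)
      + sY 1 z * pd 1 (u i) (pos c z) + sY 2 z * pd 2 (u i) (pos c z))) := by
      filter_upwards [hev] with w hw
      exact (PD_pos c w (sm_diff N.ho (N.su i) hw)).d1
    show fderiv ℝ (d1 (fun z => u i (pos c z))) z 1 = _
    rw [this.fderiv_eq]; rfl
  have e2 : d2 (d2 (fun z => u i (pos c z))) z = d2 (fun z => c * (sW 0 z * pd 0 (u i) (pos c z)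
      + sW 1 z * pd 1 (u i) (pos c z) + sW 2 z * pd 2 (u i) (pos c z))) z := by
    have : d2 (fun z => u i (pos c z)) =ᶠ[𝓝 z] (fun z => c * (sW 0 z * pd 0 (u i) (pos c z)
      + sW 1 z * pd 1 (u i) (pos c z) + sW 2 z * pd 2 (u i) (pos c z))) := by
      filter_upwards [hev] with w hw
      exact (PD_pos c w (sm_diff N.ho (N.su i) hw)).d2
    show fderiv ℝ (d2 (fun z => u i (pos c z))) z Complex.I = _
    rw [this.fderiv_eq]; rfl
  have p1 := (((hY0.mul (hG 0)).add (hY1.mul (hG 1))).add (hY2.mul (hG 2))).const_mul c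
  have p2 := (((hW0.mul (hG 0)).add (hW1.mul (hG 1))).add (hW2.mul (hG 2))).const_mul c
  rw [e1, e2, p1.d1, p2.d2]
  have hE1 : c * (sX 0 z * pd 0 (u i) (pos c z) + sX 1 z * pd 1 (u i) (pos c z)
     + sX 2 z * pd 2 (u i) (pos c z)) = - u i (pos c z) := by
    have := N.eu _ hz i
    rw [pos_apply, pos_apply, pos_apply] at this
    linarith
  have hE2 : ∀ m, c * (sX 0 z * pd 0 (pd m (u i)) (pos c z) + sX 1 z * pd 1 (pd m (u i)) (pos c z)
     + sX 2 z * pd 2 (pd m (u i)) (pos c z)) = -2 * pd m (u i) (pos c z) := by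
    intro m
    have := N.eu2 hz i m
    rw [pos_apply, pos_apply, pos_apply] at this
    linarith
  have hs : ∀ l m, pd l (pd m (u i)) (pos c z) = pd m (pd l (u i)) (pos c z) :=
    fun l m => pd_symm N.ho (N.su i) hz l m
  have hNS := N.ns _ hz i
  have m0 := hE2 0
  have m1 := hE2 1
  have m2 := hE2 2
  have c00 := s_compl 0 0 z
  have c01 := s_compl 0 1 z
  have c02 := s_compl 0 2 z
  have c11 := s_compl 1 1 z
  have c12 := s_compl 1 2 z
  have c22 := s_compl 2 2 z
  simp at c00 c01 c02 c11 c12 c22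
  rw [hNS]
  simp only [hs 1 0, hs 2 0, hs 2 1] at *
  generalize pd 0 (pd 0 (u i)) (pos c z) = H00 at *
  generalize pd 0 (pd 1 (u i)) (pos c z) = H01 at *
  generalize pd 0 (pd 2 (u i)) (pos c z) = H02 at *
  generalize pd 1 (pd 1 (u i)) (pos c z) = H11 at *
  generalize pd 1 (pd 2 (u i)) (pos c z) = H12 at *
  generalize pd 2 (pd 2 (u i)) (pos c z) = H22 at *
  generalize pd 0 (u i) (pos c z) = G0 at *
  generalize pd 1 (u i) (pos c z) = G1 at *
  generalize pd 2 (u i) (pos c z) = G2 at *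
  linear_combination c * (G0 * hl0 + G1 * hl1 + G2 * hl2)
    + c ^ 2 * (H00 * c00 + 2 * H01 * c01 + 2 * H02 * c02 + H11 * c11 + 2 * H12 * c12 + H22 * c22)
    - c * smu z * (sX 0 z * m0 + sX 1 z * m1 + sX 2 z * m2)

/-- recover 3D gradient from plane gradient -/
lemma recover {c : ℝ} (hc : c ≠ 0) (z : ℂ) {g : V3 → ℝ} (hg : DifferentiableAt ℝ g (pos c z)) (l : Fin 3) :
    pd l g (pos c z) = (c * smu z)⁻¹ * (sY l z * d1 (fun z => g (pos c z)) z
      + sW l z * d2 (fun z => g (pos c z)) z) + sX l z * c⁻¹ * (pos c z 0 * pd 0 g (pos c z)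
      + pos c z 1 * pd 1 g (pos c z) + pos c z 2 * pd 2 g (pos c z)) := by
  have h := PD_pos c z hg
  rw [h.d1, h.d2, pos_apply, pos_apply, pos_apply]
  have hm := (smu_pos z).ne'
  have c0 := s_compl l 0 z
  have c1 := s_compl l 1 z
  have c2 := s_compl l 2 z
  field_simp
  fin_cases l <;> simp at c0 c1 c2 ⊢ <;>
  linear_combination (-pd 0 g (pos c z)) * c0 - pd 1 g (pos c z) * c1 - pd 2 g (pos c z) * c2

end

section
def pdisc (r : ℝ) : Set ℂ := {z | 0 < ‖z‖ ∧ ‖z‖ < r}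

lemma pdisc_open (r : ℝ) : IsOpen (pdisc r) :=
  (isOpen_lt continuous_const continuous_norm).inter (isOpen_lt continuous_norm continuous_const)

lemma pdisc_mono {r s : ℝ} (h : r ≤ s) : pdisc r ⊆ pdisc s := fun _ hz => ⟨hz.1, hz.2.trans_le h⟩

abbrev SM (φ : ℂ → ℝ) (r : ℝ) : Prop := ContDiffOn ℝ (⊤:ℕ∞) φ (pdisc r)

variable {φ : ℂ → ℝ} {r : ℝ} {z : ℂ}

lemma SM.diff (h : SM φ r) (hz : z ∈ pdisc r) : DifferentiableAt ℝ φ z :=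
  (h.contDiffAt ((pdisc_open r).mem_nhds hz)).differentiableAt (by simp)

lemma SM.PD (h : SM φ r) (hz : z ∈ pdisc r) : PD φ z (d1 φ z) (d2 φ z) := PD_of_diff (h.diff hz)

lemma SM.d1 (h : SM φ r) : SM (d1 φ) r := by
  have h := h.fderiv_of_isOpen (pdisc_open r) (m := (⊤:ℕ∞)) (by simp)
  exact h.clm_apply contDiffOn_const

lemma SM.d2 (h : SM φ r) : SM (d2 φ) r := by
  have h := h.fderiv_of_isOpen (pdisc_open r) (m := (⊤:ℕ∞)) (by simp)
  exact h.clm_apply contDiffOn_const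

lemma SM.symm (h : SM φ r) (hz : z ∈ pdisc r) : _root_.d1 (_root_.d2 φ) z = _root_.d2 (_root_.d1 φ) z := by
  have hat := h.contDiffAt ((pdisc_open r).mem_nhds hz)
  have hsym : IsSymmSndFDerivAt ℝ φ z := hat.isSymmSndFDerivAt (by
    simp only [minSmoothness_of_isRCLikeNormedField]; norm_cast)
  have hd : DifferentiableAt ℝ (fderiv ℝ φ) z :=
    (hat.fderiv_right (m := 1) (by norm_cast)).differentiableAt (by simp)
  have key : ∀ a b : ℂ, fderiv ℝ (fun w => fderiv ℝ φ w b) z a = fderiv ℝ (fderiv ℝ φ) z a b := by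
    intro a b
    rw [fderiv_clm_apply hd (by fun_prop)]
    simp
  have := hsym 1 Complex.I
  rw [← key, ← key] at this
  exact this

lemma SM.cont (h : SM φ r) : ContinuousOn φ (pdisc r) := h.continuousOn

/-- complex combination -/
def cx (A B : ℂ → ℝ) (z : ℂ) : ℂ := (A z : ℂ) + (B z : ℂ) * Complex.I

lemma cx_smooth {A B : ℂ → ℝ} (hA : SM A r) (hB : SM B r) : ContDiffOn ℝ 1 (cx A B) (pdisc r) := by
  have h1 : ContDiffOn ℝ 1 (fun z => (A z : ℂ)) (pdisc r) :=
    Complex.ofRealCLM.contDiff.comp_contDiffOn (hA.of_le (by norm_cast))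
  have h2 : ContDiffOn ℝ 1 (fun z => (B z : ℂ)) (pdisc r) :=
    Complex.ofRealCLM.contDiff.comp_contDiffOn (hB.of_le (by norm_cast))
  exact h1.add (h2.mul contDiffOn_const)

lemma db_cx {A B : ℂ → ℝ} {a1 a2 b1 b2 : ℝ} (hA : PD A z a1 a2) (hB : PD B z b1 b2) :
    db (cx A B) z = ((a1 - b2 : ℝ) : ℂ) + ((a2 + b1 : ℝ) : ℂ) * Complex.I := by
  have h1 : HasFDerivAt (fun z => (A z : ℂ)) (Complex.ofRealCLM ∘L (a1 • Complex.reCLM + a2 • Complex.imCLM)) z :=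
    Complex.ofRealCLM.hasFDerivAt.comp z hA
  have h2 : HasFDerivAt (fun z => (B z : ℂ)) (Complex.ofRealCLM ∘L (b1 • Complex.reCLM + b2 • Complex.imCLM)) z :=
    Complex.ofRealCLM.hasFDerivAt.comp z hB
  have h3 := (h1.add (h2.mul_const Complex.I)).fderiv
  have h4 : fderiv ℝ (cx A B) z = _ := h3
  unfold db
  rw [h4]
  simp
  linear_combination (b2:ℂ) * Complex.I_mul_I

lemma norm_cx_le (A B : ℂ → ℝ) (z : ℂ) : ‖cx A B z‖ ≤ |A z| + |B z| := by
  unfold cx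
  refine (norm_add_le _ _).trans ?_
  simp

lemma abs_le_cx1 (A B : ℂ → ℝ) (z : ℂ) : |A z| ≤ ‖cx A B z‖ := by
  have := Complex.abs_re_le_norm (cx A B z)
  simpa [cx] using this

lemma abs_le_cx2 (A B : ℂ → ℝ) (z : ℂ) : |B z| ≤ ‖cx A B z‖ := by
  have := Complex.abs_im_le_norm (cx A B z)
  simpa [cx] using this

/-- complex gradient -/
def cg (φ : ℂ → ℝ) (z : ℂ) : ℂ := cx (d1 φ) (fun z => - d2 φ z) z

def lap2 (φ : ℂ → ℝ) (z : ℂ) : ℝ := d1 (d1 φ) z + d2 (d2 φ) z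

lemma cg_smooth (h : SM φ r) : ContDiffOn ℝ 1 (cg φ) (pdisc r) := cx_smooth h.d1 h.d2.neg

lemma db_cg (h : SM φ r) (hz : z ∈ pdisc r) : db (cg φ) z = (lap2 φ z : ℂ) := by
  have := db_cx (h.d1.PD hz) (h.d2.PD hz).neg
  rw [h.symm hz] at this
  show db (cx (d1 φ) (fun z => - d2 φ z)) z = _
  rw [this]; simp [lap2]

lemma abs_d1_le (φ : ℂ → ℝ) (z : ℂ) : |d1 φ z| ≤ ‖cg φ z‖ := abs_le_cx1 _ _ _
lemma abs_d2_le (φ : ℂ → ℝ) (z : ℂ) : |d2 φ z| ≤ ‖cg φ z‖ := by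
  have := abs_le_cx2 (d1 φ) (fun z => - d2 φ z) z
  simpa [cg] using this
lemma norm_cg_le (φ : ℂ → ℝ) (z : ℂ) : ‖cg φ z‖ ≤ |d1 φ z| + |d2 φ z| := by
  have := norm_cx_le (d1 φ) (fun z => - d2 φ z) z
  simpa [cg] using this

lemma db_real (h : SM φ r) (hz : z ∈ pdisc r) :
    db (cx φ (fun _ => 0)) z = (starRingEnd ℂ) (cg φ z) := by
  rw [db_cx (h.PD hz) (PD_const 0 z)]
  simp [cg, cx]

lemma rp_mono {x α β : ℝ} (hx : 0 < x) (hx1 : x ≤ 1) (h : α ≤ β) : x ^ (-α) ≤ x ^ (-β) :=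
  Real.rpow_le_rpow_of_exponent_ge hx hx1 (by linarith)

lemma rp_anti {x y α : ℝ} (hx : 0 < x) (hxy : x ≤ y) (hα : 0 ≤ α) : y ^ (-α) ≤ x ^ (-α) :=
  Real.rpow_le_rpow_of_nonpos hx hxy (by linarith)

lemma bsub {z0 : ℂ} {ρ r1 : ℝ} (hρ : 0 < ρ) (h2 : 2 * ρ ≤ ‖z0‖) (h3 : ‖z0‖ + ρ < r1)
    (hz : z ∈ closedBall z0 ρ) : z ∈ pdisc r1 ∧ ρ ≤ ‖z‖ := by
  have h := mem_closedBall.1 hz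
  rw [dist_eq_norm] at h
  have a := norm_sub_norm_le z0 z
  have b := norm_sub_norm_le z z0
  rw [norm_sub_rev] at a
  exact ⟨⟨by linarith, by linarith⟩, by linarith⟩

/-- gradient estimate -/
lemma grad_lemma {ψ : Fin 3 → ℂ → ℝ} {r1 C α δ : ℝ} (hr1 : 0 < r1) (hα : 0 < α)
    (hδ0 : 0 ≤ δ) (hδ : δ < 1) (hC : 0 ≤ C) (hψ : ∀ i, SM (ψ i) r1)
    (hb : ∀ i, ∀ z ∈ pdisc r1, |ψ i z| ≤ C * ‖z‖ ^ (-α))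
    (hl : ∀ i, ∀ z ∈ pdisc r1, |lap2 (ψ i) z| ≤ C * ‖z‖ ^ (-δ) * (∑ j, ‖cg (ψ j) z‖) + C * ‖z‖ ^ (-(2+α))) :
    ∃ C', 0 ≤ C' ∧ ∀ z, 0 < ‖z‖ → ‖z‖ < r1 / 2 → ∑ j, ‖cg (ψ j) z‖ ≤ C' * ‖z‖ ^ (-(1+α)) := by
  refine absorb (r1 := r1) (A := 12 * C) (B := 6 * C) (α := 1 + α) (β := 1 - δ) hr1 (by linarith)
    (by linarith) (by positivity) (by positivity) ?_ (fun z => Finset.sum_nonneg (fun i _ => norm_nonneg _)) ?_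
  · exact continuousOn_finsetSum _ (fun i _ => (cg_smooth (hψ i)).continuousOn.norm)
  · intro z0 ρ S hρ h2 h3 hS
    have hz0 : z0 ∈ closedBall z0 ρ := mem_closedBall_self hρ.le
    have hS0 : 0 ≤ S := (Finset.sum_nonneg (fun i _ => norm_nonneg _)).trans (hS z0 hz0)
    have key : ∀ i, ‖cg (ψ i) z0‖ ≤ 2 * (C * ρ ^ (-α)) / ρ + 2 * 0
        + 2 * 1 * (C * ρ ^ (-δ) * S + C * ρ ^ (-(2+α))) * ρ := by
      intro i
      have hτ : ‖((Complex.conjCLE : ℂ ≃L[ℝ] ℂ) : ℂ →L[ℝ] ℂ)‖ ≤ 1 := by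
        apply ContinuousLinearMap.opNorm_le_bound _ zero_le_one
        intro x; simp
      have hK0 : 0 ≤ C * ρ ^ (-δ) * S + C * ρ ^ (-(2+α)) := by positivity
      have := interior_est (pdisc_open r1) (cx_smooth (B := fun _ => 0) (hψ i) contDiffOn_const) (cg_smooth (hψ i)) hρ
        (fun z hz => (bsub hρ h2 h3 hz).1) ((Complex.conjCLE : ℂ ≃L[ℝ] ℂ) : ℂ →L[ℝ] ℂ)
        (Φ := C * ρ ^ (-α)) (K := C * ρ ^ (-δ) * S + C * ρ ^ (-(2+α))) (E := 0) ?_ ?_ ?_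
      · simp only [ContinuousLinearEquiv.coe_coe, Complex.conjCLE_apply, RCLike.norm_conj] at this
        refine this.trans ?_
        gcongr
      · intro z hz
        obtain ⟨hz1, hz2⟩ := bsub hρ h2 h3 hz
        refine (norm_cx_le _ _ _).trans ?_
        have := hb i z hz1
        simp only [abs_zero, add_zero]
        exact this.trans (mul_le_mul_of_nonneg_left (rp_anti hρ hz2 hα.le) hC)
      · intro z hz
        obtain ⟨hz1, hz2⟩ := bsub hρ h2 h3 hz
        rw [db_cg (hψ i) hz1, Complex.norm_real, Real.norm_eq_abs]
        refine (hl i z hz1).trans ?_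
        have q1 := rp_anti hρ hz2 hδ0
        have q2 := rp_anti hρ hz2 (by linarith : 0 ≤ 2 + α)
        exact add_le_add (mul_le_mul (mul_le_mul_of_nonneg_left q1 hC) (hS z hz)
          (Finset.sum_nonneg (fun i _ => norm_nonneg _)) (by positivity))
          (mul_le_mul_of_nonneg_left q2 hC)
      · intro z hz
        obtain ⟨hz1, hz2⟩ := bsub hρ h2 h3 hz
        have := db_real (hψ i) hz1
        rw [this]; simp
    have e1 : ρ ^ (-α) / ρ = ρ ^ (-(1+α)) := by
      rw [show -(1+α) = -α - 1 by ring, Real.rpow_sub_one hρ.ne']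
    have e2 : ρ ^ (-δ) * ρ = ρ ^ (1 - δ) := by
      rw [show 1 - δ = -δ + 1 by ring, Real.rpow_add_one hρ.ne']
    have e3 : ρ ^ (-(2+α)) * ρ = ρ ^ (-(1+α)) := by
      rw [show -(1+α) = -(2+α) + 1 by ring, Real.rpow_add_one hρ.ne']
    have key' : ∀ i, ‖cg (ψ i) z0‖ ≤ 4 * C * ρ ^ (-(1+α)) + 2 * C * ρ ^ (1-δ) * S := by
      intro i
      refine (key i).trans (le_of_eq ?_)
      rw [mul_div_assoc, mul_div_assoc, e1]
      linear_combination 2 * C * S * e2 + 2 * C * e3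
    rw [Fin.sum_univ_three]
    have := key' 0
    have := key' 1
    have := key' 2
    linarith

end

section
def Bd (φ : ℂ → ℝ) (α r : ℝ) : Prop := ∃ C, 0 ≤ C ∧ ∀ z ∈ pdisc r, |φ z| ≤ C * ‖z‖ ^ (-α)

variable {φ ψ : ℂ → ℝ} {α β r s : ℝ}

lemma Bd.le (h : Bd φ α r) (hle : ∀ z ∈ pdisc r, |ψ z| ≤ |φ z|) : Bd ψ α r := by
  obtain ⟨C, hC, h⟩ := h
  exact ⟨C, hC, fun z hz => (hle z hz).trans (h z hz)⟩

lemma Bd.mul (h : Bd φ α r) (h' : Bd ψ β r) : Bd (fun z => φ z * ψ z) (α + β) r := by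
  obtain ⟨C, hC, h⟩ := h
  obtain ⟨C', hC', h'⟩ := h'
  refine ⟨C * C', by positivity, fun z hz => ?_⟩
  rw [abs_mul]
  calc _ ≤ (C * ‖z‖ ^ (-α)) * (C' * ‖z‖ ^ (-β)) :=
        mul_le_mul (h z hz) (h' z hz) (abs_nonneg _) (by positivity)
    _ = _ := by rw [neg_add, Real.rpow_add hz.1]; ring

lemma Bd.add (h : Bd φ α r) (h' : Bd ψ α r) : Bd (fun z => φ z + ψ z) α r := by
  obtain ⟨C, hC, h⟩ := h
  obtain ⟨C', hC', h'⟩ := h'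
  refine ⟨C + C', by positivity, fun z hz => ?_⟩
  have := abs_add_le (φ z) (ψ z)
  have := h z hz
  have := h' z hz
  linarith

lemma Bd.neg (h : Bd φ α r) : Bd (fun z => - φ z) α r := h.le (fun z _ => by simp)

lemma Bd.sub (h : Bd φ α r) (h' : Bd ψ α r) : Bd (fun z => φ z - ψ z) α r := by
  simpa [sub_eq_add_neg] using h.add h'.neg

lemma Bd.const_mul (k : ℝ) (h : Bd φ α r) : Bd (fun z => k * φ z) α r := by
  obtain ⟨C, hC, h⟩ := h
  refine ⟨|k| * C, by positivity, fun z hz => ?_⟩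
  rw [abs_mul, mul_assoc]
  exact mul_le_mul_of_nonneg_left (h z hz) (abs_nonneg _)

lemma Bd.const (k : ℝ) : Bd (fun _ => k) 0 r := ⟨|k|, abs_nonneg _, fun z hz => by simp⟩

lemma Bd.exp (h : Bd φ α r) (hr : r ≤ 1) (hab : α ≤ β) : Bd φ β r := by
  obtain ⟨C, hC, h⟩ := h
  exact ⟨C, hC, fun z hz => (h z hz).trans
    (mul_le_mul_of_nonneg_left (rp_mono hz.1 (hz.2.le.trans hr) hab) hC)⟩

lemma Bd.sub_r (h : Bd φ α r) (hs : s ≤ r) : Bd φ α s := by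
  obtain ⟨C, hC, h⟩ := h
  exact ⟨C, hC, fun z hz => h z (pdisc_mono hs hz)⟩

lemma Bd.abs (h : Bd φ α r) : Bd (fun z => |φ z|) α r := h.le (fun z _ => by simp)

lemma ray_lemma (hr : 0 < r) (hα : 0 < α) (hφ : SM φ r) (hg : Bd (fun z => ‖cg φ z‖) (1+α) r) :
    Bd φ α (r/2) := by
  obtain ⟨C, hC, hg⟩ := hg
  have hcpt : IsCompact (sphere (0:ℂ) (r/2)) := isCompact_sphere 0 (r/2)
  have hsub : sphere (0:ℂ) (r/2) ⊆ pdisc r := by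
    intro z hz
    have : ‖z‖ = r/2 := by simpa using hz
    exact ⟨by rw [this]; linarith, by rw [this]; linarith⟩
  obtain ⟨M, hM⟩ := hcpt.exists_bound_of_continuousOn (hφ.cont.mono hsub)
  have hM0 : 0 ≤ |M| := abs_nonneg M
  refine ⟨|M| * (r/2) ^ α + 2 * C / α, by positivity, fun z hz => ?_⟩
  have hz0 := hz.1
  have hz1 := hz.2
  set e : ℂ := z / ‖z‖ with he
  have hne : (‖z‖ : ℂ) ≠ 0 := by exact_mod_cast hz0.ne'
  have hen : ‖e‖ = 1 := by rw [he]; simp [hz0.ne']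
  have hnorm : ∀ x : ℝ, 0 < x → ‖(x:ℂ) * e‖ = x := by
    intro x hx; rw [norm_mul, hen]; simp [abs_of_pos hx]
  have key := rad_int (f := fun x => ((φ ((x:ℂ) * e) : ℝ) : ℂ))
    (f' := fun x => ((fderiv ℝ φ ((x:ℂ) * e) e : ℝ) : ℂ)) (s := ‖z‖) (s1 := r/2) (α := α) (C := 2 * C)
    hz0 hz1.le hα.ne' ?_ ?_
  · have e1 : ((‖z‖ : ℝ) : ℂ) * e = z := by rw [he]; field_simp
    simp only [e1] at key
    rw [← Complex.ofReal_sub, Complex.norm_real, Real.norm_eq_abs] at key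
    have h1 : |φ (((r/2 : ℝ) : ℂ) * e)| ≤ |M| := by
      refine le_trans ?_ (le_abs_self M)
      exact hM _ (by simp only [mem_sphere_iff_norm, sub_zero]; exact hnorm _ (by linarith))
    have h2 : (1:ℝ) ≤ (r/2) ^ α * ‖z‖ ^ (-α) := by
      rw [Real.rpow_neg hz0.le, ← div_eq_mul_inv, one_le_div (by positivity)]
      exact Real.rpow_le_rpow hz0.le hz1.le hα.le
    have h3 : |φ z| ≤ |φ (((r/2 : ℝ) : ℂ) * e)| + |φ (((r/2 : ℝ) : ℂ) * e) - φ z| := by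
      have := abs_sub_abs_le_abs_sub (φ z) (φ (((r/2 : ℝ) : ℂ) * e))
      rw [abs_sub_comm] at this; linarith
    have h4 : 2 * C / α * (‖z‖ ^ (-α) - (r/2) ^ (-α)) ≤ 2 * C / α * ‖z‖ ^ (-α) := by
      apply mul_le_mul_of_nonneg_left _ (by positivity)
      have : 0 ≤ (r/2) ^ (-α) := by positivity
      linarith
    have h5 : |M| ≤ |M| * ((r/2) ^ α * ‖z‖ ^ (-α)) := le_mul_of_one_le_right hM0 h2
    calc |φ z| ≤ |M| * ((r/2) ^ α * ‖z‖ ^ (-α)) + 2 * C / α * ‖z‖ ^ (-α) := by linarith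
      _ = _ := by ring
  · intro x hx
    have hx0 : 0 < x := hz0.trans_le hx.1
    have hmem : (x:ℂ) * e ∈ pdisc r := ⟨by rw [hnorm x hx0]; exact hx0,
      by rw [hnorm x hx0]; linarith [hx.2]⟩
    have hl : HasDerivAt (fun x : ℝ => (x:ℂ) * e) e x := by
      have := (Complex.ofRealCLM.hasDerivAt (x := x)).mul_const e
      simpa using this
    have := (hφ.diff hmem).hasFDerivAt.comp_hasDerivAt x hl
    exact this.ofReal_comp
  · intro x hx
    have hx0 : 0 < x := hz0.trans_le hx.1
    have hmem : (x:ℂ) * e ∈ pdisc r := ⟨by rw [hnorm x hx0]; exact hx0,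
      by rw [hnorm x hx0]; linarith [hx.2]⟩
    have h1 := hg _ hmem
    rw [hnorm x hx0, abs_of_nonneg (norm_nonneg _)] at h1
    rw [Complex.norm_real, Real.norm_eq_abs]
    have h2 : fderiv ℝ φ ((x:ℂ) * e) e = d1 φ ((x:ℂ) * e) * e.re + d2 φ ((x:ℂ) * e) * e.im := by
      have := HasFDerivAt.fderiv (hφ.PD hmem)
      rw [this]; simp
    rw [h2]
    have a1 := abs_d1_le φ ((x:ℂ) * e)
    have a2 := abs_d2_le φ ((x:ℂ) * e)
    have b1 := Complex.abs_re_le_norm e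
    have b2 := Complex.abs_im_le_norm e
    rw [hen] at b1 b2
    refine (abs_add_le _ _).trans ?_
    rw [abs_mul, abs_mul]
    have := mul_le_mul a1 b1 (abs_nonneg _) (norm_nonneg _)
    have := mul_le_mul a2 b2 (abs_nonneg _) (norm_nonneg _)
    linarith

structure Sys (c r : ℝ) (f v1 v2 W P : ℂ → ℝ) : Prop where
  hc : c ≠ 0
  hr : 0 < r
  hr1 : r ≤ 1
  sf : SM f r
  sv1 : SM v1 r
  sv2 : SM v2 r
  sW : SM W r
  sP : SM P r
  e1 : ∀ z ∈ pdisc r, d1 P z = - d2 W z + c * v2 z * W z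
  e1' : ∀ z ∈ pdisc r, d2 P z = d1 W z - c * v1 z * W z
  e2 : ∀ z ∈ pdisc r, d1 v2 z - d2 v1 z = c * smu z * W z
  e2' : ∀ z ∈ pdisc r, d1 v1 z + d2 v2 z = - smu z * f z

variable {c : ℝ} {f v1 v2 W P : ℂ → ℝ} {z : ℂ}

lemma Sys.lapW (S : Sys c r f v1 v2 W P) (hz : z ∈ pdisc r) :
    lap2 W z = - c * smu z * f z * W z + c * (v1 z * d1 W z + v2 z * d2 W z) := by
  have h1 : d1 W =ᶠ[𝓝 z] fun z => d2 P z + c * (v1 z * W z) := by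
    filter_upwards [(pdisc_open r).mem_nhds hz] with w hw
    rw [S.e1' w hw]; ring
  have h2 : d2 W =ᶠ[𝓝 z] fun z => c * (v2 z * W z) - d1 P z := by
    filter_upwards [(pdisc_open r).mem_nhds hz] with w hw
    rw [S.e1 w hw]; ring
  have k1 := (S.sP.d2.PD hz).add (((S.sv1.PD hz).mul (S.sW.PD hz)).const_mul c)
  have k2 := (((S.sv2.PD hz).mul (S.sW.PD hz)).const_mul c).sub (S.sP.d1.PD hz)
  have l1 : d1 (d1 W) z = d1 (d2 P) z + c * (v1 z * d1 W z + W z * d1 v1 z) := by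
    show fderiv ℝ (d1 W) z 1 = _
    rw [h1.fderiv_eq]; exact k1.d1
  have l2 : d2 (d2 W) z = c * (v2 z * d2 W z + W z * d2 v2 z) - d2 (d1 P) z := by
    show fderiv ℝ (d2 W) z Complex.I = _
    rw [h2.fderiv_eq]; exact k2.d2
  unfold lap2
  rw [l1, l2]
  have := S.sP.symm hz
  have := S.e2' z hz
  linear_combination S.sP.symm hz + c * W z * this

lemma Sys.dbh (S : Sys c r f v1 v2 W P) (hz : z ∈ pdisc r) :
    db (cx W P) z = cx (fun z => c * v1 z * W z) (fun z => c * v2 z * W z) z := by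
  rw [db_cx (S.sW.PD hz) (S.sP.PD hz), S.e1 z hz, S.e1' z hz]
  simp only [cx]
  congr 2
  · ring_nf
  · congr 1; ring

lemma Sys.dbV (S : Sys c r f v1 v2 W P) (hz : z ∈ pdisc r) :
    db (cx v1 (fun z => - v2 z)) z = cx (fun z => - smu z * f z) (fun z => - c * smu z * W z) z := by
  rw [db_cx (S.sv1.PD hz) (S.sv2.PD hz).neg]
  simp only [cx]
  congr 2
  · have := S.e2' z hz; linarith
  · congr 1; have := S.e2 z hz; linarith

end

section
variable {φ ψ : ℂ → ℝ} {α β r s c δ : ℝ} {f v1 v2 W P : ℂ → ℝ} {z : ℂ}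

def smm (z : ℂ) : ℝ := 1/4 * ((1 + z.re * z.re + z.im * z.im) * (1 + z.re * z.re + z.im * z.im))

lemma PD_smm (z : ℂ) : PD smm z (z.re * (1 + z.re * z.re + z.im * z.im))
    (z.im * (1 + z.re * z.re + z.im * z.im)) := by
  have h := (((PD_const 1 z).add ((PD_re z).mul (PD_re z))).add ((PD_im z).mul (PD_im z)))
  have h2 := (h.mul h).const_mul (1/4)
  refine PD.congr h2 ?_ ?_ <;> ring

lemma smm_mul (z : ℂ) : smm z * smu z = 1 := by
  have := qq_eq z
  unfold smm smu
  linear_combination (qq z * (1 + z.re * z.re + z.im * z.im) + 1) * this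

lemma smm_smooth : SM smm r := by
  have hr : ContDiff ℝ (⊤:ℕ∞) (fun z : ℂ => z.re) := Complex.reCLM.contDiff
  have hi : ContDiff ℝ (⊤:ℕ∞) (fun z : ℂ => z.im) := Complex.imCLM.contDiff
  have : ContDiff ℝ (⊤:ℕ∞) smm := by unfold smm; fun_prop
  exact this.contDiffOn

lemma re_im_sq (z : ℂ) : z.re * z.re + z.im * z.im = ‖z‖ ^ 2 := by
  rw [← Complex.normSq_eq_norm_sq, Complex.normSq_apply]

lemma smu_le (z : ℂ) : smu z ≤ 4 := by
  have h1 := qq_eq z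
  have h2 := qq_pos z
  have h3 := re_im_sq z
  unfold smu
  have : qq z ≤ 1 := by 
    nlinarith [mul_nonneg h2.le (mul_self_nonneg z.re), mul_nonneg h2.le (mul_self_nonneg z.im)]
  nlinarith

lemma smu_sub (z : ℂ) : |smu z - 4| ≤ 8 * ‖z‖ ^ 2 := by
  have h1 := qq_eq z
  have h2 := qq_pos z
  have h3 := re_im_sq z
  have h4 : qq z * (1 + ‖z‖ ^ 2) = 1 := by rw [← h3]; linear_combination h1
  have h5 : qq z ≤ 1 := by nlinarith [sq_nonneg ‖z‖, mul_nonneg h2.le (sq_nonneg ‖z‖)]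
  have h6 : 1 - qq z ≤ ‖z‖ ^ 2 := by nlinarith [sq_nonneg ‖z‖]
  rw [abs_le]; unfold smu
  constructor <;> nlinarith [sq_nonneg ‖z‖]

lemma Bd_smu : Bd smu 0 r := ⟨4, by norm_num, fun z _ => by
  rw [abs_of_pos (smu_pos z)]; simpa using smu_le z⟩

lemma Bd_re : Bd (fun z => z.re) (-1) r := ⟨1, by norm_num, fun z _ => by
  simpa using Complex.abs_re_le_norm z⟩
lemma Bd_im : Bd (fun z => z.im) (-1) r := ⟨1, by norm_num, fun z _ => by
  simpa using Complex.abs_im_le_norm z⟩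

lemma Sys.S1 (S : Sys c r f v1 v2 W P) (hδ : 0 < δ) (hδ1 : δ < 1) (bf : Bd f δ r) (bv1 : Bd v1 δ r)
    (bv2 : Bd v2 δ r) : Bd W (1 + δ) (r/2) := by
  have hr1 := S.hr1
  -- bounds
  have bm : Bd (fun z : ℂ => (1 + z.re * z.re + z.im * z.im)) 0 r :=
    ((Bd.const 1).add ((Bd_re.mul Bd_re).exp hr1 (by norm_num))).add ((Bd_im.mul Bd_im).exp hr1 (by norm_num))
  have bm' : Bd smm 0 r := by
    have := ((bm.mul bm).const_mul (1/4)).exp hr1 (β := 0) (by norm_num)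
    exact this
  have bm1 : Bd (fun z : ℂ => z.re * (1 + z.re * z.re + z.im * z.im)) 0 r := (Bd_re.mul bm).exp hr1 (by norm_num)
  have bm2 : Bd (fun z : ℂ => z.im * (1 + z.re * z.re + z.im * z.im)) 0 r := (Bd_im.mul bm).exp hr1 (by norm_num)
  obtain ⟨C1, hC1, k1⟩ := (bv1.mul bm').abs.add (bv2.mul bm').abs
  obtain ⟨C2, hC2, k2⟩ := ((bf.exp hr1 (by linarith : δ ≤ δ + 0)).abs.add
    ((bv1.mul bm1).add (bv2.mul bm2)).abs).add ((bv1.mul bm2).sub (bv2.mul bm1)).abs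
  obtain ⟨C3, hC3, k3⟩ := bv1.abs.add bv2.abs
  simp only [add_zero] at k1 k2
  have hcp : 0 < |c| := abs_pos.2 S.hc
  have main := absorb (F := fun z => |W z|) (r1 := r) (A := |c|⁻¹ * (2 * C1 + 2 * C2))
    (B := |c|⁻¹ * (2 * |c| * (|c| * C3))) (α := 1 + δ) (β := 1 - δ) S.hr (by linarith) (by linarith)
    (by positivity) (by positivity) S.sW.cont.abs (fun z => abs_nonneg _) ?_
  · obtain ⟨C, hC, h⟩ := main
    exact ⟨C, hC, fun z hz => h z hz.1 hz.2⟩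
  intro z0 ρ T hρ h2 h3 hT
  have hz0 : z0 ∈ closedBall z0 ρ := mem_closedBall_self hρ.le
  have hT0 : 0 ≤ T := (abs_nonneg _).trans (hT z0 hz0)
  have hρ1 : ρ ≤ 1 := by linarith
  set τ : ℂ →L[ℝ] ℂ := Complex.reCLM.smulRight (-(c:ℂ) * Complex.I) with hτ
  have hτa : ∀ w, τ w = (w.re : ℂ) * (-(c:ℂ) * Complex.I) := by
    intro w; simp [hτ]
  have hτn : ‖τ‖ ≤ |c| := by
    apply ContinuousLinearMap.opNorm_le_bound _ hcp.le
    intro w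
    rw [hτa]
    simp only [norm_mul, Complex.norm_real, norm_neg, Complex.norm_I, mul_one, Real.norm_eq_abs]
    rw [mul_comm]
    exact mul_le_mul_of_nonneg_left (Complex.abs_re_le_norm w) hcp.le
  have sφ1 : SM (fun z => v1 z * smm z) r := S.sv1.mul smm_smooth
  have sφ2 : SM (fun z => - v2 z * smm z) r := S.sv2.neg.mul smm_smooth
  have est := interior_est (pdisc_open r) (cx_smooth sφ1 sφ2) (cx_smooth S.sW S.sP) hρ
    (fun z hz => (bsub hρ h2 h3 hz).1) τ
    (Φ := C1 * ρ ^ (-δ)) (K := |c| * C3 * ρ ^ (-δ) * T) (E := C2 * ρ ^ (-δ)) ?_ ?_ ?_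
  · have e0 : ‖τ (cx W P z0)‖ = |c| * |W z0| := by
      rw [hτa]; simp [cx]; ring
    rw [e0] at est
    have e1 : ρ ^ (-δ) / ρ = ρ ^ (-(1+δ)) := by
      rw [show -(1+δ) = -δ - 1 by ring, Real.rpow_sub_one hρ.ne']
    have e2 : ρ ^ (-δ) * ρ = ρ ^ (1 - δ) := by
      rw [show 1 - δ = -δ + 1 by ring, Real.rpow_add_one hρ.ne']
    have e3 : ρ ^ (-δ) ≤ ρ ^ (-(1+δ)) := rp_mono hρ hρ1 (by linarith)
    have hfin : |c| * |W z0| ≤ (2 * C1 + 2 * C2) * ρ ^ (-(1+δ)) + 2 * |c| * (|c| * C3) * ρ ^ (1-δ) * T := by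
      have a1 : 2 * (C1 * ρ ^ (-δ)) / ρ = 2 * C1 * ρ ^ (-(1+δ)) := by rw [← e1]; ring
      have a2 : 2 * (C2 * ρ ^ (-δ)) ≤ 2 * C2 * ρ ^ (-(1+δ)) := by nlinarith
      have a3 : 2 * ‖τ‖ * (|c| * C3 * ρ ^ (-δ) * T) * ρ ≤ 2 * |c| * (|c| * C3 * ρ ^ (-δ) * T) * ρ := by
        gcongr
      have a4 : 2 * |c| * (|c| * C3 * ρ ^ (-δ) * T) * ρ = 2 * |c| * (|c| * C3) * ρ ^ (1-δ) * T := by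
        rw [← e2]; ring
      linarith
    calc |W z0| = |c|⁻¹ * (|c| * |W z0|) := by field_simp
      _ ≤ |c|⁻¹ * ((2 * C1 + 2 * C2) * ρ ^ (-(1+δ)) + 2 * |c| * (|c| * C3) * ρ ^ (1-δ) * T) :=
        mul_le_mul_of_nonneg_left hfin (by positivity)
      _ = _ := by ring
  · intro z hz
    obtain ⟨hz1, hz2⟩ := bsub hρ h2 h3 hz
    refine (norm_cx_le _ _ _).trans ?_
    have := k1 z hz1
    rw [neg_mul, abs_neg]
    exact ((le_abs_self _).trans this).trans (mul_le_mul_of_nonneg_left (rp_anti hρ hz2 hδ.le) hC1)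
  · intro z hz
    obtain ⟨hz1, hz2⟩ := bsub hρ h2 h3 hz
    rw [S.dbh hz1]
    refine (norm_cx_le _ _ _).trans ?_
    have h := ((le_abs_self _).trans (k3 z hz1)).trans (mul_le_mul_of_nonneg_left (rp_anti hρ hz2 hδ.le) hC3)
    rw [abs_mul, abs_mul, abs_mul, abs_mul]
    calc _ = |c| * ((|v1 z| + |v2 z|) * |W z|) := by ring
      _ ≤ |c| * ((C3 * ρ ^ (-δ)) * T) := by
        apply mul_le_mul_of_nonneg_left _ hcp.le
        exact mul_le_mul h (hT z hz) (abs_nonneg _) (by positivity)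
      _ = _ := by ring
  · intro z hz
    obtain ⟨hz1, hz2⟩ := bsub hρ h2 h3 hz
    rw [db_cx ((S.sv1.PD hz1).mul (PD_smm z)) ((S.sv2.PD hz1).neg.mul (PD_smm z)), hτa]
    have h := ((le_abs_self _).trans (k2 z hz1)).trans (mul_le_mul_of_nonneg_left (rp_anti hρ hz2 hδ.le) hC2)
    refine le_trans ?_ h
    have e2 := S.e2 z hz1
    have e2' := S.e2' z hz1
    have em := smm_mul z
    set M1 := z.re * (1 + z.re * z.re + z.im * z.im)
    set M2 := z.im * (1 + z.re * z.re + z.im * z.im)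
    have q1 : v1 z * M1 + smm z * d1 v1 z - (-v2 z * M2 + smm z * -d2 v2 z)
       = - f z + (v1 z * M1 + v2 z * M2) := by
      linear_combination smm z * e2' - f z * em
    have q2 : v1 z * M2 + smm z * d2 v1 z + (-v2 z * M1 + smm z * -d1 v2 z)
       = - c * W z + (v1 z * M2 - v2 z * M1) := by
      linear_combination (-smm z) * e2 - c * W z * em
    rw [q1, q2]
    have : (((- f z + (v1 z * M1 + v2 z * M2) : ℝ) : ℂ) + ((- c * W z + (v1 z * M2 - v2 z * M1) : ℝ) : ℂ) * Complex.I)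
        - ((cx W P z).re : ℂ) * (-(c:ℂ) * Complex.I)
      = ((- f z + (v1 z * M1 + v2 z * M2) : ℝ) : ℂ) + ((v1 z * M2 - v2 z * M1 : ℝ) : ℂ) * Complex.I := by
      simp [cx]; ring
    rw [this]
    refine (norm_add_le _ _).trans ?_
    rw [norm_mul, Complex.norm_I, mul_one, Complex.norm_real, Complex.norm_real, Real.norm_eq_abs, Real.norm_eq_abs]
    have := abs_add_le (-f z) (v1 z * M1 + v2 z * M2)
    rw [abs_neg] at this
    linarith

lemma Sys.S2 (S : Sys c r f v1 v2 W P) (hs : 0 < s) (hsr : s ≤ r) (hα : 0 < α) (hδ : 0 < δ)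
    (hδ1 : δ < 1) (bf : Bd f δ r) (bv1 : Bd v1 δ r)
    (bv2 : Bd v2 δ r) (bW : Bd W α s) :
    Bd (fun z => ‖cg W z‖) (1+α) (s/2) ∧ Bd (fun z => ‖cg P z‖) (1+α) (s/2) ∧ Bd P α (s/4) := by
  have hs1 : s ≤ 1 := hsr.trans S.hr1
  have bfs := bf.sub_r hsr
  have b1s := bv1.sub_r hsr
  have b2s := bv2.sub_r hsr
  have sub := pdisc_mono hsr
  have hWg : Bd (fun z => ‖cg W z‖) (1+α) (s/2) := by
    obtain ⟨C1, hC1, k1⟩ := bW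
    obtain ⟨C2, hC2, k2⟩ := ((b1s.abs.add b2s.abs).const_mul |c|)
    obtain ⟨C3, hC3, k3⟩ := (((Bd_smu.mul bfs).mul ⟨C1, hC1, k1⟩).const_mul c).exp hs1
      (by linarith : 0 + δ + α ≤ 2 + α)
    have := grad_lemma (ψ := fun _ => W) (r1 := s) (C := C1 + C2 + C3) (α := α) (δ := δ) hs hα hδ.le hδ1
      (by positivity) (fun _ => S.sW.mono sub) ?_ ?_
    · obtain ⟨C, hC, h⟩ := this
      refine ⟨C, hC, fun z hz => ?_⟩
      have := h z hz.1 hz.2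
      rw [Fin.sum_univ_three] at this
      rw [abs_of_nonneg (norm_nonneg _)]
      have := norm_nonneg (cg W z)
      linarith
    · intro _ z hz
      refine (k1 z hz).trans (mul_le_mul_of_nonneg_right (by linarith) (by positivity))
    · intro _ z hz
      rw [S.lapW (sub hz), Fin.sum_univ_three]
      have h3 := k3 z hz
      have h2 := (le_abs_self _).trans (k2 z hz)
      have a1 := abs_d1_le W z
      have a2 := abs_d2_le W z
      have n0 := norm_nonneg (cg W z)
      have hz0 := hz.1
      have t1 : |c * (v1 z * d1 W z + v2 z * d2 W z)| ≤ |c| * (|v1 z| + |v2 z|) * ‖cg W z‖ := by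
        rw [abs_mul, mul_assoc]
        apply mul_le_mul_of_nonneg_left _ (abs_nonneg _)
        refine (abs_add_le _ _).trans ?_
        rw [abs_mul, abs_mul, add_mul]
        exact add_le_add (mul_le_mul_of_nonneg_left a1 (abs_nonneg _))
          (mul_le_mul_of_nonneg_left a2 (abs_nonneg _))
      have t2 : |-c * smu z * f z * W z| = |c * (smu z * f z * W z)| := by
        rw [← abs_neg]; congr 1; ring
      have t3 : |c| * (|v1 z| + |v2 z|) * ‖cg W z‖ ≤ C2 * ‖z‖ ^ (-δ) * ‖cg W z‖ :=
        mul_le_mul_of_nonneg_right h2 n0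
      have t4 : C2 * ‖z‖ ^ (-δ) * ‖cg W z‖ ≤ (C1 + C2 + C3) * ‖z‖ ^ (-δ) * (‖cg W z‖ + ‖cg W z‖ + ‖cg W z‖) := by
        apply mul_le_mul _ (by linarith) n0 (by positivity)
        exact mul_le_mul_of_nonneg_right (by linarith) (by positivity)
      have t5 : C3 * ‖z‖ ^ (-(2+α)) ≤ (C1 + C2 + C3) * ‖z‖ ^ (-(2+α)) :=
        mul_le_mul_of_nonneg_right (by linarith) (by positivity)
      refine (abs_add_le _ _).trans ?_
      rw [t2]
      linarith
  have hs2 : s/2 ≤ 1 := by linarith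
  have hs2' : s/2 ≤ s := by linarith
  have hPg : Bd (fun z => ‖cg P z‖) (1+α) (s/2) := by
    have q := (((((b1s.mul bW).const_mul c).abs.add ((b2s.mul bW).const_mul c).abs).sub_r hs2').exp hs2
      (by linarith : δ + α ≤ 1 + α)).add (hWg.const_mul 2)
    refine q.le (fun z hz => ?_)
    have hz' := sub (pdisc_mono hs2' hz)
    refine le_trans ?_ (le_abs_self _)
    rw [abs_of_nonneg (norm_nonneg _)]
    refine (norm_cg_le P z).trans ?_
    rw [S.e1 z hz', S.e1' z hz']
    have a1 := abs_d1_le W z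
    have a2 := abs_d2_le W z
    have i1 := abs_add_le (-d2 W z) (c * v2 z * W z)
    have i2 := abs_sub (d1 W z) (c * v1 z * W z)
    rw [abs_neg] at i1
    simp only [mul_assoc] at i1 i2 ⊢
    linarith
  refine ⟨hWg, hPg, ?_⟩
  have := ray_lemma (by linarith : 0 < s/2) hα (S.sP.mono (pdisc_mono (hs2'.trans hsr))) hPg
  rw [show s/4 = s/2/2 by ring]; exact this

lemma Sys.S345 (S : Sys c r f v1 v2 W P) (hδ : 0 < δ) (hδ1 : δ < 1/8) (bf : Bd f δ r)
    (bv1 : Bd v1 δ r) (bv2 : Bd v2 δ r)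
    (ho1 : ∀ ε > (0:ℝ), ∃ ρ > (0:ℝ), ∀ z : ℂ, 0 < ‖z‖ → ‖z‖ < ρ → |v1 z| ≤ ε * |Real.log ‖z‖|)
    (ho2 : ∀ ε > (0:ℝ), ∃ ρ > (0:ℝ), ∀ z : ℂ, 0 < ‖z‖ → ‖z‖ < ρ → |v2 z| ≤ ε * |Real.log ‖z‖|) :
    Bd W (4*δ) (r/32) ∧ Bd P (4*δ) (r/32) := by
  have hr := S.hr
  have hr1 := S.hr1
  have bW := S.S1 hδ (by linarith) bf bv1 bv2
  obtain ⟨-, -, bP⟩ := S.S2 (s := r/2) (by linarith) (by linarith) (by linarith : 0 < 1 + δ) hδ (by linarith) bf bv1 bv2 bW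
  have hr8 : r/8 ≤ 1 := by linarith
  have bW8 := bW.sub_r (by linarith : r/8 ≤ r/2)
  have bP8 := bP.sub_r (by linarith : r/8 ≤ r/2/4)
  have b18 := bv1.sub_r (by linarith : r/8 ≤ r)
  have b28 := bv2.sub_r (by linarith : r/8 ≤ r)
  have sub : pdisc (r/8) ⊆ pdisc r := pdisc_mono (by linarith)
  have sub' : pdisc (r/32) ⊆ pdisc r := pdisc_mono (by linarith)
  obtain ⟨C1, hC1, k1⟩ := (bW8.abs.add bP8.abs).exp hr8 (by linarith : 1 + δ ≤ 1 + 2 * δ)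
  obtain ⟨C2, hC2, k2⟩ := (((b18.mul bW8).const_mul c).abs.add ((b28.mul bW8).const_mul c).abs).exp hr8
      (by linarith : δ + (1 + δ) ≤ 1 + 2 * δ)
  obtain ⟨L, C', hC', hL⟩ := pole_lemma (h := cx W P) (r1 := r/8) (C := C1 + C2) (η := 2 * δ) (by linarith)
    (by positivity) ((cx_smooth S.sW S.sP).mono sub) (by linarith) (by linarith) (by
      intro z h0 h1
      refine (norm_cx_le _ _ _).trans ?_
      refine ((le_abs_self _).trans (k1 z ⟨h0, h1⟩)).trans ?_
      exact mul_le_mul_of_nonneg_right (by linarith) (by positivity)) (by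
      intro z h0 h1
      rw [S.dbh (sub ⟨h0, h1⟩)]
      refine (norm_cx_le _ _ _).trans ?_
      have := (le_abs_self _).trans (k2 z ⟨h0, h1⟩)
      simp only [mul_assoc] at this ⊢
      refine this.trans ?_
      exact mul_le_mul_of_nonneg_right (by linarith) (by positivity))
  rw [show r/8/4 = r/32 by ring, show 2 * (2 * δ) = 4 * δ by ring] at hL
  have hr32 : r/32 ≤ 1 := by linarith
  have bE : Bd (fun z => smu z - 4) (-2) (r/32) := ⟨8, by norm_num, fun z _ => by
    have := smu_sub z
    simp only [neg_neg]
    exact_mod_cast this⟩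
  obtain ⟨C3, hC3, k3⟩ := (Bd_smu.mul (bf.sub_r (by linarith : r/32 ≤ r))).exp hr32 (by linarith : 0 + δ ≤ 4 * δ)
  obtain ⟨C4, hC4, k4⟩ := ((bE.mul (bW.sub_r (by linarith : r/32 ≤ r/2))).const_mul c).exp hr32
    (by linarith : -2 + (1 + δ) ≤ 4 * δ)
  have hL0 : (-(2 * (c:ℂ) * Complex.I) * (starRingEnd ℂ) L) = 0 := by
    refine log_lemma (φ := cx v1 (fun z => - v2 z)) (r1 := r/32) (C := C3 + C4 + 4 * |c| * C') (γ := 4 * δ)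
      (β := -(2 * (c:ℂ) * Complex.I) * L) (by linarith)
      (by linarith) ((cx_smooth S.sv1 S.sv2.neg).mono sub') ?_ ?_
    · intro z h0 h1
      have hz : z ∈ pdisc (r/32) := ⟨h0, h1⟩
      rw [S.dbV (sub' hz)]
      have hW : ((W z : ℝ) : ℂ) = (cx W P z + (starRingEnd ℂ) (cx W P z)) / 2 := by
        simp [cx]; ring
      have e := hL z h0 h1
      have e' : ‖(starRingEnd ℂ) (cx W P z) - (starRingEnd ℂ) L / (starRingEnd ℂ) z‖ ≤ C' * ‖z‖ ^ (-(4 * δ)) := by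
        rw [← map_div₀, ← map_sub, RCLike.norm_conj]; exact e
      have id : cx (fun z => - smu z * f z) (fun z => - c * smu z * W z) z
          - (-(2 * (c:ℂ) * Complex.I) * (starRingEnd ℂ) L / (starRingEnd ℂ) z + -(2 * (c:ℂ) * Complex.I) * L / z)
        = ((-(smu z * f z) : ℝ) : ℂ) + ((-(c * ((smu z - 4) * W z)) : ℝ) : ℂ) * Complex.I
          + -(2 * (c:ℂ) * Complex.I) * ((cx W P z - L / z) +
           ((starRingEnd ℂ) (cx W P z) - (starRingEnd ℂ) L / (starRingEnd ℂ) z)) := by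
        have : cx (fun z => - smu z * f z) (fun z => - c * smu z * W z) z =
          ((-(smu z * f z) : ℝ) : ℂ) + ((-(c * ((smu z - 4) * W z)) : ℝ) : ℂ) * Complex.I
           - 4 * (c:ℂ) * ((W z : ℝ):ℂ) * Complex.I := by
          simp [cx]; ring
        rw [this, hW]; ring
      rw [id]
      have n1 : ‖((-(smu z * f z) : ℝ) : ℂ)‖ ≤ C3 * ‖z‖ ^ (-(4*δ)) := by
        rw [Complex.norm_real, norm_neg]; exact k3 z hz
      have n2 : ‖((-(c * ((smu z - 4) * W z)) : ℝ) : ℂ) * Complex.I‖ ≤ C4 * ‖z‖ ^ (-(4*δ)) := by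
        rw [norm_mul, Complex.norm_I, mul_one, Complex.norm_real, norm_neg]; exact k4 z hz
      have n3 : ‖-(2 * (c:ℂ) * Complex.I) * ((cx W P z - L / z) +
           ((starRingEnd ℂ) (cx W P z) - (starRingEnd ℂ) L / (starRingEnd ℂ) z))‖
           ≤ 2 * |c| * (C' * ‖z‖ ^ (-(4*δ)) + C' * ‖z‖ ^ (-(4*δ))) := by
        rw [norm_mul]
        have : ‖-(2 * (c:ℂ) * Complex.I)‖ = 2 * |c| := by simp
        rw [this]
        exact mul_le_mul_of_nonneg_left ((norm_add_le _ _).trans (add_le_add e e')) (by positivity)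
      refine (norm_add_le _ _).trans ?_
      have := norm_add_le ((-(smu z * f z) : ℝ) : ℂ) (((-(c * ((smu z - 4) * W z)) : ℝ) : ℂ) * Complex.I)
      linarith
    · intro ε hε
      obtain ⟨ρ1, hρ1, g1⟩ := ho1 (ε/2) (by linarith)
      obtain ⟨ρ2, hρ2, g2⟩ := ho2 (ε/2) (by linarith)
      refine ⟨min ρ1 ρ2, lt_min hρ1 hρ2, fun z h0 h1 => ?_⟩
      refine (norm_cx_le _ _ _).trans ?_
      have a := g1 z h0 (h1.trans_le (min_le_left _ _))
      have b := g2 z h0 (h1.trans_le (min_le_right _ _))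
      rw [abs_neg]; linarith
  have hL1 : L = 0 := by
    have hc : (c:ℂ) ≠ 0 := by exact_mod_cast S.hc
    simpa [hc] using hL0
  rw [hL1] at hL
  simp only [zero_div, sub_zero] at hL
  exact ⟨⟨C', hC', fun z hz => (abs_le_cx1 W P z).trans (hL z hz.1 hz.2)⟩,
    ⟨C', hC', fun z hz => (abs_le_cx2 W P z).trans (hL z hz.1 hz.2)⟩⟩

end

section
lemma S6 {U : Fin 3 → ℂ → ℝ} {r C δ : ℝ} (hr : 0 < r) (hr1 : r ≤ 1) (hδ : 0 < δ) (hδ1 : δ < 1/16)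
    (hC : 0 ≤ C) (sU : ∀ i, SM (U i) r) (bU : ∀ i, Bd (U i) δ r)
    (hl : ∀ i, ∀ z ∈ pdisc r, |lap2 (U i) z| ≤ C * (‖z‖ ^ (-δ) * (∑ j, ‖cg (U j) z‖) + ‖z‖ ^ (-(1+4*δ))))
    (ho : ∀ i, ∀ ε > (0:ℝ), ∃ ρ > (0:ℝ), ∀ z : ℂ, 0 < ‖z‖ → ‖z‖ < ρ → |U i z| ≤ ε * |Real.log ‖z‖|)
    (i : Fin 3) : Bd (fun z => ‖cg (U i) z‖) (8*δ) (r/8) := by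
  obtain ⟨A0, hA0, k0⟩ := bU 0
  obtain ⟨A1, hA1, k1⟩ := bU 1
  obtain ⟨A2, hA2, k2⟩ := bU 2
  obtain ⟨C', hC', hF⟩ := grad_lemma (ψ := U) (r1 := r) (C := A0 + A1 + A2 + C) (α := δ) (δ := δ) hr hδ hδ.le
    (by linarith) (by positivity) sU (by
      intro i z hz
      have p0 : 0 ≤ ‖z‖ ^ (-δ) := by positivity
      fin_cases i
      · exact (k0 z hz).trans (mul_le_mul_of_nonneg_right (by linarith) p0)
      · exact (k1 z hz).trans (mul_le_mul_of_nonneg_right (by linarith) p0)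
      · exact (k2 z hz).trans (mul_le_mul_of_nonneg_right (by linarith) p0)) (by
      intro i z hz
      refine (hl i z hz).trans ?_
      have q := rp_mono hz.1 (hz.2.le.trans hr1) (by linarith : 1 + 4 * δ ≤ 2 + δ)
      have hF0 : 0 ≤ ∑ j, ‖cg (U j) z‖ := Finset.sum_nonneg (fun i _ => norm_nonneg _)
      rw [mul_add, ← mul_assoc]
      have hCC : C ≤ A0 + A1 + A2 + C := by linarith
      apply add_le_add
      · exact mul_le_mul_of_nonneg_right (mul_le_mul_of_nonneg_right hCC (by positivity)) hF0
      · exact mul_le_mul hCC q (by positivity) (by positivity))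
  have sub : pdisc (r/2) ⊆ pdisc r := pdisc_mono (by linarith)
  have sub8 : pdisc (r/8) ⊆ pdisc r := pdisc_mono (by linarith)
  obtain ⟨L, C2, hC2, hL⟩ := pole_lemma (h := cg (U i)) (r1 := r/2) (C := C' + C * (C' + 1)) (η := 4 * δ)
    (by linarith) (by positivity) ((cg_smooth (sU i)).mono sub) (by linarith) (by linarith) (by
      intro z h0 h1
      have hz1 : ‖z‖ ≤ 1 := by linarith
      have h := hF z h0 h1
      have h' : ‖cg (U i) z‖ ≤ ∑ j, ‖cg (U j) z‖ :=
        Finset.single_le_sum (f := fun j => ‖cg (U j) z‖) (fun i _ => norm_nonneg _) (Finset.mem_univ i)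
      refine (h'.trans h).trans ?_
      refine (mul_le_mul_of_nonneg_left (rp_mono h0 hz1 (by linarith : 1 + δ ≤ 1 + 4 * δ)) hC').trans ?_
      exact mul_le_mul_of_nonneg_right (le_add_of_nonneg_right (by positivity)) (by positivity)) (by
      intro z h0 h1
      have hz1 : ‖z‖ ≤ 1 := by linarith
      have hz : z ∈ pdisc r := sub ⟨h0, h1⟩
      rw [db_cg (sU i) hz, Complex.norm_real, Real.norm_eq_abs]
      refine (hl i z hz).trans ?_
      have h := hF z h0 h1
      have e1 : ‖z‖ ^ (-δ) * (∑ j, ‖cg (U j) z‖) ≤ C' * ‖z‖ ^ (-(1 + 4 * δ)) := by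
        calc _ ≤ ‖z‖ ^ (-δ) * (C' * ‖z‖ ^ (-(1+δ))) := mul_le_mul_of_nonneg_left h (by positivity)
          _ = C' * ‖z‖ ^ (-(1 + 2 * δ)) := by
            rw [show -(1 + 2 * δ) = -δ + -(1+δ) by ring, Real.rpow_add h0]; ring
          _ ≤ _ := mul_le_mul_of_nonneg_left (rp_mono h0 hz1 (by linarith)) hC'
      have e2 : C * (‖z‖ ^ (-δ) * (∑ j, ‖cg (U j) z‖) + ‖z‖ ^ (-(1+4*δ))) ≤
         C * (C' * ‖z‖ ^ (-(1 + 4 * δ)) + ‖z‖ ^ (-(1+4*δ))) := mul_le_mul_of_nonneg_left (by linarith) hC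
      have e3 : 0 ≤ C' * ‖z‖ ^ (-(1 + 4 * δ)) := by positivity
      calc _ ≤ _ := e2
        _ ≤ _ := by nlinarith)
  rw [show r/2/4 = r/8 by ring, show 2 * (4 * δ) = 8 * δ by ring] at hL
  have hL0 : (starRingEnd ℂ) L = 0 := by
    refine log_lemma (φ := cx (U i) (fun _ => 0)) (r1 := r/8) (C := C2) (γ := 8 * δ) (β := 0) (by linarith)
      (by linarith) ((cx_smooth (B := fun _ => 0) (sU i) contDiffOn_const).mono sub8) ?_ ?_
    · intro z h0 h1
      rw [db_real (sU i) (sub8 ⟨h0, h1⟩)]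
      have := hL z h0 h1
      rw [← RCLike.norm_conj, map_sub, map_div₀] at this
      simpa using this
    · intro ε hε
      obtain ⟨ρ, hρ, h⟩ := ho i ε hε
      refine ⟨ρ, hρ, fun z h0 h1 => ?_⟩
      refine (norm_cx_le _ _ _).trans ?_
      simpa using h z h0 h1
  have hL1 : L = 0 := by simpa using hL0
  rw [hL1] at hL
  simp only [zero_div, sub_zero] at hL
  exact ⟨C2, hC2, fun z hz => by rw [abs_of_nonneg (norm_nonneg _)]; exact hL z hz.1 hz.2⟩

def BW (φ w : ℂ → ℝ) (r : ℝ) : Prop := ∃ C, 0 ≤ C ∧ ∀ z ∈ pdisc r, |φ z| ≤ C * w z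

section BW
variable {φ ψ w : ℂ → ℝ} {r : ℝ}
lemma BW.add (h : BW φ w r) (h' : BW ψ w r) : BW (fun z => φ z + ψ z) w r := by
  obtain ⟨C, hC, h⟩ := h
  obtain ⟨C', hC', h'⟩ := h'
  refine ⟨C + C', by positivity, fun z hz => ?_⟩
  have := abs_add_le (φ z) (ψ z)
  have := h z hz
  have := h' z hz
  linarith

lemma BW.mulB (h : BW φ w r) (h' : Bd ψ 0 r) : BW (fun z => ψ z * φ z) w r := by
  obtain ⟨C, hC, h⟩ := h
  obtain ⟨C', hC', h'⟩ := h'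
  refine ⟨C' * C, by positivity, fun z hz => ?_⟩
  rw [abs_mul, mul_assoc]
  have := h' z hz
  simp only [neg_zero, Real.rpow_zero, mul_one] at this
  exact mul_le_mul this (h z hz) (abs_nonneg _) hC'

lemma BW.congr (h : BW φ w r) (he : ∀ z ∈ pdisc r, ψ z = φ z) : BW ψ w r := by
  obtain ⟨C, hC, h⟩ := h
  exact ⟨C, hC, fun z hz => by rw [he z hz]; exact h z hz⟩

lemma BW.sub_r {s : ℝ} (h : BW φ w r) (hs : s ≤ r) : BW φ w s := by
  obtain ⟨C, hC, h⟩ := h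
  exact ⟨C, hC, fun z hz => h z (pdisc_mono hs hz)⟩
end BW

lemma Bd_sX (l : Fin 3) (r : ℝ) : Bd (sX l) 0 r := by
  refine ⟨1, by norm_num, fun z _ => ?_⟩
  have := s_unit z
  simp only [neg_zero, Real.rpow_zero, mul_one]
  rw [abs_le_one_iff_mul_self_le_one]
  fin_cases l <;> simp <;> nlinarith [sq_nonneg (sX 0 z), sq_nonneg (sX 1 z), sq_nonneg (sX 2 z)]

lemma s_sq_le (l : Fin 3) (z : ℂ) : sY l z ^ 2 ≤ 4 ∧ sW l z ^ 2 ≤ 4 := by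
  have h := s_compl l l z
  simp at h
  have := smu_le z
  have := smu_pos z
  have h2 : smu z * (1 - sX l z * sX l z) ≤ 4 := by
    nlinarith [mul_nonneg (smu_pos z).le (mul_self_nonneg (sX l z))]
  constructor <;> nlinarith [mul_self_nonneg (sY l z), mul_self_nonneg (sW l z)]

lemma Bd_sY (l : Fin 3) (r : ℝ) : Bd (sY l) 0 r := by
  refine ⟨2, by norm_num, fun z _ => ?_⟩
  simp only [neg_zero, Real.rpow_zero, mul_one]
  exact abs_le_of_sq_le_sq (by linarith [(s_sq_le l z).1]) (by norm_num)

lemma Bd_sW (l : Fin 3) (r : ℝ) : Bd (sW l) 0 r := by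
  refine ⟨2, by norm_num, fun z _ => ?_⟩
  simp only [neg_zero, Real.rpow_zero, mul_one]
  exact abs_le_of_sq_le_sq (by linarith [(s_sq_le l z).2]) (by norm_num)

lemma Bd_smm {r : ℝ} (hr1 : r ≤ 1) : Bd smm 0 r := by
  have bm : Bd (fun z : ℂ => (1 + z.re * z.re + z.im * z.im)) 0 r :=
    ((Bd.const 1).add ((Bd_re.mul Bd_re).exp hr1 (by norm_num))).add ((Bd_im.mul Bd_im).exp hr1 (by norm_num))
  exact ((bm.mul bm).const_mul (1/4)).exp hr1 (β := 0) (by norm_num)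

/-- small-o transfer -/
lemma ho_comb {U0 U1 U2 y0 y1 y2 : ℂ → ℝ} (hy0 : ∀ z, y0 z ^ 2 ≤ 4) (hy1 : ∀ z, y1 z ^ 2 ≤ 4) (hy2 : ∀ z, y2 z ^ 2 ≤ 4)
    (h0 : ∀ ε > (0:ℝ), ∃ ρ > (0:ℝ), ∀ z : ℂ, 0 < ‖z‖ → ‖z‖ < ρ → |U0 z| ≤ ε * |Real.log ‖z‖|)
    (h1 : ∀ ε > (0:ℝ), ∃ ρ > (0:ℝ), ∀ z : ℂ, 0 < ‖z‖ → ‖z‖ < ρ → |U1 z| ≤ ε * |Real.log ‖z‖|)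
    (h2 : ∀ ε > (0:ℝ), ∃ ρ > (0:ℝ), ∀ z : ℂ, 0 < ‖z‖ → ‖z‖ < ρ → |U2 z| ≤ ε * |Real.log ‖z‖|) :
    ∀ ε > (0:ℝ), ∃ ρ > (0:ℝ), ∀ z : ℂ, 0 < ‖z‖ → ‖z‖ < ρ →
      |U0 z * y0 z + U1 z * y1 z + U2 z * y2 z| ≤ ε * |Real.log ‖z‖| := by
  intro ε hε
  obtain ⟨ρ0, p0, g0⟩ := h0 (ε/6) (by linarith)
  obtain ⟨ρ1, p1, g1⟩ := h1 (ε/6) (by linarith)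
  obtain ⟨ρ2, p2, g2⟩ := h2 (ε/6) (by linarith)
  refine ⟨min ρ0 (min ρ1 ρ2), lt_min p0 (lt_min p1 p2), fun z hz hz' => ?_⟩
  have a0 := g0 z hz (hz'.trans_le (min_le_left _ _))
  have a1 := g1 z hz (hz'.trans_le ((min_le_right _ _).trans (min_le_left _ _)))
  have a2 := g2 z hz (hz'.trans_le ((min_le_right _ _).trans (min_le_right _ _)))
  have b0 : |y0 z| ≤ 2 := abs_le_of_sq_le_sq (by linarith [hy0 z]) (by norm_num)
  have b1 : |y1 z| ≤ 2 := abs_le_of_sq_le_sq (by linarith [hy1 z]) (by norm_num)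
  have b2 : |y2 z| ≤ 2 := abs_le_of_sq_le_sq (by linarith [hy2 z]) (by norm_num)
  have c0 := mul_le_mul a0 b0 (abs_nonneg _) (by positivity)
  have c1 := mul_le_mul a1 b1 (abs_nonneg _) (by positivity)
  have c2 := mul_le_mul a2 b2 (abs_nonneg _) (by positivity)
  rw [← abs_mul] at c0 c1 c2
  have := abs_add_le (U0 z * y0 z + U1 z * y1 z) (U2 z * y2 z)
  have := abs_add_le (U0 z * y0 z) (U1 z * y1 z)
  linarith

end

section
def wt (U : Fin 3 → ℂ → ℝ) (δ : ℝ) (z : ℂ) : ℝ :=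
  ‖z‖ ^ (-δ) * (∑ j, ‖cg (U j) z‖) + ‖z‖ ^ (-(1+4*δ))

lemma BW_of_Bd {U : Fin 3 → ℂ → ℝ} {δ t : ℝ} {φ : ℂ → ℝ} (h : Bd φ (1+4*δ) t) : BW φ (wt U δ) t := by
  obtain ⟨C, hC, h⟩ := h
  refine ⟨C, hC, fun z hz => (h z hz).trans (mul_le_mul_of_nonneg_left ?_ hC)⟩
  unfold wt
  have : 0 ≤ ‖z‖ ^ (-δ) * (∑ j, ‖cg (U j) z‖) := by positivity
  linarith

lemma BW_grad {U : Fin 3 → ℂ → ℝ} {δ t : ℝ} {ψ D : ℂ → ℝ} (h : Bd ψ δ t) (j : Fin 3)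
    (hD : ∀ z, |D z| ≤ ‖cg (U j) z‖) : BW (fun z => ψ z * D z) (wt U δ) t := by
  obtain ⟨C, hC, h⟩ := h
  refine ⟨C, hC, fun z hz => ?_⟩
  have h' : ‖cg (U j) z‖ ≤ ∑ j, ‖cg (U j) z‖ :=
    Finset.single_le_sum (f := fun j => ‖cg (U j) z‖) (fun i _ => norm_nonneg _) (Finset.mem_univ j)
  have h2 : |ψ z * D z| ≤ C * ‖z‖ ^ (-δ) * (∑ j, ‖cg (U j) z‖) := by
    rw [abs_mul]
    exact mul_le_mul (h z hz) ((hD z).trans h') (abs_nonneg _) (by positivity)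
  have h3 : 0 ≤ C * ‖z‖ ^ (-(1+4*δ)) := by positivity
  unfold wt
  rw [mul_add, ← mul_assoc]; linarith

/-- combination bound for the derivative of the pressure in the plane -/
lemma BW_dQ {U : Fin 3 → ℂ → ℝ} {δ t c : ℝ} (ht1 : t ≤ 1) (hδ : 0 < δ) {f v dP : ℂ → ℝ} {D : Fin 3 → ℂ → ℝ}
    (bU : ∀ i, Bd (U i) δ t) (bf : Bd f δ t) (bv : Bd v δ t) (bP : Bd dP (1+4*δ) t)
    (hD : ∀ j z, |D j z| ≤ ‖cg (U j) z‖) :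
    BW (fun z => dP z + (f z + c⁻¹) * v z + ((f z + c⁻¹) * sX 0 z - U 0 z) * D 0 z
      + ((f z + c⁻¹) * sX 1 z - U 1 z) * D 1 z + ((f z + c⁻¹) * sX 2 z - U 2 z) * D 2 z) (wt U δ) t := by
  have b1 : Bd (fun z => f z + c⁻¹) δ t := bf.add ((Bd.const c⁻¹).exp ht1 hδ.le)
  have b2 : ∀ j, Bd (fun z => (f z + c⁻¹) * sX j z - U j z) δ t := fun j =>
    ((b1.mul (Bd_sX j t)).exp ht1 (by linarith)).sub (bU j)
  exact ((((BW_of_Bd bP).add (BW_of_Bd ((b1.mul bv).exp ht1 (by linarith)))).add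
    (BW_grad (b2 0) 0 (hD 0))).add (BW_grad (b2 1) 1 (hD 1))).add (BW_grad (b2 2) 2 (hD 2))

variable {O : Set V3} {u : Fin 3 → V3 → ℝ} {p : V3 → ℝ}

lemma NSd.dQ (N : NSd O u p) {c : ℝ} {z : ℂ} (hz : pos c z ∈ O) :
    d1 (fun z => p (pos c z)) z = d1 (zP u p c) z + (zf u c z + c⁻¹) * zv1 u c z
      + ((zf u c z + c⁻¹) * sX 0 z - u 0 (pos c z)) * d1 (fun z => u 0 (pos c z)) z
      + ((zf u c z + c⁻¹) * sX 1 z - u 1 (pos c z)) * d1 (fun z => u 1 (pos c z)) z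
      + ((zf u c z + c⁻¹) * sX 2 z - u 2 (pos c z)) * d1 (fun z => u 2 (pos c z)) z ∧
    d2 (fun z => p (pos c z)) z = d2 (zP u p c) z + (zf u c z + c⁻¹) * zv2 u c z
      + ((zf u c z + c⁻¹) * sX 0 z - u 0 (pos c z)) * d2 (fun z => u 0 (pos c z)) z
      + ((zf u c z + c⁻¹) * sX 1 z - u 1 (pos c z)) * d2 (fun z => u 1 (pos c z)) z
      + ((zf u c z + c⁻¹) * sX 2 z - u 2 (pos c z)) * d2 (fun z => u 2 (pos c z)) z := by
  have hu : ∀ i, PD (fun z => u i (pos c z)) z (d1 (fun z => u i (pos c z)) z) (d2 (fun z => u i (pos c z)) z) := by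
    intro i
    have h := PD_pos c z (sm_diff N.ho (N.su i) hz)
    exact h.congr h.d1.symm h.d2.symm
  have hp : PD (fun z => p (pos c z)) z (d1 (fun z => p (pos c z)) z) (d2 (fun z => p (pos c z)) z) := by
    have h := PD_pos c z (sm_diff N.ho N.sp hz)
    exact h.congr h.d1.symm h.d2.symm
  have hX := fun l => PD_sX l z
  have pf : PD (zf u c) z _ _ := (((hu 0).mul (hX 0)).add ((hu 1).mul (hX 1))).add ((hu 2).mul (hX 2))
  have pP : PD (zP u p c) z _ _ := ((hp.add ((((((hu 0).mul (hu 0)).add ((hu 1).mul (hu 1))).add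
    ((hu 2).mul (hu 2))).const_mul (1/2)))).sub ((pf.mul pf).const_mul (1/2))).sub (pf.const_mul c⁻¹)
  rw [pP.d1, pP.d2]
  unfold zv1 zv2
  constructor <;> ring

lemma NSd.plane (N : NSd O u p) {c r δ : ℝ} (hc : c ≠ 0) (hr : 0 < r) (hr1 : r ≤ 1)
    (hmap : ∀ z ∈ pdisc r, pos c z ∈ O) (hδ : 0 < δ) (hδ1 : δ < 1/16)
    (bU : ∀ i, Bd (fun z => u i (pos c z)) δ r)
    (ho : ∀ i, ∀ ε > (0:ℝ), ∃ ρ > (0:ℝ), ∀ z : ℂ, 0 < ‖z‖ → ‖z‖ < ρ → |u i (pos c z)| ≤ ε * |Real.log ‖z‖|) :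
    ∃ r' > 0, r' ≤ r ∧ (∀ i l, Bd (fun z => pd l (u i) (pos c z)) (8*δ) r') ∧
      Bd (fun z => p (pos c z)) (4*δ) r' ∧ ∀ l, Bd (fun z => pd l p (pos c z)) (1+4*δ) r' := by
  have cmp : ∀ {g : V3 → ℝ}, ContDiffOn ℝ (⊤:ℕ∞) g O → SM (fun z => g (pos c z)) r := fun hg =>
    hg.comp (contDiff_pos c).contDiffOn hmap
  have sU : ∀ i, SM (fun z => u i (pos c z)) r := fun i => cmp (N.su i)
  have sD : ∀ i l, SM (fun z => pd l (u i) (pos c z)) r := fun i l => cmp (pd_smooth N.ho (N.su i) l)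
  have sX' : ∀ l, SM (sX l) r := fun l => (contDiff_sX l).contDiffOn
  have sY' : ∀ l, SM (sY l) r := fun l => (contDiff_sY l).contDiffOn
  have sW' : ∀ l, SM (sW l) r := fun l => (contDiff_sW l).contDiffOn
  have hf : SM (zf u c) r := (((sU 0).mul (sX' 0)).add ((sU 1).mul (sX' 1))).add ((sU 2).mul (sX' 2))
  have S : Sys c r (zf u c) (zv1 u c) (zv2 u c) (zW u c) (zP u p c) :=
    { hc := hc, hr := hr, hr1 := hr1, sf := hf
      sv1 := (((sU 0).mul (sY' 0)).add ((sU 1).mul (sY' 1))).add ((sU 2).mul (sY' 2))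
      sv2 := (((sU 0).mul (sW' 0)).add ((sU 1).mul (sW' 1))).add ((sU 2).mul (sW' 2))
      sW := (((sX' 0).mul ((sD 2 1).sub (sD 1 2))).add
        ((sX' 1).mul ((sD 0 2).sub (sD 2 0)))).add ((sX' 2).mul ((sD 1 0).sub (sD 0 1)))
      sP := (((cmp N.sp).add (contDiffOn_const.mul ((((sU 0).mul (sU 0)).add ((sU 1).mul (sU 1))).add
        ((sU 2).mul (sU 2))))).sub (contDiffOn_const.mul (hf.mul hf))).sub (contDiffOn_const.mul hf)
      e1 := fun z hz => (N.E1 hc (hmap z hz)).1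
      e1' := fun z hz => (N.E1 hc (hmap z hz)).2
      e2 := fun z hz => (N.E2 (hmap z hz)).1
      e2' := fun z hz => (N.E2 (hmap z hz)).2 }
  have bf : Bd (zf u c) δ r := ((((bU 0).mul (Bd_sX 0 r)).add ((bU 1).mul (Bd_sX 1 r))).add
    ((bU 2).mul (Bd_sX 2 r))).exp hr1 (by linarith)
  have bv1 : Bd (zv1 u c) δ r := ((((bU 0).mul (Bd_sY 0 r)).add ((bU 1).mul (Bd_sY 1 r))).add
    ((bU 2).mul (Bd_sY 2 r))).exp hr1 (by linarith)
  have bv2 : Bd (zv2 u c) δ r := ((((bU 0).mul (Bd_sW 0 r)).add ((bU 1).mul (Bd_sW 1 r))).add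
    ((bU 2).mul (Bd_sW 2 r))).exp hr1 (by linarith)
  have ho1 := ho_comb (fun z => (s_sq_le 0 z).1) (fun z => (s_sq_le 1 z).1) (fun z => (s_sq_le 2 z).1)
    (ho 0) (ho 1) (ho 2)
  have ho2 := ho_comb (fun z => (s_sq_le 0 z).2) (fun z => (s_sq_le 1 z).2) (fun z => (s_sq_le 2 z).2)
    (ho 0) (ho 1) (ho 2)
  obtain ⟨bW, bP⟩ := S.S345 hδ (by linarith) bf bv1 bv2 ho1 ho2
  obtain ⟨-, bgP, -⟩ := S.S2 (s := r/32) (by linarith) (by linarith) (by linarith : 0 < 4*δ) hδ (by linarith)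
    bf bv1 bv2 bW
  obtain ⟨t, ht⟩ : ∃ t, t = r/32/2 := ⟨_, rfl⟩
  rw [← ht] at bgP
  have ht0 : 0 < t := by rw [ht]; linarith
  have ht1 : t ≤ 1 := by rw [ht]; linarith
  have htr : t ≤ r := by rw [ht]; linarith
  have bf := bf.sub_r htr
  have bv1 := bv1.sub_r htr
  have bv2 := bv2.sub_r htr
  have bU : ∀ i, Bd (fun z => u i (pos c z)) δ t := fun i => (bU i).sub_r htr
  have bP := bP.sub_r (by rw [ht]; linarith : t ≤ r/32)
  have hmap : ∀ z ∈ pdisc t, pos c z ∈ O := fun z hz => hmap z (pdisc_mono htr hz)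
  have bQ : Bd (fun z => p (pos c z)) (4*δ) t := by
    have q : ∀ i, Bd (fun z => u i (pos c z) * u i (pos c z)) (4*δ) t := fun i =>
      ((bU i).mul (bU i)).exp ht1 (by linarith)
    have := ((bP.sub ((((q 0).add (q 1)).add (q 2)).const_mul (1/2))).add
      (((bf.mul bf).exp ht1 (by linarith : δ + δ ≤ 4 * δ)).const_mul (1/2))).add
      ((bf.exp ht1 (by linarith : δ ≤ 4 * δ)).const_mul c⁻¹)
    refine this.le (fun z _ => le_of_eq ?_)
    congr 1
    simp only [zP]; ring
  let U : Fin 3 → ℂ → ℝ := fun i z => u i (pos c z)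
  have b1 : BW (d1 (fun z => p (pos c z))) (wt U δ) t :=
    (BW_dQ (U := U) (c := c) ht1 hδ bU bf bv1 (bgP.le (fun z _ => by
      rw [abs_of_nonneg (norm_nonneg _)]; exact abs_d1_le (zP u p c) z)) (D := fun j => d1 (U j))
      (fun j z => abs_d1_le (U j) z)).congr (fun z hz => (N.dQ (hmap z hz)).1)
  have b2 : BW (d2 (fun z => p (pos c z))) (wt U δ) t :=
    (BW_dQ (U := U) (c := c) ht1 hδ bU bf bv2 (bgP.le (fun z _ => by
      rw [abs_of_nonneg (norm_nonneg _)]; exact abs_d2_le (zP u p c) z)) (D := fun j => d2 (U j))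
      (fun j z => abs_d2_le (U j) z)).congr (fun z hz => (N.dQ (hmap z hz)).2)
  have bm := Bd_smm ht1
  have rp : ∀ l, ∀ z ∈ pdisc t, pd l p (pos c z) = (c⁻¹ * (smm z * sY l z)) * d1 (fun z => p (pos c z)) z
      + (c⁻¹ * (smm z * sW l z)) * d2 (fun z => p (pos c z)) z + (-2 * c⁻¹) * (sX l z * p (pos c z)) := by
    intro l z hz
    have h := recover hc z (sm_diff N.ho N.sp (hmap z hz)) l
    rw [N.ep _ (hmap z hz)] at h
    rw [h, mul_inv, ← eq_inv_of_mul_eq_one_left (smm_mul z)]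
    ring
  have ru : ∀ i l, ∀ z ∈ pdisc t, pd l (u i) (pos c z) = (c⁻¹ * (smm z * sY l z)) * d1 (U i) z
      + (c⁻¹ * (smm z * sW l z)) * d2 (U i) z + (-c⁻¹) * (sX l z * u i (pos c z)) := by
    intro i l z hz
    have h := recover hc z (sm_diff N.ho (N.su i) (hmap z hz)) l
    rw [N.eu _ (hmap z hz)] at h
    rw [h, mul_inv, ← eq_inv_of_mul_eq_one_left (smm_mul z)]
    ring
  have bY : ∀ l, Bd (fun z => c⁻¹ * (smm z * sY l z)) 0 t := fun l =>
    ((bm.mul (Bd_sY l t)).const_mul c⁻¹).exp ht1 (by norm_num)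
  have bZ : ∀ l, Bd (fun z => c⁻¹ * (smm z * sW l z)) 0 t := fun l =>
    ((bm.mul (Bd_sW l t)).const_mul c⁻¹).exp ht1 (by norm_num)
  have bpl : ∀ l, BW (fun z => pd l p (pos c z)) (wt U δ) t := fun l =>
    (((b1.mulB (bY l)).add (b2.mulB (bZ l))).add (BW_of_Bd ((((Bd_sX l t).mul bQ).const_mul (-2 * c⁻¹)).exp ht1
      (by linarith)))).congr (rp l)
  have buu : ∀ i j, BW (fun z => u j (pos c z) * pd j (u i) (pos c z)) (wt U δ) t := by
    intro i j
    refine (((BW_grad (U := U) (((bU j).mul (bY j)).exp ht1 (by linarith : δ + 0 ≤ δ)) i (abs_d1_le (U i))).add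
      (BW_grad (U := U) (((bU j).mul (bZ j)).exp ht1 (by linarith : δ + 0 ≤ δ)) i (abs_d2_le (U i)))).add
      (BW_of_Bd ((((bU j).mul ((Bd_sX j t).mul (bU i))).const_mul (-c⁻¹)).exp ht1
        (by linarith)))).congr (fun z hz => ?_)
    rw [ru i j z hz]; ring
  have bl : ∀ i, BW (lap2 (U i)) (wt U δ) t := by
    intro i
    refine (((bpl i).add (((buu i 0).add (buu i 1)).add (buu i 2))).mulB
      (Bd_smu.const_mul (c^2))).congr (fun z hz => ?_)
    exact N.E3 (hmap z hz) i
  obtain ⟨C0, hC0, k0⟩ := bl 0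
  obtain ⟨C1, hC1, k1⟩ := bl 1
  obtain ⟨C2, hC2, k2⟩ := bl 2
  have key := S6 (U := U) (C := C0 + C1 + C2) ht0 ht1 hδ hδ1 (by positivity) (fun i => (sU i).mono (pdisc_mono htr)) bU
    (by
      intro i z hz
      have w0 : 0 ≤ wt U δ z := by unfold wt; positivity
      fin_cases i
      · exact (k0 z hz).trans (mul_le_mul_of_nonneg_right (by linarith) w0)
      · exact (k1 z hz).trans (mul_le_mul_of_nonneg_right (by linarith) w0)
      · exact (k2 z hz).trans (mul_le_mul_of_nonneg_right (by linarith) w0)) ho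
  have ht8 : t/8 ≤ t := by linarith
  have ht81 : t/8 ≤ 1 := by linarith
  have g1 : ∀ i, Bd (d1 (U i)) (8*δ) (t/8) := fun i => (key i).le (fun z _ => by
      rw [abs_of_nonneg (norm_nonneg _)]; exact abs_d1_le (U i) z)
  have g2 : ∀ i, Bd (d2 (U i)) (8*δ) (t/8) := fun i => (key i).le (fun z _ => by
      rw [abs_of_nonneg (norm_nonneg _)]; exact abs_d2_le (U i) z)
  refine ⟨t/8, by linarith, by linarith, ?_, bQ.sub_r ht8, ?_⟩
  · intro i l
    have := ((((bY l).sub_r ht8).mul (g1 i)).exp ht81 (by linarith : 0 + 8*δ ≤ 8*δ)).add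
      ((((bZ l).sub_r ht8).mul (g2 i)).exp ht81 (by linarith : 0 + 8*δ ≤ 8*δ)) |>.add
      (((((Bd_sX l t).mul (bU i)).const_mul (-c⁻¹)).sub_r ht8).exp ht81 (by linarith : 0 + δ ≤ 8 * δ))
    refine this.le (fun z hz => le_of_eq ?_)
    rw [ru i l z (pdisc_mono ht8 hz)]
  · intro l
    obtain ⟨C, hC, h⟩ := bpl l
    obtain ⟨K0, hK0, h0⟩ := key 0
    obtain ⟨K1, hK1, h1⟩ := key 1
    obtain ⟨K2, hK2, h2⟩ := key 2
    refine ⟨C * (K0 + K1 + K2 + 1), by positivity, fun z hz => ?_⟩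
    refine (h z (pdisc_mono ht8 hz)).trans ?_
    rw [mul_assoc]
    refine mul_le_mul_of_nonneg_left ?_ hC
    unfold wt
    have a0 := h0 z hz
    have a1 := h1 z hz
    have a2 := h2 z hz
    rw [abs_of_nonneg (norm_nonneg _)] at a0 a1 a2
    have hs : (∑ j, ‖cg (U j) z‖) ≤ (K0 + K1 + K2) * ‖z‖ ^ (-(8*δ)) := by
      rw [Fin.sum_univ_three]; linarith
    have h4 := mul_le_mul_of_nonneg_left hs (by positivity : 0 ≤ ‖z‖ ^ (-δ))
    have h5 : ‖z‖ ^ (-δ) * ((K0 + K1 + K2) * ‖z‖ ^ (-(8*δ))) = (K0 + K1 + K2) * ‖z‖ ^ (-(9*δ)) := by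
      rw [show -(9*δ) = -δ + -(8*δ) by ring, Real.rpow_add hz.1]; ring
    have h6 := mul_le_mul_of_nonneg_left (rp_mono hz.1 (hz.2.le.trans ht81) (by linarith : 9 * δ ≤ 1 + 4 * δ))
      (by positivity : 0 ≤ K0 + K1 + K2)
    linarith

end

section
lemma fd_apply (g : V3 → ℝ) (x y : V3) : fderiv ℝ g x y = y 0 * pd 0 g x + y 1 * pd 1 g x + y 2 * pd 2 g x := by
  conv_lhs => rw [V3_eta y]
  rw [map_sum, Fin.sum_univ_three]
  simp [pd]

lemma euler_of_hom {O : Set V3} (hO : IsOpen O) {g : V3 → ℝ} (hg : ContDiffOn ℝ (⊤:ℕ∞) g O) (k : ℕ)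
    (hom : ∀ x ∈ O, ∀ lam : ℝ, 0 < lam → lam • x ∈ O → g (lam • x) = (lam ^ k)⁻¹ * g x)
    {x : V3} (hx : x ∈ O) : x 0 * pd 0 g x + x 1 * pd 1 g x + x 2 * pd 2 g x = - k * g x := by
  rw [← fd_apply]
  have h1 : HasDerivAt (fun l : ℝ => l • x) x 1 := by
    simpa using (hasDerivAt_id (1:ℝ)).smul_const x
  have hd : HasFDerivAt g (fderiv ℝ g x) ((1:ℝ) • x) := by
    rw [one_smul]; exact (sm_diff hO hg hx).hasFDerivAt
  have h2 : HasDerivAt (fun l : ℝ => g (l • x)) (fderiv ℝ g x x) 1 := hd.comp_hasDerivAt (1:ℝ) h1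
  have h3 : HasDerivAt (fun l : ℝ => (l ^ k)⁻¹ * g x) (- k * g x) 1 := by
    have := (((hasDerivAt_pow k (1:ℝ)).inv (by simp)).mul_const (g x))
    simpa using this
  have hev : ∀ᶠ l in 𝓝 (1:ℝ), l • x ∈ O := by
    have : ContinuousAt (fun l : ℝ => l • x) 1 := h1.continuousAt
    exact this.eventually (by simpa using hO.mem_nhds hx)
  have h4 : (fun l : ℝ => g (l • x)) =ᶠ[𝓝 1] fun l : ℝ => (l ^ k)⁻¹ * g x := by
    filter_upwards [hev, lt_mem_nhds (zero_lt_one)] with l hl hl0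
    exact hom x hx l hl0 hl
  exact (h2.congr_of_eventuallyEq h4.symm).unique h3

lemma pd_of_hom {O : Set V3} (hO : IsOpen O) {g : V3 → ℝ} (hg : ContDiffOn ℝ (⊤:ℕ∞) g O) (k : ℕ)
    (hom : ∀ x ∈ O, ∀ lam : ℝ, 0 < lam → lam • x ∈ O → g (lam • x) = (lam ^ k)⁻¹ * g x)
    {x : V3} (hx : x ∈ O) {lam : ℝ} (hl : 0 < lam) (hlx : lam • x ∈ O) (j : Fin 3) :
    pd j g x = lam ^ (k+1) * pd j g (lam • x) := by
  have hev : ∀ᶠ y in 𝓝 x, lam • y ∈ O := by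
    have : ContinuousAt (fun y : V3 => lam • y) x := by fun_prop
    exact this.eventually (hO.mem_nhds hlx)
  have h4 : g =ᶠ[𝓝 x] fun y => lam ^ k * g (lam • y) := by
    filter_upwards [hev, hO.mem_nhds hx] with y hy hy'
    rw [hom y hy' lam hl hy]; field_simp
  have h1 : HasFDerivAt (fun y : V3 => lam • y) (lam • ContinuousLinearMap.id ℝ V3) x :=
    (hasFDerivAt_id x).const_smul lam
  have h2 := ((sm_diff hO hg hlx).hasFDerivAt.comp x h1).const_mul (lam ^ k)
  have h3 := (h2.congr_of_eventuallyEq (f₁ := g) h4).fderiv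
  unfold pd
  rw [h3]
  simp
  ring

lemma rho_cont : Continuous rho := by
  unfold rho; fun_prop

lemma rho_pos_iff (x : V3) : 0 < rho x ↔ x ∉ axis3 := by
  unfold rho axis3
  rw [Real.sqrt_pos]
  constructor
  · rintro h ⟨h0, h1⟩; rw [h0, h1] at h; norm_num at h
  · intro h
    by_contra h'
    apply h
    have a0 := sq_nonneg (x 0)
    have a1 := sq_nonneg (x 1)
    constructor
    · exact pow_eq_zero_iff (two_ne_zero) |>.1 (by linarith)
    · exact pow_eq_zero_iff (two_ne_zero) |>.1 (by linarith)

lemma mem_dom {a b R : ℝ} {x : V3} : x ∈ OmegaR a b R \ axis3 ↔ (a < x 2 ∧ x 2 < b ∧ rho x < R) ∧ 0 < rho x := by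
  rw [rho_pos_iff]; rfl

lemma dom_open (a b R : ℝ) : IsOpen (OmegaR a b R \ axis3) := by
  have : OmegaR a b R \ axis3 = {x | a < x 2} ∩ {x | x 2 < b} ∩ {x | rho x < R} ∩ {x | 0 < rho x} := by
    ext x; rw [mem_dom]; simp [and_assoc]
  rw [this]
  have h2 : Continuous (fun x : V3 => x 2) := by fun_prop
  exact (((isOpen_lt continuous_const h2).inter (isOpen_lt h2 continuous_const)).inter
    (isOpen_lt rho_cont continuous_const)).inter (isOpen_lt continuous_const rho_cont)

lemma mkNSd {a b R : ℝ} {u : V3 → V3} {p : V3 → ℝ}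
    (hreg_u : ContDiffOn ℝ (⊤:ℕ∞) u (OmegaR a b R \ axis3))
    (hreg_p : ContDiffOn ℝ (⊤:ℕ∞) p (OmegaR a b R \ axis3))
    (hu_hom : ∀ x ∈ OmegaR a b R \ axis3, ∀ lam : ℝ, 0 < lam →
      lam • x ∈ OmegaR a b R \ axis3 → u (lam • x) = lam⁻¹ • u x)
    (hp_hom : ∀ x ∈ OmegaR a b R \ axis3, ∀ lam : ℝ, 0 < lam →
      lam • x ∈ OmegaR a b R \ axis3 → p (lam • x) = (lam ^ 2)⁻¹ * p x)
    (hNS : ∀ x ∈ OmegaR a b R \ axis3, NSEq u p x) :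
    NSd (OmegaR a b R \ axis3) (fun i x => u x i) p ∧
    (∀ i, ∀ x ∈ OmegaR a b R \ axis3, ∀ lam : ℝ, 0 < lam →
      lam • x ∈ OmegaR a b R \ axis3 → u (lam • x) i = (lam ^ 1)⁻¹ * u x i) := by
  have hO := dom_open a b R
  have su : ∀ i, ContDiffOn ℝ (⊤:ℕ∞) (fun x => u x i) (OmegaR a b R \ axis3) := fun i =>
    (EuclideanSpace.proj i : V3 →L[ℝ] ℝ).contDiff.comp_contDiffOn hreg_u
  have hh : (∀ i, ∀ x ∈ OmegaR a b R \ axis3, ∀ lam : ℝ, 0 < lam →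
      lam • x ∈ OmegaR a b R \ axis3 → u (lam • x) i = (lam ^ 1)⁻¹ * u x i) := by
    intro i x hx l hl hlx
    rw [hu_hom x hx l hl hlx]; simp
  refine ⟨⟨hO, su, hreg_p, ?_, ?_, ?_, ?_⟩, hh⟩
  · intro x hx i
    have := euler_of_hom hO (su i) 1 (hh i) hx
    simpa using this
  · intro x hx
    have := euler_of_hom hO hreg_p 2 hp_hom hx
    simpa using this
  · intro x hx i
    have := (hNS x hx).1 i
    simp only [lap3, Fin.sum_univ_three] at this
    linarith
  · intro x hx
    have := (hNS x hx).2
    simpa only [Fin.sum_univ_three] using this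

end

section
lemma norm_sq_c (z : ℂ) : ‖z‖ ^ 2 = z.re * z.re + z.im * z.im := by
  rw [Complex.sq_norm, Complex.normSq_apply]

lemma rho_posz (c : ℝ) (z : ℂ) : rho (pos c z) = |c| * (2 * qq z) * ‖z‖ := by
  unfold rho
  have hq := qq_pos z
  rw [pos_apply, pos_apply]
  have : (c * sX 0 z) ^ 2 + (c * sX 1 z) ^ 2 = (|c| * (2 * qq z) * ‖z‖) ^ 2 := by
    rw [mul_pow (|c| * (2 * qq z)), mul_pow (|c|), norm_sq_c, sq_abs]
    simp [sX]; ring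
  rw [this, Real.sqrt_sq (by positivity)]

lemma qq_bds {z : ℂ} (hz : ‖z‖ ≤ 1) : 1/2 ≤ qq z ∧ qq z ≤ 1 ∧ 1 - qq z ≤ ‖z‖ := by
  have h := norm_sq_c z
  have hq := qq_pos z
  have he := qq_eq z
  have h0 := norm_nonneg z
  have e : qq z * (1 + ‖z‖ ^ 2) = 1 := by rw [h]; linarith
  have h1 : qq z ≤ 1 := by nlinarith [mul_nonneg hq.le (sq_nonneg ‖z‖)]
  have h2 : ‖z‖ ^ 2 ≤ ‖z‖ := by nlinarith
  refine ⟨by nlinarith [mul_le_mul_of_nonneg_left h2 hq.le, mul_le_mul_of_nonneg_left hz hq.le], h1, ?_⟩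
  nlinarith [mul_le_mul_of_nonneg_left h2 hq.le, mul_le_mul_of_nonneg_right h1 h0]

lemma geo1 {a b R c : ℝ} (hR : 0 < R) (hab : a < b) (hc : c = (a+b)/2) (hc0 : c ≠ 0) :
    ∃ r0 > 0, r0 ≤ 1 ∧ ∀ z ∈ pdisc r0, pos c z ∈ OmegaR a b (3*R) \ axis3 := by
  have hca := abs_pos.2 hc0
  refine ⟨min 1 (min ((b-a)/(4*|c|)) (3*R/(2*|c|))), ?_, min_le_left _ _, ?_⟩
  · refine lt_min one_pos (lt_min (by apply div_pos <;> linarith) (by positivity))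
  rintro z ⟨hz0, hz1⟩
  have h1 : ‖z‖ ≤ 1 := hz1.le.trans (min_le_left _ _)
  have h2 : ‖z‖ < (b-a)/(4*|c|) := hz1.trans_le ((min_le_right _ _).trans (min_le_left _ _))
  have h3 : ‖z‖ < 3*R/(2*|c|) := hz1.trans_le ((min_le_right _ _).trans (min_le_right _ _))
  rw [lt_div_iff₀ (by positivity)] at h2 h3
  obtain ⟨q1, q2, q3⟩ := qq_bds h1
  have hq := qq_pos z
  rw [mem_dom, rho_posz, pos_apply]
  have e2 : c * sX 2 z = c - c * (2 * (1 - qq z)) := by simp [sX]; ring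
  have h4 : |c * (2 * (1 - qq z))| < (b - a)/2 := by
    rw [abs_mul, abs_of_nonneg (by linarith : 0 ≤ 2 * (1 - qq z))]
    nlinarith [mul_le_mul_of_nonneg_left q3 hca.le]
  rw [abs_lt] at h4
  rw [e2]
  refine ⟨⟨by linarith [h4.2], by linarith [h4.1], ?_⟩, by positivity⟩
  have := mul_le_mul_of_nonneg_right q2 (mul_nonneg hca.le hz0.le)
  linarith

lemma log_rho {c : ℝ} (hc0 : c ≠ 0) : ∃ ρ > 0, ρ ≤ 1 ∧ ∀ z : ℂ, 0 < ‖z‖ → ‖z‖ < ρ →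
    |Real.log (rho (pos c z))| ≤ 2 * |Real.log ‖z‖| := by
  have hca := abs_pos.2 hc0
  set L := |Real.log (|c|)| + Real.log 2 with hL
  refine ⟨min 1 (Real.exp (-L)), lt_min one_pos (Real.exp_pos _), min_le_left _ _, fun z h0 h1 => ?_⟩
  have hz1 : ‖z‖ < 1 := h1.trans_le (min_le_left _ _)
  have hz2 : ‖z‖ < Real.exp (-L) := h1.trans_le (min_le_right _ _)
  obtain ⟨q1, q2, q3⟩ := qq_bds hz1.le
  have hq := qq_pos z
  rw [rho_posz, Real.log_mul (by positivity) h0.ne', Real.log_mul (by positivity) (by positivity)]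
  have l1 : 0 ≤ Real.log (2 * qq z) := Real.log_nonneg (by linarith)
  have l2 : Real.log (2 * qq z) ≤ Real.log 2 := Real.log_le_log (by positivity) (by linarith)
  have l3 : Real.log ‖z‖ < -L := (Real.log_lt_iff_lt_exp h0).2 hz2
  have l4 : Real.log ‖z‖ < 0 := Real.log_neg h0 hz1
  have l5 := abs_add_le (Real.log (|c|) + Real.log (2 * qq z)) (Real.log ‖z‖)
  have l6 := abs_add_le (Real.log (|c|)) (Real.log (2 * qq z))
  rw [abs_of_nonneg l1] at l6
  rw [abs_of_neg l4] at l5 ⊢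
  linarith

lemma inv_pt {c : ℝ} (x : V3) (hx : 0 < c * x 2) (hr : 0 < rho x) :
    ∃ z : ℂ, ‖z‖ = rho x / (‖x‖ + |x 2|) ∧ (|c| / ‖x‖) • x = pos c z := by
  have hc0 : c ≠ 0 := by rintro rfl; simp at hx
  have hca := abs_pos.2 hc0
  have hx2 : x 2 ≠ 0 := by intro h; rw [h] at hx; simp at hx
  have ht := abs_pos.2 hx2
  set t := |x 2| with ht'
  set n := ‖x‖ with hn
  have hn2 : n ^ 2 = x 0 ^ 2 + x 1 ^ 2 + t ^ 2 := by
    rw [hn, EuclideanSpace.norm_sq_eq, Fin.sum_univ_three]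
    simp [ht', sq_abs]
  have hr2 : rho x ^ 2 = x 0 ^ 2 + x 1 ^ 2 := by
    unfold rho; rw [Real.sq_sqrt (by positivity)]
  have hn0 : 0 < n := by
    rw [hn, norm_pos_iff]; rintro h; rw [h] at hx2; simp at hx2
  obtain ⟨σ, hσ, hσ2, hσx⟩ : ∃ σ : ℝ, σ * σ = 1 ∧ c * σ = |c| ∧ σ * t = x 2 := by
    rcases lt_or_gt_of_ne hc0 with h | h
    · refine ⟨-1, by norm_num, by rw [abs_of_neg h]; ring, ?_⟩
      have : x 2 < 0 := by nlinarith
      rw [ht', abs_of_neg this]; ring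
    · refine ⟨1, by norm_num, by rw [abs_of_pos h]; ring, ?_⟩
      have : 0 < x 2 := by nlinarith
      rw [ht', abs_of_pos this]; ring
  have hnt : 0 < n + t := by positivity
  refine ⟨⟨σ * x 0 / (n + t), σ * x 1 / (n + t)⟩, ?_, ?_⟩
  · have h := norm_sq_c ⟨σ * x 0 / (n + t), σ * x 1 / (n + t)⟩
    have : (rho x / (n + t)) ^ 2 = σ * x 0 / (n + t) * (σ * x 0 / (n + t)) + σ * x 1 / (n + t) * (σ * x 1 / (n + t)) := by
      rw [div_pow, hr2]
      field_simp
      linear_combination (-(x 0)^2 - (x 1)^2) * hσ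
    rw [← this] at h
    exact (pow_left_inj₀ (norm_nonneg _) (by positivity) two_ne_zero).1 h
  · have hq : qq ⟨σ * x 0 / (n + t), σ * x 1 / (n + t)⟩ = (n + t) / (2 * n) := by
      unfold qq
      rw [inv_eq_iff_eq_inv, inv_div]
      field_simp
      linear_combination ((x 0)^2 + (x 1)^2) * hσ - hn2
    ext m
    rw [pos_apply, ← hσ2]
    fin_cases m
    · simp [sX, hq]; field_simp
    · simp [sX, hq]; field_simp
    · simp [sX, hq]; rw [← hσx]; field_simp
      linear_combination t * hσ

end

section
lemma norm_le_rho (x : V3) : ‖x‖ ≤ rho x + |x 2| := by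
  have hr2 : rho x ^ 2 = x 0 ^ 2 + x 1 ^ 2 := by
    unfold rho; rw [Real.sq_sqrt (by positivity)]
  have h0 : 0 ≤ rho x := Real.sqrt_nonneg _
  have h1 := abs_nonneg (x 2)
  apply le_of_sq_le_sq _ (by positivity)
  rw [EuclideanSpace.norm_sq_eq, Fin.sum_univ_three]
  simp only [Real.norm_eq_abs, sq_abs]
  nlinarith [mul_nonneg h0 h1, sq_abs (x 2)]

lemma abs_le_norm (x : V3) : |x 2| ≤ ‖x‖ := by
  have := PiLp.norm_apply_le x 2
  simpa using this

lemma transfer {O : Set V3} {g : V3 → ℝ} {c α r m0 N0 : ℝ} {k : ℕ} (hα : 0 ≤ α) (hr : 0 < r) (hc : c ≠ 0)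
    (hB : Bd (fun z => g (pos c z)) α r) (hmap : ∀ z ∈ pdisc r, pos c z ∈ O)
    (hg : ∀ x ∈ O, ∀ l : ℝ, 0 < l → l • x ∈ O → g x = l ^ k * g (l • x))
    (hm0 : 0 < m0) (hm : ∀ x ∈ O, m0 ≤ |x 2|) (hN : ∀ x ∈ O, ‖x‖ ≤ N0) (hs : ∀ x ∈ O, 0 < c * x 2)
    (hρ : ∀ x ∈ O, 0 < rho x) :
    ∃ C, 0 ≤ C ∧ ∃ ρ > 0, ∀ x ∈ O, rho x < ρ → |g x| ≤ C * rho x ^ (-α) := by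
  obtain ⟨C, hC, h⟩ := hB
  refine ⟨(|c| / m0) ^ k * (C * (2 * |N0|) ^ α), by positivity, m0 * r, by positivity, fun x hx hxr => ?_⟩
  have hxp := hρ x hx
  have hca := abs_pos.2 hc
  obtain ⟨z, hz, hp⟩ := inv_pt x (hs x hx) hxp
  have h1 := hm x hx
  have h2 := abs_le_norm x
  have h3 : ‖x‖ ≤ |N0| := (hN x hx).trans (le_abs_self _)
  have hn : 0 < ‖x‖ := by linarith
  have hz0 : 0 < ‖z‖ := by rw [hz]; positivity
  have hzr : ‖z‖ < r := by
    rw [hz, div_lt_iff₀ (by positivity)]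
    nlinarith
  have hzO := hmap z ⟨hz0, hzr⟩
  have hl : 0 < |c| / ‖x‖ := by positivity
  rw [hg x hx _ hl (by rw [hp]; exact hzO), hp, abs_mul, abs_of_pos (by positivity), mul_assoc]
  have b1 : (|c| / ‖x‖) ^ k ≤ (|c| / m0) ^ k := by
    apply pow_le_pow_left₀ hl.le
    exact div_le_div_of_nonneg_left hca.le hm0 (by linarith)
  have b2 : ‖z‖ ^ (-α) ≤ (2 * |N0|) ^ α * rho x ^ (-α) := by
    have e : rho x / (2 * |N0|) ≤ ‖z‖ := by
      rw [hz]; apply div_le_div_of_nonneg_left hxp.le (by positivity); linarith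
    have hNp : 0 < |N0| := by linarith
    refine (rp_anti (by positivity) e hα).trans (le_of_eq ?_)
    rw [Real.div_rpow hxp.le (by positivity), Real.rpow_neg (by positivity : 0 ≤ 2 * |N0|)]
    field_simp
  refine mul_le_mul b1 ?_ (abs_nonneg _) (by positivity)
  refine (h z ⟨hz0, hzr⟩).trans ?_
  rw [mul_assoc]
  exact mul_le_mul_of_nonneg_left b2 hC

lemma extend {a b a' b' R α C ρ : ℝ} {g : V3 → ℝ} (hR : 0 < R) (ha : a < a') (hb : b' < b) (hα : 0 ≤ α)
    (hg : ContinuousOn g (OmegaR a b (3*R) \ axis3)) (hC : 0 ≤ C) (hρ : 0 < ρ)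
    (h : ∀ x ∈ OmegaR a b (3*R) \ axis3, rho x < ρ → |g x| ≤ C * rho x ^ (-α)) :
    ∃ C', 0 ≤ C' ∧ ∀ x : V3, a' ≤ x 2 → x 2 ≤ b' → 0 < rho x → rho x ≤ R → |g x| ≤ C' * rho x ^ (-α) := by
  let K : Set V3 := {x | a' ≤ x 2 ∧ x 2 ≤ b' ∧ ρ ≤ rho x ∧ rho x ≤ R}
  have hx2 : Continuous (fun x : V3 => x 2) := by fun_prop
  have hK : IsCompact K := by
    apply Metric.isCompact_of_isClosed_isBounded
    · exact (isClosed_le continuous_const hx2).inter ((isClosed_le hx2 continuous_const).inter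
        ((isClosed_le continuous_const rho_cont).inter (isClosed_le rho_cont continuous_const)))
    · apply (Metric.isBounded_closedBall (x := (0:V3)) (r := R + (|a'| + |b'|))).subset
      rintro x ⟨h1, h2, h3, h4⟩
      have : |x 2| ≤ |a'| + |b'| := by
        rw [abs_le]
        exact ⟨by linarith [neg_abs_le a', abs_nonneg b'], by linarith [le_abs_self b', abs_nonneg a']⟩
      have := norm_le_rho x
      simp only [mem_closedBall, dist_zero_right]; linarith
  have hsub : K ⊆ OmegaR a b (3*R) \ axis3 := by
    rintro x ⟨h1, h2, h3, h4⟩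
    rw [mem_dom]; exact ⟨⟨by linarith, by linarith, by linarith⟩, by linarith⟩
  obtain ⟨M, hM⟩ := hK.exists_bound_of_continuousOn (hg.mono hsub)
  refine ⟨C + |M| * R ^ α, by positivity, fun x h1 h2 h3 h4 => ?_⟩
  have p1 : 0 ≤ C * rho x ^ (-α) := by positivity
  have p2 : 0 ≤ |M| * R ^ α * rho x ^ (-α) := by positivity
  rw [add_mul]
  rcases lt_or_ge (rho x) ρ with hlt | hge
  · have := h x (mem_dom.2 ⟨⟨by linarith, by linarith, by linarith⟩, by linarith⟩) hlt
    linarith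
  · have h5 := (hM x ⟨h1, h2, hge, h4⟩).trans (le_abs_self M)
    rw [Real.norm_eq_abs] at h5
    have h6 : 1 ≤ R ^ α * rho x ^ (-α) := by
      rw [Real.rpow_neg h3.le, ← div_eq_mul_inv, one_le_div (by positivity)]
      exact Real.rpow_le_rpow h3.le h4 hα
    have h7 := le_mul_of_one_le_right (abs_nonneg M) h6
    rw [← mul_assoc] at h7
    linarith

lemma axis_bounds {R a b δ : ℝ} (hR : 0 < R) (hab : a < b) (hab' : 0 < a * b)
    {u : V3 → V3} {p : V3 → ℝ}
    (hreg_u : ContDiffOn ℝ (⊤:ℕ∞) u (OmegaR a b (3 * R) \ axis3))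
    (hreg_p : ContDiffOn ℝ (⊤:ℕ∞) p (OmegaR a b (3 * R) \ axis3))
    (hu_hom : ∀ x ∈ OmegaR a b (3 * R) \ axis3, ∀ lam : ℝ, 0 < lam →
      lam • x ∈ OmegaR a b (3 * R) \ axis3 → u (lam • x) = lam⁻¹ • u x)
    (hp_hom : ∀ x ∈ OmegaR a b (3 * R) \ axis3, ∀ lam : ℝ, 0 < lam →
      lam • x ∈ OmegaR a b (3 * R) \ axis3 → p (lam • x) = (lam ^ 2)⁻¹ * p x)
    (hNS : ∀ x ∈ OmegaR a b (3 * R) \ axis3, NSEq u p x)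
    (hsmall : ∀ ε > (0:ℝ), ∃ ρ > (0:ℝ), ∀ x ∈ OmegaR a b (3 * R) \ axis3,
      rho x < ρ → ‖u x‖ ≤ ε * |Real.log (rho x)|) (hδ : 0 < δ) (hδ1 : δ < 1/16)
    {a' b' : ℝ} (ha : a < a') (hb : b' < b) :
    (∃ C, 0 ≤ C ∧ ∀ x : V3, a' ≤ x 2 → x 2 ≤ b' → 0 < rho x → rho x ≤ R → |p x| ≤ C * rho x ^ (-(1+4*δ))) ∧
    (∀ l, ∃ C, 0 ≤ C ∧ ∀ x : V3, a' ≤ x 2 → x 2 ≤ b' → 0 < rho x → rho x ≤ R →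
      |pd l p x| ≤ C * rho x ^ (-(1+4*δ))) ∧
    (∀ i l, ∃ C, 0 ≤ C ∧ ∀ x : V3, a' ≤ x 2 → x 2 ≤ b' → 0 < rho x → rho x ≤ R →
      |pd l (fun x => u x i) x| ≤ C * rho x ^ (-(8*δ))) := by
  obtain ⟨N, hh⟩ := mkNSd hreg_u hreg_p hu_hom hp_hom hNS
  obtain ⟨c, hc⟩ : ∃ c, c = (a+b)/2 := ⟨_, rfl⟩
  have hs : ∀ x ∈ OmegaR a b (3 * R) \ axis3, 0 < c * x 2 := by
    intro x hx
    rw [mem_dom] at hx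
    obtain ⟨⟨h1, h2, -⟩, -⟩ := hx
    rcases lt_or_ge 0 a with h | h
    · have : 0 < c := by rw [hc]; linarith
      exact mul_pos this (by linarith)
    · have ha0 : a < 0 := lt_of_le_of_ne h (by rintro rfl; simp at hab')
      have hb0 : b < 0 := by nlinarith
      have : c < 0 := by rw [hc]; linarith
      exact mul_pos_of_neg_of_neg this (by linarith)
  have hc0 : c ≠ 0 := by
    rintro rfl
    rcases lt_or_ge 0 a with h | h
    · linarith
    · nlinarith
  have hm0 : 0 < min |a| |b| := by
    refine lt_min (abs_pos.2 ?_) (abs_pos.2 ?_)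
    · rintro rfl; simp at hab'
    · rintro rfl; simp at hab'
  have hm : ∀ x ∈ OmegaR a b (3 * R) \ axis3, min |a| |b| ≤ |x 2| := by
    intro x hx
    rw [mem_dom] at hx
    obtain ⟨⟨h1, h2, -⟩, -⟩ := hx
    rcases lt_or_ge 0 a with h | h
    · refine (min_le_left _ _).trans ?_
      rw [abs_of_pos h, abs_of_pos (by linarith)]; exact h1.le
    · have hb0 : b < 0 := by nlinarith
      refine (min_le_right _ _).trans ?_
      rw [abs_of_neg hb0, abs_of_neg (by linarith)]; linarith
  have hN : ∀ x ∈ OmegaR a b (3 * R) \ axis3, ‖x‖ ≤ 3 * R + (|a| + |b|) := by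
    intro x hx
    rw [mem_dom] at hx
    obtain ⟨⟨h1, h2, h3⟩, -⟩ := hx
    have : |x 2| ≤ |a| + |b| := by
      rw [abs_le]
      exact ⟨by linarith [neg_abs_le a, abs_nonneg b], by linarith [le_abs_self b, abs_nonneg a]⟩
    have := norm_le_rho x
    linarith
  have hρ : ∀ x ∈ OmegaR a b (3 * R) \ axis3, 0 < rho x := fun x hx => (mem_dom.1 hx).2
  obtain ⟨r0, hr0, hr01, hmap⟩ := geo1 hR hab hc hc0
  obtain ⟨ρ1, hρ1, hρ11, hlog⟩ := log_rho hc0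
  have hca := abs_pos.2 hc0
  have ho : ∀ i, ∀ ε > (0:ℝ), ∃ ρ > (0:ℝ), ∀ z : ℂ, 0 < ‖z‖ → ‖z‖ < ρ → |u (pos c z) i| ≤ ε * |Real.log ‖z‖| := by
    intro i ε hε
    obtain ⟨ρ, hρ, h⟩ := hsmall (ε/2) (by linarith)
    refine ⟨min (min r0 ρ1) (ρ / (2 * |c|)), lt_min (lt_min hr0 hρ1) (by positivity), fun z h0 h1 => ?_⟩
    have k0 : ‖z‖ < r0 := h1.trans_le ((min_le_left _ _).trans (min_le_left _ _))
    have k1 : ‖z‖ < ρ1 := h1.trans_le ((min_le_left _ _).trans (min_le_right _ _))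
    have k2 : ‖z‖ < ρ / (2 * |c|) := h1.trans_le (min_le_right _ _)
    rw [lt_div_iff₀ (by positivity)] at k2
    have hq := (qq_bds (by linarith : ‖z‖ ≤ 1)).2.1
    have hlt : rho (pos c z) < ρ := by
      rw [rho_posz]
      have := mul_le_mul_of_nonneg_right hq (mul_nonneg hca.le h0.le)
      linarith
    have e1 := h _ (hmap z ⟨h0, k0⟩) hlt
    have e2 : |u (pos c z) i| ≤ ‖u (pos c z)‖ := by
      have := PiLp.norm_apply_le (u (pos c z)) i
      simpa using this
    have e3 := hlog z h0 k1
    have e4 := mul_le_mul_of_nonneg_left e3 (by linarith : 0 ≤ ε/2)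
    linarith
  obtain ⟨s0, hs0, g0⟩ := ho 0 1 one_pos
  obtain ⟨s1, hs1, g1⟩ := ho 1 1 one_pos
  obtain ⟨s2, hs2, g2⟩ := ho 2 1 one_pos
  obtain ⟨r, hr⟩ : ∃ r, r = min r0 (min s0 (min s1 s2)) := ⟨_, rfl⟩
  have hrp : 0 < r := by rw [hr]; exact lt_min hr0 (lt_min hs0 (lt_min hs1 hs2))
  have hrr : r ≤ r0 := by rw [hr]; exact min_le_left _ _
  have q0 : r ≤ s0 := by rw [hr]; exact (min_le_right _ _).trans (min_le_left _ _)
  have q1 : r ≤ s1 := by rw [hr]; exact (min_le_right _ _).trans ((min_le_right _ _).trans (min_le_left _ _))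
  have q2 : r ≤ s2 := by rw [hr]; exact (min_le_right _ _).trans ((min_le_right _ _).trans (min_le_right _ _))
  have hr1 : r ≤ 1 := hrr.trans hr01
  have hlg : ∀ z ∈ pdisc r, |Real.log ‖z‖| ≤ 1/δ * ‖z‖ ^ (-δ) := by
    intro z hz
    have := (Real.abs_log_mul_self_rpow_lt ‖z‖ δ hz.1 (hz.2.le.trans hr1) hδ).le
    have hp : 0 < ‖z‖ ^ δ := Real.rpow_pos_of_pos hz.1 _
    rw [abs_mul, abs_of_pos hp] at this
    rw [Real.rpow_neg hz.1.le, ← div_eq_mul_inv, le_div_iff₀ hp]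
    exact this
  have bU : ∀ i, Bd (fun z => u (pos c z) i) δ r := by
    intro i
    refine ⟨1/δ, by positivity, fun z hz => ?_⟩
    refine le_trans ?_ (hlg z hz)
    fin_cases i
    · have := g0 z hz.1 (hz.2.trans_le q0); simpa using this
    · have := g1 z hz.1 (hz.2.trans_le q1); simpa using this
    · have := g2 z hz.1 (hz.2.trans_le q2); simpa using this
  obtain ⟨r', hr', hr'r, Bu, Bp, Bq⟩ := N.plane hc0 hrp hr1 (fun z hz => hmap z (pdisc_mono hrr hz)) hδ hδ1 bU ho
  have hmap' : ∀ z ∈ pdisc r', pos c z ∈ OmegaR a b (3*R) \ axis3 := fun z hz =>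
    hmap z (pdisc_mono (hr'r.trans hrr) hz)
  have hr'1 : r' ≤ 1 := hr'r.trans hr1
  refine ⟨?_, fun l => ?_, fun i l => ?_⟩
  · obtain ⟨C, hC, ρ, hρ', h⟩ := transfer (k := 2) (by positivity) hr' hc0 (Bp.exp hr'1 (by linarith : 4*δ ≤ 1+4*δ)) hmap'
      (fun x hx l hl hlx => by rw [hp_hom x hx l hl hlx]; field_simp) hm0 hm hN hs hρ
    exact extend hR ha hb (by positivity) N.sp.continuousOn hC hρ' h
  · obtain ⟨C, hC, ρ, hρ', h⟩ := transfer (k := 2+1) (by positivity) hr' hc0 (Bq l) hmap'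
      (fun x hx lam hl hlx => pd_of_hom N.ho N.sp 2 hp_hom hx hl hlx l) hm0 hm hN hs hρ
    exact extend hR ha hb (by positivity) (pd_smooth N.ho N.sp l).continuousOn hC hρ' h
  · obtain ⟨C, hC, ρ, hρ', h⟩ := transfer (k := 1+1) (by positivity) hr' hc0 (Bu i l) hmap'
      (fun x hx lam hl hlx => pd_of_hom N.ho (N.su i) 1 (hh i) hx hl hlx l) hm0 hm hN hs hρ
    exact extend hR ha hb (by positivity) (pd_smooth N.ho (N.su i) l).continuousOn hC hρ' h

end

section
lemma integrable_tp1 (M : ℝ) {α : ℝ} (hα : α < 1) : Integrable (fun x : ℝ => tp M α ‖x‖) := by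
  rw [integrable_fun_norm_addHaar volume (f := tp M α), Module.finrank_self]
  rcases le_or_gt M 0 with hM | hM
  · apply (integrableOn_zero (ε' := ℝ)).congr_fun _ measurableSet_Ioi
    intro y hy
    have : ¬ y < M := by simp only [Set.mem_Ioi] at hy; linarith
    simp [tp, this]
  · have h1 : IntegrableOn (fun y : ℝ => y ^ (- α)) (Set.Ioo 0 M) :=
      (intervalIntegral.integrableOn_Ioo_rpow_iff hM).2 (by linarith)
    have h2 : Set.Ioi (0:ℝ) = Set.Ioo 0 M ∪ Set.Ici M := by
      ext y; simp; constructor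
      · intro hy; rcases lt_or_ge y M with h | h <;> simp [*]
      · rintro (h | h) <;> linarith
    rw [h2]
    apply IntegrableOn.union
    · apply h1.congr_fun _ measurableSet_Ioo
      intro y hy
      simp [tp, hy.2]
    · apply (integrableOn_zero (ε' := ℝ)).congr_fun _ measurableSet_Ici
      intro y hy
      have : ¬ y < M := by simp only [Set.mem_Ici] at hy; linarith
      simp [tp, this]

lemma tp_meas (M α : ℝ) : Measurable (tp M α) := by
  unfold tp
  exact Measurable.ite measurableSet_Iio (by fun_prop) measurable_const

lemma tp_rpow (M α : ℝ) {s y : ℝ} (hs : 0 < s) (hy : 0 ≤ y) : tp M α y ^ s = tp M (α * s) y := by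
  unfold tp
  split_ifs
  · rw [← Real.rpow_mul hy]; congr 1; ring
  · exact Real.zero_rpow hs.ne'

lemma memLp_V2 (C M : ℝ) {α s : ℝ} (hs : 1 < s) (hα : α * s < 2) :
    MemLp (fun y : V2 => C * tp M α ‖y‖) (ENNReal.ofReal s) := by
  refine MemLp.const_mul ?_ C
  have hm : AEStronglyMeasurable (fun y : V2 => tp M α ‖y‖) volume :=
    ((tp_meas M α).comp measurable_norm).aestronglyMeasurable
  rw [← integrable_norm_rpow_iff hm (by simp; linarith) (by simp)]
  rw [ENNReal.toReal_ofReal (by linarith)]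
  have := integrable_tp (volume : Measure V2) finrank_euclideanSpace_fin M hα
  refine this.congr (Eventually.of_forall fun y => ?_)
  simp only
  rw [Real.norm_of_nonneg (tp_nonneg (norm_nonneg _)), tp_rpow M α (by linarith) (norm_nonneg _)]

def K3 (M M' : ℝ) (α : ℝ) (x : V3) : ℝ := tp M α ‖x 0‖ * tp M 0 ‖x 1‖ * tp M' 0 ‖x 2‖

lemma K3_nonneg (M M' α : ℝ) (x : V3) : 0 ≤ K3 M M' α x :=
  mul_nonneg (mul_nonneg (tp_nonneg (norm_nonneg _)) (tp_nonneg (norm_nonneg _))) (tp_nonneg (norm_nonneg _))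

lemma memLp_V3 (C M M' : ℝ) {α : ℝ} (hα : α * 2 < 1) :
    MemLp (fun x : V3 => C * K3 M M' α x) 2 := by
  refine MemLp.const_mul ?_ C
  have hc : ∀ i : Fin 3, Measurable (fun x : V3 => ‖x i‖) := fun i => by fun_prop
  have hm : AEStronglyMeasurable (fun x : V3 => K3 M M' α x) volume :=
    ((((tp_meas M α).comp (hc 0)).mul ((tp_meas M 0).comp (hc 1))).mul
      ((tp_meas M' 0).comp (hc 2))).aestronglyMeasurable
  rw [← integrable_norm_rpow_iff hm (by simp) (by simp)]
  have h0 := integrable_tp1 M hα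
  have h1 := integrable_tp1 M (by linarith : (0:ℝ) < 1)
  have h2 := integrable_tp1 M' (by linarith : (0:ℝ) < 1)
  have key := Integrable.fintype_prod (ι := Fin 3) (𝕜 := ℝ) (E := ℝ) (μ := fun _ => volume)
    (f := ![fun x => tp M (α*2) ‖x‖, fun x => tp M 0 ‖x‖, fun x => tp M' 0 ‖x‖])
    (by intro i; fin_cases i <;> simpa)
  have key2 := (PiLp.volume_preserving_ofLp (Fin 3)).integrable_comp_of_integrable key
  refine key2.congr (Eventually.of_forall fun x => ?_)
  simp only [Function.comp, Fin.prod_univ_three]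
  rw [Real.norm_of_nonneg (K3_nonneg _ _ _ _)]
  unfold K3
  have a0 : 0 ≤ tp M α ‖x 0‖ := tp_nonneg (norm_nonneg _)
  have a1 : 0 ≤ tp M 0 ‖x 1‖ := tp_nonneg (norm_nonneg _)
  have a2 : 0 ≤ tp M' 0 ‖x 2‖ := tp_nonneg (norm_nonneg _)
  rw [Real.mul_rpow (mul_nonneg a0 a1) a2, Real.mul_rpow a0 a1]
  rw [tp_rpow _ _ (by norm_num) (norm_nonneg _), tp_rpow _ _ (by norm_num) (norm_nonneg _),
    tp_rpow _ _ (by norm_num) (norm_nonneg _)]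
  simp

lemma ae_x0 : ∀ᵐ x : V3, x 0 ≠ 0 := by
  have := Measure.ae_eval_ne (fun _ : Fin 3 => (volume : Measure ℝ)) 0 (0:ℝ)
  exact (PiLp.volume_preserving_ofLp (Fin 3)).quasiMeasurePreserving.ae this

lemma rho_K3 {R M' α : ℝ} {x : V3} (hα : 0 ≤ α) (h0 : x 0 ≠ 0) (hr : rho x < R) (hM : |x 2| < M') :
    rho x ^ (-α) ≤ K3 R M' α x := by
  have h1 : |x 0| ≤ rho x := by
    unfold rho; apply Real.abs_le_sqrt; nlinarith [sq_nonneg (x 1)]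
  have h2 : |x 1| ≤ rho x := by
    unfold rho; apply Real.abs_le_sqrt; nlinarith [sq_nonneg (x 0)]
  unfold K3 tp
  simp only [Real.norm_eq_abs]
  rw [if_pos (by linarith), if_pos (by linarith), if_pos hM]
  simp only [neg_zero, Real.rpow_zero, mul_one]
  exact rp_anti (abs_pos.2 h0) h1 hα

lemma emb_rho (y : V2) (t : ℝ) : rho (emb y t) = ‖y‖ ∧ emb y t 2 = t := by
  constructor
  · rw [EuclideanSpace.norm_eq]
    simp [rho, emb]
  · simp [emb]

lemma slice_bound {g : V3 → ℝ} {a' b' R C α s : ℝ}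
    (h : ∀ x : V3, a' ≤ x 2 → x 2 ≤ b' → 0 < rho x → rho x ≤ R → |g x| ≤ C * rho x ^ (-α))
    {t : ℝ} (ht : t ∈ Set.Icc a' b') :
    eLpNorm (fun y : V2 => g (emb y t)) (ENNReal.ofReal s) (volume.restrict (Metric.ball (0:V2) R)) ≤
      eLpNorm (fun y : V2 => C * tp R α ‖y‖) (ENNReal.ofReal s) volume := by
  refine le_trans ?_ (eLpNorm_mono_measure _ (Measure.restrict_le_self (μ := volume) (s := Metric.ball (0:V2) R)))
  apply eLpNorm_mono_ae_real
  have hne : ∀ᵐ y : V2, y ≠ 0 := by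
    exact Measure.ae_ne volume 0
  filter_upwards [ae_restrict_mem measurableSet_ball, ae_restrict_of_ae hne] with y hy hy0
  obtain ⟨e1, e2⟩ := emb_rho y t
  have hyR : ‖y‖ < R := by simpa using hy
  have := h (emb y t) (by rw [e2]; exact ht.1) (by rw [e2]; exact ht.2) (by rw [e1]; exact norm_pos_iff.2 hy0)
    (by rw [e1]; exact hyR.le)
  rw [e1] at this
  rw [Real.norm_eq_abs]
  unfold tp; rw [if_pos hyR]; exact this

lemma fderiv_norm_le {u : V3 → V3} {x : V3} (hu : DifferentiableAt ℝ u x) :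
    ‖fderiv ℝ u x‖ ≤ ∑ l, ∑ i, |pd l (fun z => u z i) x| := by
  have hpd : ∀ l i, pd l (fun z => u z i) x = fderiv ℝ u x (e3 l) i := by
    intro l i
    have h := ((EuclideanSpace.proj i : V3 →L[ℝ] ℝ).hasFDerivAt.comp x hu.hasFDerivAt)
    have h' : HasFDerivAt (fun z => u z i) ((EuclideanSpace.proj i : V3 →L[ℝ] ℝ).comp (fderiv ℝ u x)) x := h
    unfold pd; rw [h'.fderiv]; rfl
  apply ContinuousLinearMap.opNorm_le_bound _ (by positivity)
  intro y
  conv_lhs => rw [V3_eta y, map_sum]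
  refine (norm_sum_le _ _).trans ?_
  rw [Finset.sum_mul]
  apply Finset.sum_le_sum
  intro l _
  rw [map_smul, norm_smul, mul_comm]
  refine mul_le_mul ?_ (PiLp.norm_apply_le y l) (norm_nonneg _) (by positivity)
  conv_lhs => rw [V3_eta (fderiv ℝ u x (e3 l))]
  refine (norm_sum_le _ _).trans ?_
  apply Finset.sum_le_sum
  intro i _
  rw [hpd, norm_smul]
  simp [e3]

lemma omega_open (a b R : ℝ) : IsOpen (OmegaR a b R) := by
  have : OmegaR a b R = {x | a < x 2} ∩ {x | x 2 < b} ∩ {x | rho x < R} := by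
    ext x; simp [OmegaR, and_assoc]
  rw [this]
  have h2 : Continuous (fun x : V3 => x 2) := by fun_prop
  exact ((isOpen_lt continuous_const h2).inter (isOpen_lt h2 continuous_const)).inter
    (isOpen_lt rho_cont continuous_const)

lemma tendsto_aux (K : ℝ) : Tendsto (fun ε => K / Real.sqrt |Real.log ε|) (𝓝[>] (0:ℝ)) (𝓝 0) := by
  apply Tendsto.const_div_atTop
  apply Real.tendsto_sqrt_atTop.comp
  exact tendsto_abs_atBot_atTop.comp Real.tendsto_log_nhdsGT_zero

theorem main_est (R a b : ℝ) (hR : 0 < R) (hab : a < b) (hab' : 0 < a * b)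
    (u : V3 → V3) (p : V3 → ℝ)
    (hreg_u : ContDiffOn ℝ (⊤:ℕ∞) u (OmegaR a b (3 * R) \ axis3))
    (hreg_p : ContDiffOn ℝ (⊤:ℕ∞) p (OmegaR a b (3 * R) \ axis3))
    (hu_hom : ∀ x ∈ OmegaR a b (3 * R) \ axis3, ∀ lam : ℝ, 0 < lam →
      lam • x ∈ OmegaR a b (3 * R) \ axis3 → u (lam • x) = lam⁻¹ • u x)
    (hp_hom : ∀ x ∈ OmegaR a b (3 * R) \ axis3, ∀ lam : ℝ, 0 < lam →
      lam • x ∈ OmegaR a b (3 * R) \ axis3 → p (lam • x) = (lam ^ 2)⁻¹ * p x)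
    (hNS : ∀ x ∈ OmegaR a b (3 * R) \ axis3, NSEq u p x)
    (hsmall : ∀ ε > (0:ℝ), ∃ ρ > (0:ℝ), ∀ x ∈ OmegaR a b (3 * R) \ axis3,
      rho x < ρ → ‖u x‖ ≤ ε * |Real.log (rho x)|) :
    (∀ s : ℝ, 1 < s → s < 2 → ∀ a' b' : ℝ, a < a' → a' ≤ b' → b' < b →
      ∃ C : ℝ≥0∞, C ≠ ⊤ ∧ ∀ t ∈ Set.Icc a' b',
        eLpNorm (fun y : V2 => p (emb y t)) (ENNReal.ofReal s)
            (volume.restrict (Metric.ball (0:V2) R))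
          + eLpNorm (fun y : V2 => pd 0 p (emb y t)) (ENNReal.ofReal s)
            (volume.restrict (Metric.ball (0:V2) R))
          + eLpNorm (fun y : V2 => pd 1 p (emb y t)) (ENNReal.ofReal s)
            (volume.restrict (Metric.ball (0:V2) R)) ≤ C) ∧
    (∀ a' b' : ℝ, a < a' → a' < b' → b' < b →
      (∀ᶠ ε in 𝓝[>] (0:ℝ),
        eLpNorm (fun x => fderiv ℝ u x) 2
          (volume.restrict (OmegaR a' b' R \ OmegaR a' b' ε)) ≠ ⊤) ∧
      Tendsto (fun ε =>
        (eLpNorm (fun x => fderiv ℝ u x) 2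
          (volume.restrict (OmegaR a' b' R \ OmegaR a' b' ε))).toReal
          / Real.sqrt |Real.log ε|) (𝓝[>] (0:ℝ)) (𝓝 0)) := by
  constructor
  · intro s hs1 hs2 a' b' ha _ hb
    obtain ⟨δ, hδ, hδ1, hδs⟩ : ∃ δ : ℝ, 0 < δ ∧ δ < 1/16 ∧ (1 + 4 * δ) * s < 2 := by
      refine ⟨(2 - s)/32, by linarith, by linarith, by nlinarith⟩
    obtain ⟨⟨C0, hC0, h0⟩, hd, -⟩ := axis_bounds hR hab hab' hreg_u hreg_p hu_hom hp_hom hNS hsmall hδ hδ1 ha hb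
    obtain ⟨C1, hC1, h1⟩ := hd 0
    obtain ⟨C2, hC2, h2⟩ := hd 1
    refine ⟨_, ?_, fun t ht => add_le_add (add_le_add (slice_bound h0 ht) (slice_bound h1 ht)) (slice_bound h2 ht)⟩
    exact ENNReal.add_ne_top.2 ⟨ENNReal.add_ne_top.2 ⟨(memLp_V2 C0 R hs1 hδs).eLpNorm_ne_top,
      (memLp_V2 C1 R hs1 hδs).eLpNorm_ne_top⟩, (memLp_V2 C2 R hs1 hδs).eLpNorm_ne_top⟩
  · intro a' b' ha hab1 hb
    obtain ⟨-, -, hd⟩ := axis_bounds (δ := 1/32) hR hab hab' hreg_u hreg_p hu_hom hp_hom hNS hsmall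
      (by norm_num) (by norm_num) ha hb
    choose C hC h using hd
    have hM := memLp_V3 (∑ l, ∑ i, C i l) R (|a'| + |b'|) (α := 8 * (1/32)) (by norm_num)
    have key : ∀ ε > (0:ℝ), eLpNorm (fun x => fderiv ℝ u x) 2
          (volume.restrict (OmegaR a' b' R \ OmegaR a' b' ε)) ≤
        eLpNorm (fun x : V3 => (∑ l, ∑ i, C i l) * K3 R (|a'| + |b'|) (8 * (1/32)) x) 2 volume := by
      intro ε hε
      refine le_trans ?_ (eLpNorm_mono_measure _ (Measure.restrict_le_self (μ := volume) (s := OmegaR a' b' R \ OmegaR a' b' ε)))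
      apply eLpNorm_mono_ae_real
      have hmeas : MeasurableSet (OmegaR a' b' R \ OmegaR a' b' ε) :=
        (omega_open _ _ _).measurableSet.diff (omega_open _ _ _).measurableSet
      filter_upwards [ae_restrict_mem hmeas, ae_restrict_of_ae ae_x0] with x hx hx0
      obtain ⟨⟨k1, k2, k3⟩, k4⟩ := hx
      have hρ : 0 < rho x := by
        by_contra hneg
        exact k4 ⟨k1, k2, by linarith⟩
      have hO : x ∈ OmegaR a b (3*R) \ axis3 := mem_dom.2 ⟨⟨by linarith, by linarith, by linarith⟩, hρ⟩
      have hdu : DifferentiableAt ℝ u x :=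
        (hreg_u.contDiffAt ((dom_open _ _ _).mem_nhds hO)).differentiableAt (by simp)
      refine (fderiv_norm_le hdu).trans ?_
      have hx2 : |x 2| < |a'| + |b'| := by
        rw [abs_lt]
        exact ⟨by linarith [neg_abs_le a', abs_nonneg b'], by linarith [le_abs_self b', abs_nonneg a']⟩
      rw [Finset.sum_mul]
      refine Finset.sum_le_sum fun l _ => ?_
      rw [Finset.sum_mul]
      refine Finset.sum_le_sum fun i _ => ?_
      refine (h i l x k1.le k2.le hρ k3.le).trans ?_
      exact mul_le_mul_of_nonneg_left (rho_K3 (by norm_num) hx0 k3 hx2) (hC i l)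
    have hfin := hM.eLpNorm_ne_top
    constructor
    · filter_upwards [self_mem_nhdsWithin] with ε hε
      exact ne_top_of_le_ne_top hfin (key ε hε)
    · refine tendsto_of_tendsto_of_tendsto_of_le_of_le' tendsto_const_nhds (tendsto_aux
        (eLpNorm (fun x : V3 => (∑ l, ∑ i, C i l) * K3 R (|a'| + |b'|) (8 * (1/32)) x) 2 volume).toReal) ?_ ?_
      · exact Eventually.of_forall fun ε => by positivity
      · filter_upwards [self_mem_nhdsWithin] with ε hε
        exact div_le_div_of_nonneg_right (ENNReal.toReal_mono hfin (key ε hε)) (Real.sqrt_nonneg _)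

end

/-- integrability of the pressure and energy estimate near the axis (Lemma 2.3). -/
theorem pressure_and_energy_estimates (R a b : ℝ) (hR : 0 < R) (hab : a < b) (hab' : 0 < a * b)
    (u : V3 → V3) (p : V3 → ℝ)
    (hreg_u : ContDiffOn ℝ (⊤:ℕ∞) u (OmegaR a b (3 * R) \ axis3))
    (hreg_p : ContDiffOn ℝ (⊤:ℕ∞) p (OmegaR a b (3 * R) \ axis3))
    (hu_hom : ∀ x ∈ OmegaR a b (3 * R) \ axis3, ∀ lam : ℝ, 0 < lam →
      lam • x ∈ OmegaR a b (3 * R) \ axis3 → u (lam • x) = lam⁻¹ • u x)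
    (hp_hom : ∀ x ∈ OmegaR a b (3 * R) \ axis3, ∀ lam : ℝ, 0 < lam →
      lam • x ∈ OmegaR a b (3 * R) \ axis3 → p (lam • x) = (lam ^ 2)⁻¹ * p x)
    (hNS : ∀ x ∈ OmegaR a b (3 * R) \ axis3, NSEq u p x)
    (hsmall : ∀ ε > (0:ℝ), ∃ ρ > (0:ℝ), ∀ x ∈ OmegaR a b (3 * R) \ axis3,
      rho x < ρ → ‖u x‖ ≤ ε * |Real.log (rho x)|) :
    (∀ s : ℝ, 1 < s → s < 2 → ∀ a' b' : ℝ, a < a' → a' ≤ b' → b' < b →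
      ∃ C : ℝ≥0∞, C ≠ ⊤ ∧ ∀ t ∈ Set.Icc a' b',
        eLpNorm (fun y : V2 => p (emb y t)) (ENNReal.ofReal s)
            (volume.restrict (Metric.ball (0:V2) R))
          + eLpNorm (fun y : V2 => pd 0 p (emb y t)) (ENNReal.ofReal s)
            (volume.restrict (Metric.ball (0:V2) R))
          + eLpNorm (fun y : V2 => pd 1 p (emb y t)) (ENNReal.ofReal s)
            (volume.restrict (Metric.ball (0:V2) R)) ≤ C) ∧
    (∀ a' b' : ℝ, a < a' → a' < b' → b' < b →
      (∀ᶠ ε in 𝓝[>] (0:ℝ),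
        eLpNorm (fun x => fderiv ℝ u x) 2
          (volume.restrict (OmegaR a' b' R \ OmegaR a' b' ε)) ≠ ⊤) ∧
      Tendsto (fun ε =>
        (eLpNorm (fun x => fderiv ℝ u x) 2
          (volume.restrict (OmegaR a' b' R \ OmegaR a' b' ε))).toReal
          / Real.sqrt |Real.log ε|) (𝓝[>] (0:ℝ)) (𝓝 0)) := by
  exact main_est R a b hR hab hab' u p hreg_u hreg_p hu_hom hp_hom hNS hsmall
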